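/- Let T > 0 and let a, b, c, d : ℝ → ℝ be continuous T-periodic functions with b(t) > 0 and d(t) > 0 for all t ∈ [0,T], and with (1/T)∫_0^T a(t) dt > 0 and (1/T)∫_0^T c(t) dt > 0. Then there exists an integer m* ≥ 2 such that for every integer m ≥ m* the system (E): x' = x(a(t) − b(t) y), y' = y(−c(t) + d(t) x) has at least two positive subharmonic solutions of order m, (x̃_{1,m}, ỹ_{1,m}) and (x̃_{2,m}, ỹ_{2,m}), meaning: each is a positive mT-periodic solution which is not jT-periodic for any integer 1 ≤ j < m, and they do not belong to the same periodicity class, i.e. for every integer j one has (x̃_{1,m}(· + jT), ỹ_{1,m}(· + jT)) ≠ (x̃_{2,m}, ỹ_{2,m}). Moreover, for i = 1, 2: min_t x̃_{i,m}(t) → 0, min_t ỹ_{i,m}(t) → 0, max_t x̃_{i,m}(t) → +∞ and max_t ỹ_{i,m}(t) → +∞ as m → ∞ (minima and maxima taken over one period [0, mT]). -/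

import Mathlib

namespace VS
open Real Set Filter Topology MeasureTheory

/-! ### Elementary comparison lemmas -/

lemma cmp {f g f' g' : ℝ → ℝ} {s t : ℝ} (hst : s ≤ t)
    (hf : ∀ x ∈ Icc s t, HasDerivAt f (f' x) x) (hg : ∀ x ∈ Icc s t, HasDerivAt g (g' x) x)
    (h : ∀ x ∈ Ioo s t, f' x ≤ g' x) : f t - f s ≤ g t - g s := by
  have hm : MonotoneOn (fun x => g x - f x) (Icc s t) := by
    apply monotoneOn_of_deriv_nonneg (convex_Icc s t)
    · intro x hx
      exact ((hg x hx).sub (hf x hx)).continuousAt.continuousWithinAt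
    · intro x hx
      rw [interior_Icc] at hx
      have hx' := Ioo_subset_Icc_self hx
      exact ((hg x hx').sub (hf x hx')).differentiableAt.differentiableWithinAt
    · intro x hx
      rw [interior_Icc] at hx
      have hx' := Ioo_subset_Icc_self hx
      have := ((hg x hx').sub (hf x hx')).deriv
      have h2 := h x hx
      change deriv (g - f) x ≥ 0
      rw [this]; linarith
  have := hm (left_mem_Icc.2 hst) (right_mem_Icc.2 hst) hst
  simp only at this
  linarith

lemma cmp_le {f f' : ℝ → ℝ} {s t C : ℝ} (hst : s ≤ t)
    (hf : ∀ x ∈ Icc s t, HasDerivAt f (f' x) x)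
    (h : ∀ x ∈ Ioo s t, f' x ≤ C) : f t - f s ≤ C * (t - s) := by
  have := cmp (g := fun x => C * x) (g' := fun _ => C) hst hf
    (fun x _ => by simpa using (hasDerivAt_id x).const_mul C) h
  linarith

lemma cmp_ge {f f' : ℝ → ℝ} {s t C : ℝ} (hst : s ≤ t)
    (hf : ∀ x ∈ Icc s t, HasDerivAt f (f' x) x)
    (h : ∀ x ∈ Ioo s t, C ≤ f' x) : C * (t - s) ≤ f t - f s := by
  have := cmp (f := fun x => C * x) (f' := fun _ => C) hst
    (fun x _ => by simpa using (hasDerivAt_id x).const_mul C) hf h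
  linarith

/-- first zero after `α`. -/
lemma first_zero {f : ℝ → ℝ} {α β : ℝ} (hab : α ≤ β) (hf : ContinuousOn f (Icc α β))
    (h0 : f α < 0) (h1 : 0 ≤ f β) :
    ∃ τ, α < τ ∧ τ ≤ β ∧ f τ = 0 ∧ ∀ t, α ≤ t → t < τ → f t < 0 := by
  set Z := Icc α β ∩ f ⁻¹' (Ici 0) with hZ
  have hZc : IsCompact Z := by
    apply IsCompact.of_isClosed_subset isCompact_Icc _ inter_subset_left
    exact hf.preimage_isClosed_of_isClosed isClosed_Icc isClosed_Ici
  have hne : Z.Nonempty := ⟨β, ⟨hab, le_rfl⟩, h1⟩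
  obtain ⟨τ, hτ⟩ := hZc.exists_isLeast hne
  have hτ1 : α ≤ τ := hτ.1.1.1
  have hτ2 : τ ≤ β := hτ.1.1.2
  have hτ3 : 0 ≤ f τ := hτ.1.2
  have hneg : ∀ t, α ≤ t → t < τ → f t < 0 := by
    intro t ht1 ht2
    by_contra hcon
    have : τ ≤ t := hτ.2 ⟨⟨ht1, by linarith⟩, not_lt.1 hcon⟩
    linarith
  have hne' : α < τ := by
    rcases hτ1.lt_or_eq with h | h
    · exact h
    · rw [← h] at hτ3; linarith
  refine ⟨τ, hne', hτ2, ?_, hneg⟩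
  apply le_antisymm _ hτ3
  obtain ⟨z, hz, hz0⟩ := intermediate_value_Icc hτ1 (hf.mono (Icc_subset_Icc_right hτ2))
    (show (0:ℝ) ∈ Icc (f α) (f τ) from ⟨h0.le, hτ3⟩)
  rcases hz.2.lt_or_eq with h | h
  · have := hneg z hz.1 h; linarith
  · rw [← h, hz0]

/-- A bounded Lipschitz field has solutions on a symmetric interval. -/
lemma picard (f : ℝ → ℝ × ℝ → ℝ × ℝ) (t₀ n : ℝ) (hn : 0 < n) (x₀ : ℝ × ℝ) (L K : NNReal)
    (hL : ∀ t ∈ Icc (t₀ - n) (t₀ + n), ∀ x, ‖f t x‖ ≤ L)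
    (hK : ∀ t ∈ Icc (t₀ - n) (t₀ + n), LipschitzWith K (f t))
    (hc : ∀ x, Continuous fun t => f t x) :
    ∃ α : ℝ → ℝ × ℝ, α t₀ = x₀ ∧ ∀ t ∈ Ioo (t₀ - n) (t₀ + n), HasDerivAt α (f t (α t)) t := by
  have h : IsPicardLindelof f (tmin := t₀ - n) (tmax := t₀ + n)
      ⟨t₀, by constructor <;> linarith⟩ x₀ (L * ⟨n, hn.le⟩) 0 L K :=
    { lipschitzOnWith := fun t ht => (hK t ht).lipschitzOnWith
      continuousOn := fun x _ => (hc x).continuousOn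
      norm_le := fun t ht x _ => hL t ht x
      mul_max_le := by
        simp only [add_sub_cancel_left, sub_sub_cancel, max_self, NNReal.coe_zero, sub_zero]
        exact le_of_eq rfl }
  obtain ⟨α, h0, h1⟩ := h.exists_eq_forall_mem_Icc_hasDerivWithinAt₀
  refine ⟨α, h0, fun t ht => ?_⟩
  exact (h1 t (Ioo_subset_Icc_self ht)).hasDerivAt (Icc_mem_nhds ht.1 ht.2)

lemma exp_sub_le {p q N : ℝ} (hp : p ≤ N) (hq : q ≤ N) :
    |exp q - exp p| ≤ exp N * |q - p| := by
  wlog h : p ≤ q generalizing p q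
  · rw [abs_sub_comm, abs_sub_comm q p]; exact this hq hp (le_of_not_ge h)
  rw [abs_of_nonneg (sub_nonneg.2 (exp_le_exp.2 h)), abs_of_nonneg (sub_nonneg.2 h)]
  have h1 := add_one_le_exp (p - q)
  have h2 : exp p = exp q * exp (p - q) := by rw [← exp_add]; ring_nf
  have h3 : exp q - exp p ≤ exp q * (q - p) := by
    rw [h2]; nlinarith [exp_pos q]
  have h4 : exp q ≤ exp N := exp_le_exp.2 hq
  nlinarith

/-! ### The system -/

structure Sys where
  a : ℝ
  c : ℝ
  b : ℝ → ℝ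
  d : ℝ → ℝ
  T : ℝ
  k : ℝ
  M : ℝ
  hT : 0 < T
  hk : 0 < k
  hk1 : k ≤ 1
  hM : 1 ≤ M
  ka : k ≤ a
  aM : a ≤ M
  kc : k ≤ c
  cM : c ≤ M
  bc : Continuous b
  dc : Continuous d
  bp : ∀ t, b (t + T) = b t
  dp : ∀ t, d (t + T) = d t
  kb : ∀ t, k ≤ b t
  bM : ∀ t, b t ≤ M
  kd : ∀ t, k ≤ d t
  dM : ∀ t, d t ≤ M

namespace Sys
variable (S : Sys)

lemma b_pos (t : ℝ) : 0 < S.b t := S.hk.trans_le (S.kb t)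
lemma d_pos (t : ℝ) : 0 < S.d t := S.hk.trans_le (S.kd t)
lemma a_pos : 0 < S.a := S.hk.trans_le S.ka
lemma c_pos : 0 < S.c := S.hk.trans_le S.kc
lemma M_pos : 0 < S.M := zero_lt_one.trans_le S.hM

/-- time reversal and swap of the components -/
def mir : Sys where
  a := S.c
  c := S.a
  b := fun t => S.d (-t)
  d := fun t => S.b (-t)
  T := S.T
  k := S.k
  M := S.M
  hT := S.hT
  hk := S.hk
  hk1 := S.hk1
  hM := S.hM
  ka := S.kc
  aM := S.cM
  kc := S.ka
  cM := S.aM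
  bc := S.dc.comp continuous_neg
  dc := S.bc.comp continuous_neg
  bp := fun t => by rw [← S.dp (-(t + S.T))]; ring_nf
  dp := fun t => by rw [← S.bp (-(t + S.T))]; ring_nf
  kb := fun t => S.kd _
  bM := fun t => S.dM _
  kd := fun t => S.kb _
  dM := fun t => S.bM _

/-- global solutions in logarithmic coordinates -/
def Sol (u v : ℝ → ℝ) : Prop :=
  ∀ t, HasDerivAt u (S.a - S.b t * exp (v t)) t ∧ HasDerivAt v (-S.c + S.d t * exp (u t)) t

variable {S} {u v : ℝ → ℝ}

lemma Sol.mir (h : S.Sol u v) : S.mir.Sol (fun t => v (-t)) (fun t => u (-t)) := by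
  intro t
  have h1 := ((h (-t)).2).comp t (hasDerivAt_neg t)
  have h2 := ((h (-t)).1).comp t (hasDerivAt_neg t)
  constructor
  · refine HasDerivAt.congr_deriv h1 ?_
    change _ = S.c - S.d (-t) * exp (u (-t))
    ring
  · refine HasDerivAt.congr_deriv h2 ?_
    change _ = -S.a + S.b (-t) * exp (v (-t))
    ring

lemma Sol.shift (h : S.Sol u v) : S.Sol (fun t => u (t + S.T)) (fun t => v (t + S.T)) := by
  intro t
  have h1 := ((h (t + S.T)).1).comp_add_const t S.T
  have h2 := ((h (t + S.T)).2).comp_add_const t S.T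
  rw [S.bp] at h1
  rw [S.dp] at h2
  exact ⟨h1, h2⟩

lemma Sol.cu (h : S.Sol u v) : Continuous u :=
  continuous_iff_continuousAt.2 fun t => (h t).1.continuousAt
lemma Sol.cv (h : S.Sol u v) : Continuous v :=
  continuous_iff_continuousAt.2 fun t => (h t).2.continuousAt

lemma Sol.u_le (h : S.Sol u v) {s t : ℝ} (hst : s ≤ t) : u t ≤ u s + S.a * (t - s) := by
  have := cmp_le (C := S.a) hst (fun x _ => (h x).1)
    (fun x _ => by have := mul_pos (S.b_pos x) (exp_pos (v x)); linarith)
  linarith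

lemma Sol.v_ge (h : S.Sol u v) {s t : ℝ} (hst : s ≤ t) : v s - S.c * (t - s) ≤ v t := by
  have := cmp_ge (C := -S.c) hst (fun x _ => (h x).2)
    (fun x _ => by have := mul_pos (S.d_pos x) (exp_pos (u x)); linarith)
  linarith

lemma Sol.bound_fwd (S : Sys) (B ℓ : ℝ) (hℓ : 0 ≤ ℓ) (hB : 0 ≤ B) :
    ∃ C, 0 ≤ C ∧ ∀ (S' : Sys), S'.M = S.M → ∀ u v t₀, S'.Sol u v → |u t₀| ≤ B → |v t₀| ≤ B →
      ∀ t, t₀ ≤ t → t ≤ t₀ + ℓ → |u t| ≤ C ∧ |v t| ≤ C := by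
  have hM := S.M_pos
  set C1 := B + S.M * ℓ + exp (B + S.M * ℓ) * S.M * ℓ with hC1
  have hC1' : 0 ≤ C1 := by positivity
  refine ⟨C1 + exp C1 * S.M * ℓ, by positivity, ?_⟩
  intro S' hS' u v t₀ h hu hv t ht ht2
  rw [abs_le] at hu hv
  have hu1 : ∀ x, t₀ ≤ x → x ≤ t → u x ≤ B + S.M * ℓ := by
    intro x hx hx2
    have h1 := h.u_le hx
    have h2 : S'.a * (x - t₀) ≤ S.M * ℓ := by
      rw [← hS']
      exact mul_le_mul S'.aM (by linarith) (by linarith) S'.M_pos.le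
    linarith
  have hv1 : ∀ x, t₀ ≤ x → x ≤ t → -(B + S.M * ℓ) ≤ v x := by
    intro x hx hx2
    have h1 := h.v_ge hx
    have h2 : S'.c * (x - t₀) ≤ S.M * ℓ := by
      rw [← hS']
      exact mul_le_mul S'.cM (by linarith) (by linarith) S'.M_pos.le
    linarith
  have hv2 : ∀ x, t₀ ≤ x → x ≤ t → v x ≤ C1 := by
    intro x hx hx2
    have := cmp_le (C := exp (B + S.M * ℓ) * S.M) hx (fun y _ => (h y).2)
      (fun y hy => by
        have e1 : exp (u y) ≤ exp (B + S.M * ℓ) :=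
          exp_le_exp.2 (hu1 y hy.1.le (hy.2.le.trans hx2))
        have e2 : S'.d y * exp (u y) ≤ S.M * exp (B + S.M * ℓ) := by
          rw [← hS'] at e1 ⊢
          exact mul_le_mul (S'.dM y) e1 (exp_pos _).le S'.M_pos.le
        linarith [S'.c_pos])
    have h3 : exp (B + S.M * ℓ) * S.M * (x - t₀) ≤ exp (B + S.M * ℓ) * S.M * ℓ :=
      mul_le_mul_of_nonneg_left (by linarith) (by positivity)
    have h4 : 0 ≤ S.M * ℓ := by positivity
    linarith
  have hu2 : -(C1 + exp C1 * S.M * ℓ) ≤ u t := by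
    have := cmp_ge (C := -(exp C1 * S.M)) ht (fun y _ => (h y).1)
      (fun y hy => by
        have e1 : exp (v y) ≤ exp C1 := exp_le_exp.2 (hv2 y hy.1.le hy.2.le)
        have e2 : S'.b y * exp (v y) ≤ S.M * exp C1 := by
          rw [← hS']
          exact mul_le_mul (S'.bM y) e1 (exp_pos _).le S'.M_pos.le
        linarith [S'.a_pos])
    have h3 : exp C1 * S.M * (t - t₀) ≤ exp C1 * S.M * ℓ :=
      mul_le_mul_of_nonneg_left (by linarith) (by positivity)
    have h4 : 0 ≤ S.M * ℓ := by positivity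
    have h5 : 0 ≤ exp (B + S.M * ℓ) * S.M * ℓ := by positivity
    linarith
  have h4 : 0 ≤ S.M * ℓ := by positivity
  have h5 : 0 ≤ exp (B + S.M * ℓ) * S.M * ℓ := by positivity
  have h6 : 0 ≤ exp C1 * S.M * ℓ := by positivity
  have h7 := hu1 t ht le_rfl
  have h8 := hv1 t ht le_rfl
  have h9 := hv2 t ht le_rfl
  rw [abs_le, abs_le]
  refine ⟨⟨hu2, by linarith⟩, ⟨by linarith, by linarith⟩⟩

lemma Sol.bound (S : Sys) (B ℓ : ℝ) (hℓ : 0 ≤ ℓ) (hB : 0 ≤ B) :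
    ∃ C, 0 ≤ C ∧ ∀ u v t₀, S.Sol u v → |u t₀| ≤ B → |v t₀| ≤ B →
      ∀ t, |t - t₀| ≤ ℓ → |u t| ≤ C ∧ |v t| ≤ C := by
  obtain ⟨C, hC, H⟩ := Sol.bound_fwd S B ℓ hℓ hB
  refine ⟨C, hC, ?_⟩
  intro u v t₀ h hu hv t ht
  rw [abs_le] at ht
  rcases le_total t₀ t with h1 | h1
  · exact H S rfl u v t₀ h hu hv t h1 (by linarith)
  · have := H S.mir rfl _ _ (-t₀) h.mir (by simpa using hv) (by simpa using hu) (-t)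
      (by linarith) (by linarith)
    simp only [neg_neg] at this
    exact this.symm

lemma Sol.lip_fwd (S : Sys) {u v u₂ v₂ : ℝ → ℝ} {t₀ t₁ C : ℝ} (h : S.Sol u v)
    (h₂ : S.Sol u₂ v₂) 
    (hu : ∀ t ∈ Icc t₀ t₁, |u t| ≤ C ∧ |v t| ≤ C) (hu₂ : ∀ t ∈ Icc t₀ t₁, |u₂ t| ≤ C ∧ |v₂ t| ≤ C) :
    ∀ t ∈ Icc t₀ t₁, max |u₂ t - u t| |v₂ t - v t| ≤
      max |u₂ t₀ - u t₀| |v₂ t₀ - v t₀| * exp (S.M * exp C * (t - t₀)) := by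
  set f : ℝ → ℝ × ℝ := fun t => (u₂ t - u t, v₂ t - v t) with hf
  set f' : ℝ → ℝ × ℝ := fun t => ((S.a - S.b t * exp (v₂ t)) - (S.a - S.b t * exp (v t)),
    (-S.c + S.d t * exp (u₂ t)) - (-S.c + S.d t * exp (u t))) with hf'
  have hfd : ∀ t, HasDerivAt f (f' t) t := fun t =>
    (((h₂ t).1.sub (h t).1).prodMk ((h₂ t).2.sub (h t).2))
  have := norm_le_gronwallBound_of_norm_deriv_right_le (f := f) (f' := f')
    (δ := ‖f t₀‖) (K := S.M * exp C) (ε := 0) (a := t₀) (b := t₁)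
    (fun t _ => (hfd t).continuousAt.continuousWithinAt)
    (fun t _ => (hfd t).hasDerivWithinAt) le_rfl
    (by
      intro t ht
      have ht' := Ico_subset_Icc_self ht
      have b1 := hu t ht'
      have b2 := hu₂ t ht'
      simp only [abs_le] at b1 b2
      have e1 := exp_sub_le (N := C) b1.1.2 b2.1.2
      have e2 := exp_sub_le (N := C) b1.2.2 b2.2.2
      rw [hf, hf', Prod.norm_def, Prod.norm_def]
      simp only [norm_eq_abs, add_zero]
      apply max_le
      · have : (S.a - S.b t * exp (v₂ t)) - (S.a - S.b t * exp (v t))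
          = - (S.b t * (exp (v₂ t) - exp (v t))) := by ring
        rw [this, abs_neg, abs_mul, abs_of_pos (S.b_pos t), mul_assoc]
        apply mul_le_mul (S.bM t) _ (abs_nonneg _) S.M_pos.le
        exact e2.trans (mul_le_mul_of_nonneg_left (le_max_right _ _) (exp_pos _).le)
      · have : (-S.c + S.d t * exp (u₂ t)) - (-S.c + S.d t * exp (u t))
          = (S.d t * (exp (u₂ t) - exp (u t))) := by ring
        rw [this, abs_mul, abs_of_pos (S.d_pos t), mul_assoc]
        apply mul_le_mul (S.dM t) _ (abs_nonneg _) S.M_pos.le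
        exact e1.trans (mul_le_mul_of_nonneg_left (le_max_left _ _) (exp_pos _).le))
  intro t ht
  have := this t ht
  rw [gronwallBound_ε0] at this
  simpa [hf, Prod.norm_def] using this

lemma Sol.lip (S : Sys) (B ℓ : ℝ) (hℓ : 0 ≤ ℓ) (hB : 0 ≤ B) :
    ∃ C, 1 ≤ C ∧ ∀ u v u₂ v₂ t₀, S.Sol u v → S.Sol u₂ v₂ → |u t₀| ≤ B → |v t₀| ≤ B →
      |u₂ t₀| ≤ B → |v₂ t₀| ≤ B → ∀ t, |t - t₀| ≤ ℓ → 
      |u t| ≤ C ∧ |v t| ≤ C ∧ 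
      max |u₂ t - u t| |v₂ t - v t| ≤ C * max |u₂ t₀ - u t₀| |v₂ t₀ - v t₀| := by
  obtain ⟨C, hC, H⟩ := Sol.bound S B ℓ hℓ hB
  have hM := S.M_pos
  refine ⟨max (max 1 C) (exp (S.M * exp C * ℓ)), by simp, ?_⟩
  intro u v u₂ v₂ t₀ h h₂ hu hv hu₂ hv₂ t ht
  have hh := H u v t₀ h hu hv
  have hh₂ := H u₂ v₂ t₀ h₂ hu₂ hv₂
  have b := hh t ht
  refine ⟨b.1.trans (by simp), b.2.trans (by simp), ?_⟩
  rw [abs_le] at ht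
  have key : max |u₂ t - u t| |v₂ t - v t| ≤
      max |u₂ t₀ - u t₀| |v₂ t₀ - v t₀| * exp (S.M * exp C * |t - t₀|) := by
    rcases le_total t₀ t with h1 | h1
    · have := Sol.lip_fwd S (t₀ := t₀) (t₁ := t) (C := C) h h₂ 
        (fun x hx => hh x (by rw [abs_le]; constructor <;> linarith [hx.1, hx.2]))
        (fun x hx => hh₂ x (by rw [abs_le]; constructor <;> linarith [hx.1, hx.2])) t ⟨h1, le_rfl⟩
      rwa [abs_of_nonneg (sub_nonneg.2 h1)]
    · have := Sol.lip_fwd S.mir (t₀ := -t₀) (t₁ := -t) (C := C) h.mir h₂.mir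
        (fun x hx => (hh (-x) (by rw [abs_le]; constructor <;> linarith [hx.1, hx.2])).symm)
        (fun x hx => (hh₂ (-x) (by rw [abs_le]; constructor <;> linarith [hx.1, hx.2])).symm) 
        (-t) ⟨by linarith, le_rfl⟩
      simp only [neg_neg] at this
      rw [max_comm, abs_of_nonpos (sub_nonpos.2 h1), max_comm |u₂ t₀ - u t₀|, neg_sub]
      rw [neg_sub_neg] at this
      exact this
  refine key.trans ?_
  rw [mul_comm]
  apply mul_le_mul_of_nonneg_right _ (le_max_of_le_left (abs_nonneg _))
  refine le_trans ?_ (le_max_right _ _)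
  apply exp_le_exp.2
  apply mul_le_mul_of_nonneg_left _ (by positivity)
  rw [abs_le]; exact ht

lemma Sol.unique {u₂ v₂ : ℝ → ℝ} {t₀ : ℝ} (h : S.Sol u v) (h₂ : S.Sol u₂ v₂)
    (hu : u t₀ = u₂ t₀) (hv : v t₀ = v₂ t₀) : ∀ t, u t = u₂ t ∧ v t = v₂ t := by
  intro t
  obtain ⟨C, -, H⟩ := Sol.lip S (|u t₀| + |v t₀|) |t - t₀| (abs_nonneg _) (by positivity)
  have e1 := abs_nonneg (u t₀)
  have e2 := abs_nonneg (v t₀)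
  have := (H u v u₂ v₂ t₀ h h₂ (by linarith) (by linarith) (by rw [← hu]; linarith)
    (by rw [← hv]; linarith) t le_rfl).2.2
  rw [hu, hv] at this
  simp only [sub_self, abs_zero, max_self, mul_zero] at this
  have h1 := (le_max_left _ _).trans this
  have h2 := (le_max_right _ _).trans this
  rw [abs_nonpos_iff] at h1 h2
  constructor <;> linarith

end Sys
end VS

namespace VS
open Real Set Filter Topology MeasureTheory
namespace Sys
variable (S : Sys)

noncomputable def fld (t : ℝ) (p : ℝ × ℝ) : ℝ × ℝ :=
  (S.a - S.b t * exp p.2, -S.c + S.d t * exp p.1)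

lemma exp_min_lip (N p q : ℝ) : |exp (min q N) - exp (min p N)| ≤ exp N * |q - p| := by
  refine (exp_sub_le (min_le_right _ _) (min_le_right _ _)).trans ?_
  apply mul_le_mul_of_nonneg_left _ (exp_pos _).le
  have := abs_min_sub_min_le_max q N p N
  simpa using this

lemma prod_lip {f : ℝ × ℝ → ℝ × ℝ} {K : ℝ} {s : Set (ℝ × ℝ)} (hK : 0 ≤ K)
    (h1 : ∀ p ∈ s, ∀ q ∈ s, |(f q).1 - (f p).1| ≤ K * |q.2 - p.2|)
    (h2 : ∀ p ∈ s, ∀ q ∈ s, |(f q).2 - (f p).2| ≤ K * |q.1 - p.1|) :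
    LipschitzOnWith ⟨K, hK⟩ f s := by
  apply LipschitzOnWith.of_dist_le_mul
  intro p hp q hq
  rw [Prod.dist_eq, Prod.dist_eq]
  simp only [Real.dist_eq]
  change _ ≤ K * _
  apply max_le
  · exact (h1 q hq p hp).trans (mul_le_mul_of_nonneg_left (le_max_right _ _) hK)
  · exact (h2 q hq p hp).trans (mul_le_mul_of_nonneg_left (le_max_left _ _) hK)

lemma loc_exists (t₀ u₀ v₀ n : ℝ) (hn : 0 < n) :
    ∃ (α : ℝ → ℝ × ℝ) (N : ℝ), α t₀ = (u₀, v₀) ∧ ∀ t ∈ Ioo (t₀ - n) (t₀ + n),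
      HasDerivAt α (S.fld t (α t)) t ∧ (α t).1 ≤ N ∧ (α t).2 ≤ N := by
  have hM := S.M_pos
  set N1 := |u₀| + |v₀| + S.M * n with hN1
  set N := N1 + n * (exp N1 * S.M) with hN
  have hKpos : 0 ≤ S.M * exp N := by positivity
  have hLpos : 0 ≤ S.M + S.M * exp N := by positivity
  set f : ℝ → ℝ × ℝ → ℝ × ℝ := fun t p =>
    (S.a - S.b t * exp (min p.2 N), -S.c + S.d t * exp (min p.1 N)) with hf
  have hemin : ∀ x, exp (min x N) ≤ exp N := fun x => exp_le_exp.2 (min_le_right _ _)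
  obtain ⟨α, h0, hα⟩ := picard f t₀ n hn (u₀, v₀) ⟨_, hLpos⟩ ⟨_, hKpos⟩
    (by
      intro t _ x
      rw [hf, Prod.norm_def]
      change _ ≤ S.M + S.M * exp N
      simp only [norm_eq_abs]
      have e1 : S.b t * exp (min x.2 N) ≤ S.M * exp N :=
        mul_le_mul (S.bM t) (hemin _) (exp_pos _).le hM.le
      have e2 : S.d t * exp (min x.1 N) ≤ S.M * exp N :=
        mul_le_mul (S.dM t) (hemin _) (exp_pos _).le hM.le
      have e3 := mul_pos (S.b_pos t) (exp_pos (min x.2 N))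
      have e4 := mul_pos (S.d_pos t) (exp_pos (min x.1 N))
      have := S.aM
      have := S.cM
      have := S.a_pos
      have := S.c_pos
      apply max_le <;> rw [abs_le] <;> constructor <;> linarith)
    (by
      intro t _
      refine lipschitzOnWith_univ.1 ?_
      apply prod_lip
      · intro p _ q _
        have : (f t q).1 - (f t p).1 = -(S.b t * (exp (min q.2 N) - exp (min p.2 N))) := by
          simp only [hf]; ring
        rw [this, abs_neg, abs_mul, abs_of_pos (S.b_pos t), mul_assoc]
        exact mul_le_mul (S.bM t) (exp_min_lip _ _ _) (abs_nonneg _) hM.le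
      · intro p _ q _
        have : (f t q).2 - (f t p).2 = (S.d t * (exp (min q.1 N) - exp (min p.1 N))) := by
          simp only [hf]; ring
        rw [this, abs_mul, abs_of_pos (S.d_pos t), mul_assoc]
        exact mul_le_mul (S.dM t) (exp_min_lip _ _ _) (abs_nonneg _) hM.le)
    (by
      intro x
      have := S.bc
      have := S.dc
      simp only [hf]
      fun_prop)
  refine ⟨α, N, h0, ?_⟩
  have d1 : ∀ t ∈ Ioo (t₀ - n) (t₀ + n), HasDerivAt (fun t => (α t).1)
      (S.a - S.b t * exp (min (α t).2 N)) t := fun t ht => (hα t ht).fst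
  have d2 : ∀ t ∈ Ioo (t₀ - n) (t₀ + n), HasDerivAt (fun t => (α t).2)
      (-S.c + S.d t * exp (min (α t).1 N)) t := fun t ht => (hα t ht).snd
  have hu0 : (α t₀).1 ≤ |u₀| := by rw [h0]; exact le_abs_self _
  have hv0 : (α t₀).2 ≤ |v₀| := by rw [h0]; exact le_abs_self _
  have au := abs_nonneg u₀
  have av := abs_nonneg v₀
  have hMn : 0 ≤ S.M * n := by positivity
  have hNN : 0 ≤ n * (exp N1 * S.M) := by positivity
  have f1 : ∀ t, t₀ ≤ t → t < t₀ + n → (α t).1 ≤ N1 := by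
    intro t ht ht2
    have := cmp_le (C := S.a) ht (fun x hx => d1 x ⟨by linarith [hx.1], by linarith [hx.2]⟩)
      (fun x _ => by have := mul_pos (S.b_pos x) (exp_pos (min (α x).2 N)); linarith)
    have h2 : S.a * (t - t₀) ≤ S.M * n :=
      mul_le_mul S.aM (by linarith) (by linarith) hM.le
    linarith
  have g1 : ∀ t, t ≤ t₀ → t₀ - n < t → (α t).2 ≤ N1 := by
    intro t ht ht2
    have := cmp_ge (C := -S.c) ht (fun x hx => d2 x ⟨by linarith [hx.1], by linarith [hx.2]⟩)
      (fun x _ => by have := mul_pos (S.d_pos x) (exp_pos (min (α x).1 N)); linarith)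
    have h2 : S.c * (t₀ - t) ≤ S.M * n :=
      mul_le_mul S.cM (by linarith) (by linarith) hM.le
    linarith
  have f2 : ∀ t, t₀ ≤ t → t < t₀ + n → (α t).2 ≤ N := by
    intro t ht ht2
    have := cmp_le (C := exp N1 * S.M) ht
      (fun x hx => d2 x ⟨by linarith [hx.1], by linarith [hx.2]⟩)
      (fun x hx => by
        have e1 : exp (min (α x).1 N) ≤ exp N1 := exp_le_exp.2
          ((min_le_left _ _).trans (f1 x hx.1.le (by linarith [hx.2])))
        have := mul_le_mul (S.dM x) e1 (exp_pos _).le hM.le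
        linarith [S.c_pos])
    have h2 : exp N1 * S.M * (t - t₀) ≤ exp N1 * S.M * n :=
      mul_le_mul_of_nonneg_left (by linarith) (by positivity)
    linarith
  have g2 : ∀ t, t ≤ t₀ → t₀ - n < t → (α t).1 ≤ N := by
    intro t ht ht2
    have := cmp_ge (C := -(exp N1 * S.M)) ht
      (fun x hx => d1 x ⟨by linarith [hx.1], by linarith [hx.2]⟩)
      (fun x hx => by
        have e1 : exp (min (α x).2 N) ≤ exp N1 := exp_le_exp.2
          ((min_le_left _ _).trans (g1 x hx.2.le (by linarith [hx.1])))
        have := mul_le_mul (S.bM x) e1 (exp_pos _).le hM.le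
        linarith [S.a_pos])
    have h2 : exp N1 * S.M * (t₀ - t) ≤ exp N1 * S.M * n :=
      mul_le_mul_of_nonneg_left (by linarith) (by positivity)
    linarith
  intro t ht
  have B : (α t).1 ≤ N ∧ (α t).2 ≤ N := by
    rcases le_total t₀ t with h | h
    · exact ⟨(f1 t h ht.2).trans (by linarith), f2 t h ht.2⟩
    · exact ⟨g2 t h ht.1, (g1 t h ht.1).trans (by linarith)⟩
  refine ⟨?_, B⟩
  have := hα t ht
  simp only [hf, min_eq_left B.1, min_eq_left B.2] at this
  exact this

lemma fld_lip (t N : ℝ) : LipschitzOnWith ⟨S.M * exp N, by have := S.M_pos; positivity⟩ (S.fld t)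
    {p | p.1 ≤ N ∧ p.2 ≤ N} := by
  have hM := S.M_pos
  apply prod_lip
  · intro p hp q hq
    have : (S.fld t q).1 - (S.fld t p).1 = -(S.b t * (exp q.2 - exp p.2)) := by
      simp only [fld]; ring
    rw [this, abs_neg, abs_mul, abs_of_pos (S.b_pos t), mul_assoc]
    exact mul_le_mul (S.bM t) (exp_sub_le hp.2 hq.2) (abs_nonneg _) hM.le
  · intro p hp q hq
    have : (S.fld t q).2 - (S.fld t p).2 = (S.d t * (exp q.1 - exp p.1)) := by
      simp only [fld]; ring
    rw [this, abs_mul, abs_of_pos (S.d_pos t), mul_assoc]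
    exact mul_le_mul (S.dM t) (exp_sub_le hp.1 hq.1) (abs_nonneg _) hM.le

theorem exists_sol (t₀ u₀ v₀ : ℝ) : ∃ u v, S.Sol u v ∧ u t₀ = u₀ ∧ v t₀ = v₀ := by
  have H := fun n : ℕ => S.loc_exists t₀ u₀ v₀ (n + 1) (by positivity)
  choose α N h0 hα using H
  have key : ∀ n m : ℕ, n ≤ m → ∀ t ∈ Ioo (t₀ - (n + 1)) (t₀ + (n + 1)), α n t = α m t := by
    intro n m hnm
    have hc : (n : ℝ) ≤ m := by exact_mod_cast hnm
    apply ODE_solution_unique_of_mem_Ioo (v := S.fld) (t₀ := t₀)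
      (s := fun _ => {p | p.1 ≤ max (N n) (N m) ∧ p.2 ≤ max (N n) (N m)})
      (fun t _ => S.fld_lip t (max (N n) (N m)))
    · have : (0 : ℝ) ≤ n := by positivity
      constructor <;> linarith
    · intro t ht
      obtain ⟨h1, h2, h3⟩ := hα n t ht
      exact ⟨h1, h2.trans (le_max_left _ _), h3.trans (le_max_left _ _)⟩
    · intro t ht
      obtain ⟨h1, h2, h3⟩ := hα m t ⟨by linarith [ht.1], by linarith [ht.2]⟩
      exact ⟨h1, h2.trans (le_max_right _ _), h3.trans (le_max_right _ _)⟩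
    · rw [h0, h0]
  set z : ℝ → ℝ × ℝ := fun t => α ⌈|t - t₀|⌉₊ t with hz
  have hzn : ∀ n : ℕ, ∀ t ∈ Ioo (t₀ - n) (t₀ + n), z t = α n t := by
    intro n t ht
    apply key
    · apply Nat.ceil_le.2
      rw [abs_le]; constructor <;> linarith [ht.1, ht.2]
    · have := Nat.le_ceil |t - t₀|
      rw [abs_le] at this
      constructor <;> linarith [this.1, this.2]
  have hd : ∀ t, HasDerivAt z (S.fld t (z t)) t := by
    intro t
    obtain ⟨n, hn⟩ := exists_nat_gt |t - t₀|
    rw [abs_lt] at hn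
    have ht : t ∈ Ioo (t₀ - (n : ℝ)) (t₀ + n) := ⟨by linarith [hn.1], by linarith [hn.2]⟩
    rw [hzn n t ht]
    have := (hα n t ⟨by linarith [ht.1], by linarith [ht.2]⟩).1
    apply this.congr_of_eventuallyEq
    filter_upwards [Ioo_mem_nhds ht.1 ht.2] with x hx
    exact hzn n x hx
  have hz0 : z t₀ = (u₀, v₀) := by rw [hz]; exact h0 _
  refine ⟨fun t => (z t).1, fun t => (z t).2, fun t => ⟨(hd t).fst, (hd t).snd⟩, ?_, ?_⟩
  · simp [hz0]
  · simp [hz0]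

/-- first component of the solution that equals `(r, r)` at time `s` -/
noncomputable def uu (s r : ℝ) : ℝ → ℝ := (S.exists_sol s r r).choose
/-- second component of the solution that equals `(r, r)` at time `s` -/
noncomputable def vv (s r : ℝ) : ℝ → ℝ := (S.exists_sol s r r).choose_spec.choose

lemma sol (s r : ℝ) : S.Sol (S.uu s r) (S.vv s r) :=
  (S.exists_sol s r r).choose_spec.choose_spec.1
@[simp] lemma uu_self (s r : ℝ) : S.uu s r s = r :=
  (S.exists_sol s r r).choose_spec.choose_spec.2.1
@[simp] lemma vv_self (s r : ℝ) : S.vv s r s = r :=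
  (S.exists_sol s r r).choose_spec.choose_spec.2.2

lemma flow_per (s r t : ℝ) : S.uu (s + S.T) r (t + S.T) = S.uu s r t ∧
    S.vv (s + S.T) r (t + S.T) = S.vv s r t :=
  (S.sol (s + S.T) r).shift.unique (S.sol s r) (t₀ := s) (by simp) (by simp) t

/-- Lipschitz dependence on the initial data -/
lemma flow_lip (B ℓ : ℝ) (hB : 0 ≤ B) (hℓ : 0 ≤ ℓ) : ∃ C, 1 ≤ C ∧ ∀ s₀ s r₀ r,
    |r₀| ≤ B → |r| ≤ B → |s - s₀| ≤ 1 → ∀ t, |t - s₀| ≤ ℓ →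
    |S.uu s r t - S.uu s₀ r₀ t| ≤ C * (|s - s₀| + |r - r₀|) ∧
    |S.vv s r t - S.vv s₀ r₀ t| ≤ C * (|s - s₀| + |r - r₀|) ∧
    |S.uu s r t| ≤ C ∧ |S.vv s r t| ≤ C := by
  obtain ⟨C1, hC1, H1⟩ := Sol.bound S B 1 zero_le_one hB
  obtain ⟨C2, hC2, H2⟩ := Sol.lip S (max B C1) (ℓ + 1) (by linarith) (le_max_of_le_left hB)
  have hM := S.M_pos
  set D := S.M + S.M * exp C1 with hD
  have hDpos : 0 ≤ D := by positivity
  refine ⟨C2 * (1 + D), by nlinarith, ?_⟩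
  intro s₀ s r₀ r hr₀ hr hs t ht
  have hsol := S.sol s₀ r₀
  -- the base solution moves little between s₀ and s
  have hb := H1 _ _ s₀ hsol (by simpa using hr₀) (by simpa using hr₀)
  have hconv : Convex ℝ (uIcc s₀ s) := convex_uIcc _ _
  have hin : ∀ x ∈ uIcc s₀ s, |x - s₀| ≤ 1 := fun x hx =>
    (abs_sub_left_of_mem_uIcc hx).trans hs
  have m1 : ‖S.uu s₀ r₀ s - S.uu s₀ r₀ s₀‖ ≤ D * ‖s - s₀‖ := by
    apply hconv.norm_image_sub_le_of_norm_hasDerivWithin_le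
      (fun x _ => (hsol x).1.hasDerivWithinAt) _ left_mem_uIcc right_mem_uIcc
    intro x hx
    have e := (abs_le.1 (hb x (hin x hx)).2).2
    have e1 := mul_le_mul (S.bM x) (exp_le_exp.2 e) (exp_pos _).le hM.le
    have e2 := mul_pos (S.b_pos x) (exp_pos (S.vv s₀ r₀ x))
    rw [norm_eq_abs, abs_le]
    have := S.aM; have := S.a_pos
    constructor <;> linarith
  have m2 : ‖S.vv s₀ r₀ s - S.vv s₀ r₀ s₀‖ ≤ D * ‖s - s₀‖ := by
    apply hconv.norm_image_sub_le_of_norm_hasDerivWithin_le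
      (fun x _ => (hsol x).2.hasDerivWithinAt) _ left_mem_uIcc right_mem_uIcc
    intro x hx
    have e := (abs_le.1 (hb x (hin x hx)).1).2
    have e1 := mul_le_mul (S.dM x) (exp_le_exp.2 e) (exp_pos _).le hM.le
    have e2 := mul_pos (S.d_pos x) (exp_pos (S.uu s₀ r₀ x))
    rw [norm_eq_abs, abs_le]
    have := S.cM; have := S.c_pos
    constructor <;> linarith
  rw [uu_self, norm_eq_abs, norm_eq_abs] at m1
  rw [vv_self, norm_eq_abs, norm_eq_abs] at m2
  have hbs := hb s hs
  have ht' : |t - s| ≤ ℓ + 1 := by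
    have := abs_sub_le t s₀ s
    rw [abs_sub_comm s₀ s] at this
    linarith
  have hrr := hr.trans (le_max_left B C1)
  have K := H2 _ _ _ _ s hsol (S.sol s r) (hbs.1.trans (le_max_right _ _))
    (hbs.2.trans (le_max_right _ _)) (by simpa using hrr) (by simpa using hrr) t ht'
  have K2 := H2 _ _ _ _ s (S.sol s r) hsol (by simpa using hrr) (by simpa using hrr)
    (hbs.1.trans (le_max_right _ _)) (hbs.2.trans (le_max_right _ _)) t ht'
  have n1 : |r - S.uu s₀ r₀ s| ≤ |r - r₀| + D * |s - s₀| := by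
    have := abs_sub_le r r₀ (S.uu s₀ r₀ s)
    rw [abs_sub_comm r₀] at this
    linarith
  have n2 : |r - S.vv s₀ r₀ s| ≤ |r - r₀| + D * |s - s₀| := by
    have := abs_sub_le r r₀ (S.vv s₀ r₀ s)
    rw [abs_sub_comm r₀] at this
    linarith
  have K3 := K.2.2
  rw [uu_self, vv_self] at K3
  have K4 : C2 * max |r - S.uu s₀ r₀ s| |r - S.vv s₀ r₀ s| ≤
      C2 * (1 + D) * (|s - s₀| + |r - r₀|) := by
    rw [mul_assoc]
    apply mul_le_mul_of_nonneg_left _ (by linarith)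
    have p1 := abs_nonneg (s - s₀)
    have p2 := abs_nonneg (r - r₀)
    have p3 := mul_nonneg hDpos p2
    apply max_le <;> nlinarith
  have K5 : C2 ≤ C2 * (1 + D) := by nlinarith
  exact ⟨(le_max_left _ _).trans (K3.trans K4), (le_max_right _ _).trans (K3.trans K4),
    K2.1.trans K5, K2.2.1.trans K5⟩

end Sys

/-! ### Linear systems -/

/-- `(P, Q)` solves `P' = -β Q`, `Q' = δ P` on `[s, t]`. -/
def Lin (β δ P Q : ℝ → ℝ) (s t : ℝ) : Prop :=
  ∀ x ∈ Icc s t, HasDerivAt P (-(β x * Q x)) x ∧ HasDerivAt Q (δ x * P x) x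

lemma Lin.mir {β δ P Q : ℝ → ℝ} {s t : ℝ} (h : Lin β δ P Q s t) :
    Lin (fun x => δ (-x)) (fun x => β (-x)) (fun x => Q (-x)) (fun x => P (-x)) (-t) (-s) := by
  intro x hx
  have hx' : -x ∈ Icc s t := ⟨by linarith [hx.2], by linarith [hx.1]⟩
  have h1 := ((h (-x) hx').2).comp x (hasDerivAt_neg x)
  have h2 := ((h (-x) hx').1).comp x (hasDerivAt_neg x)
  constructor
  · refine HasDerivAt.congr_deriv h1 ?_
    ring
  · refine HasDerivAt.congr_deriv h2 ?_
    ring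

lemma Lin.wedge {β δ P Q U V : ℝ → ℝ} {s t : ℝ} (h : Lin β δ P Q s t) (h' : Lin β δ U V s t)
    (hst : s ≤ t) : U t * Q t - V t * P t = U s * Q s - V s * P s := by
  have hd : ∀ x ∈ Icc s t, HasDerivAt (fun x => U x * Q x - V x * P x) 0 x := by
    intro x hx
    have := ((h' x hx).1.mul (h x hx).2).sub ((h' x hx).2.mul (h x hx).1)
    refine HasDerivAt.congr_deriv this ?_
    ring
  have h1 := cmp_le (C := 0) hst hd (fun x _ => le_rfl)
  have h2 := cmp_ge (C := 0) hst hd (fun x _ => le_rfl)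
  simp only [zero_mul] at h1 h2
  linarith

lemma lin_exists (β δ : ℝ → ℝ) (hβ : Continuous β) (hδ : Continuous δ) (t₀ t₁ p q : ℝ)
    (h01 : t₀ ≤ t₁) : ∃ P Q, Lin β δ P Q t₀ t₁ ∧ P t₀ = p ∧ Q t₀ = q := by
  set n := t₁ - t₀ + 1 with hn
  have hnpos : 0 < n := by linarith
  obtain ⟨Λ1, hΛ1⟩ := isCompact_Icc.exists_bound_of_continuousOn
    (hβ.continuousOn (s := Icc (t₀ - n) (t₀ + n)))
  obtain ⟨Λ2, hΛ2⟩ := isCompact_Icc.exists_bound_of_continuousOn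
    (hδ.continuousOn (s := Icc (t₀ - n) (t₀ + n)))
  set Λ := max Λ1 Λ2 with hΛ
  have hb : ∀ t ∈ Icc (t₀ - n) (t₀ + n), |β t| ≤ Λ := fun t ht =>
    (hΛ1 t ht).trans (le_max_left _ _)
  have hd : ∀ t ∈ Icc (t₀ - n) (t₀ + n), |δ t| ≤ Λ := fun t ht =>
    (hΛ2 t ht).trans (le_max_right _ _)
  have hΛ0 : 0 ≤ Λ := (abs_nonneg _).trans (hb t₀ ⟨by linarith, by linarith⟩)
  set N := ‖((p, q) : ℝ × ℝ)‖ * exp (Λ * n) with hN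
  have hN0 : 0 ≤ N := by positivity
  set cl : ℝ → ℝ := fun x => max (-N) (min x N) with hcl
  have hcl1 : ∀ x, |cl x| ≤ N := by
    intro x
    rw [abs_le]
    exact ⟨le_max_left _ _, max_le (by linarith) (min_le_right _ _)⟩
  have hcl2 : ∀ x y, |cl x - cl y| ≤ |x - y| := by
    intro x y
    have h1 := abs_max_sub_max_le_max (-N) (min x N) (-N) (min y N)
    have h2 := abs_min_sub_min_le_max x N y N
    simp only [sub_self, abs_zero, abs_nonneg, sup_of_le_left, sup_of_le_right] at h1 h2
    exact h1.trans h2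
  have hcl3 : ∀ x, |cl x| ≤ |x| := by
    intro x
    have := hcl2 x 0
    have h0 : cl 0 = 0 := by simp [hcl, hN0]
    simpa [h0] using this
  have hcl4 : ∀ x, |x| ≤ N → cl x = x := by
    intro x hx
    rw [abs_le] at hx
    simp [hcl, hx.1, hx.2]
  set f : ℝ → ℝ × ℝ → ℝ × ℝ := fun t x => (-(β t * cl x.2), δ t * cl x.1) with hf
  have hL0 : 0 ≤ Λ * N := by positivity
  obtain ⟨α, h0, hα⟩ := picard f t₀ n hnpos (p, q) ⟨_, hL0⟩ ⟨_, hΛ0⟩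
    (by
      intro t ht x
      rw [hf, Prod.norm_def]
      change _ ≤ Λ * N
      simp only [norm_eq_abs, abs_neg, abs_mul]
      exact max_le (mul_le_mul (hb t ht) (hcl1 _) (abs_nonneg _) hΛ0)
        (mul_le_mul (hd t ht) (hcl1 _) (abs_nonneg _) hΛ0))
    (by
      intro t ht
      refine lipschitzOnWith_univ.1 ?_
      apply Sys.prod_lip
      · intro x _ y _
        have : (f t y).1 - (f t x).1 = -(β t * (cl y.2 - cl x.2)) := by simp only [hf]; ring
        rw [this, abs_neg, abs_mul]
        exact mul_le_mul (hb t ht) (hcl2 _ _) (abs_nonneg _) hΛ0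
      · intro x _ y _
        have : (f t y).2 - (f t x).2 = (δ t * (cl y.1 - cl x.1)) := by simp only [hf]; ring
        rw [this, abs_mul]
        exact mul_le_mul (hd t ht) (hcl2 _ _) (abs_nonneg _) hΛ0)
    (by
      intro x
      simp only [hf]
      fun_prop)
  have G := norm_le_gronwallBound_of_norm_deriv_right_le (f := α) (f' := fun t => f t (α t))
    (δ := ‖α t₀‖) (K := Λ) (ε := 0) (a := t₀) (b := t₁)
    (fun t ht => (hα t ⟨by linarith [ht.1], by linarith [ht.2]⟩).continuousAt.continuousWithinAt)
    (fun t ht => (hα t ⟨by linarith [ht.1], by linarith [ht.2]⟩).hasDerivWithinAt) le_rfl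
    (by
      intro t ht
      have ht' : t ∈ Icc (t₀ - n) (t₀ + n) := ⟨by linarith [ht.1], by linarith [ht.2]⟩
      rw [hf, Prod.norm_def, Prod.norm_def]
      simp only [norm_eq_abs, abs_neg, abs_mul, add_zero]
      exact max_le (mul_le_mul (hb t ht') ((hcl3 _).trans (le_max_right _ _)) (abs_nonneg _) hΛ0)
        (mul_le_mul (hd t ht') ((hcl3 _).trans (le_max_left _ _)) (abs_nonneg _) hΛ0))
  refine ⟨fun t => (α t).1, fun t => (α t).2, ?_, by simp [h0], by simp [h0]⟩
  intro t ht
  have g := G t ht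
  rw [gronwallBound_ε0, h0] at g
  have g2 : ‖α t‖ ≤ N := by
    refine g.trans (mul_le_mul_of_nonneg_left ?_ (norm_nonneg _))
    apply exp_le_exp.2
    exact mul_le_mul_of_nonneg_left (by linarith [ht.2]) hΛ0
  have g3 : |(α t).1| ≤ N := (norm_fst_le _).trans g2
  have g4 : |(α t).2| ≤ N := (norm_snd_le _).trans g2
  have := hα t ⟨by linarith [ht.1], by linarith [ht.2]⟩
  simp only [hf, hcl4 _ g3, hcl4 _ g4] at this
  exact ⟨this.fst, this.snd⟩

end VS

namespace VS
open Real Set Filter Topology MeasureTheory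
namespace Sys
variable (S : Sys)

/-- constants -/
noncomputable def w : ℝ := S.k ^ 2 / (512 * S.M ^ 2)
noncomputable def Cc : ℝ := 4 * S.M / S.k
noncomputable def U0 : ℝ := log (2 * S.M / S.k)
noncomputable def t1 : ℝ := 1 / (2 * S.M)
noncomputable def κ : ℝ := S.k / 4

/-- `r` is large -/
def Big (r : ℝ) : Prop := 1 ≤ r ∧ S.Cc < exp r ∧ r + S.Cc + S.U0 ≤ S.w * exp r

lemma w_pos : 0 < S.w := by have := S.hk; have := S.M_pos; unfold w; positivity
lemma Cc_pos : 0 < S.Cc := by have := S.hk; have := S.M_pos; unfold Cc; positivity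
lemma t1_pos : 0 < S.t1 := by have := S.hk; have := S.M_pos; unfold t1; positivity
lemma κ_pos : 0 < S.κ := by have := S.hk; unfold κ; positivity
lemma U0_nonneg : 0 ≤ S.U0 := by
  apply log_nonneg
  rw [le_div_iff₀ S.hk]
  linarith [S.hk1, S.hM]
lemma Cc_κ : S.Cc * S.κ = S.M := by
  have := S.hk.ne'
  unfold Cc κ; field_simp
lemma t1_M : S.M * S.t1 = 1 / 2 := by
  have := S.M_pos.ne'
  unfold t1; field_simp
lemma w_eq : S.w * (64 * S.M) = S.k * S.κ * S.t1 := by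
  have := S.M_pos.ne'
  unfold w κ t1; field_simp; ring
lemma w_le : 64 * S.w ≤ S.κ * S.t1 := by
  have h1 := S.w_eq
  have h2 : S.k * (S.κ * S.t1) ≤ 1 * (S.κ * S.t1) :=
    mul_le_mul_of_nonneg_right S.hk1 (mul_pos S.κ_pos S.t1_pos).le
  nlinarith [S.w_pos, S.hM]
lemma exp_U0 : S.M * exp (-S.U0) = S.k / 2 := by
  have := S.M_pos
  have := S.hk
  rw [U0, exp_neg, exp_log (by positivity)]
  field_simp

lemma tendsto_lin_exp (p q : ℝ) (hq : 0 < q) : ∀ᶠ r : ℝ in atTop, r + p ≤ q * exp r := by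
  have h := (tendsto_exp_div_pow_atTop 1).eventually (eventually_ge_atTop ((1 + |p|) / q))
  filter_upwards [h, eventually_ge_atTop (1:ℝ)] with r hr h1
  rw [pow_one, le_div_iff₀ (by linarith), div_mul_eq_mul_div, div_le_iff₀ hq] at hr
  have := le_abs_self p
  have := abs_nonneg p
  nlinarith

lemma big_ev : ∀ᶠ r in atTop, S.Big r := by
  filter_upwards [eventually_ge_atTop (1:ℝ), tendsto_exp_atTop.eventually_gt_atTop S.Cc,
    tendsto_lin_exp (S.Cc + S.U0) S.w S.w_pos] with r h1 h2 h3
  exact ⟨h1, h2, by linarith⟩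

variable {S} {u v : ℝ → ℝ} {s r τ : ℝ}

lemma exp_neg_half_ge : (1:ℝ) / 2 ≤ exp (-(1/2)) := by
  have := add_one_le_exp (-(1/2) : ℝ)
  linarith

lemma y_ge (h : S.Sol u v) (hv : v s = r) {t : ℝ} (hst : s ≤ t) (ht : t ≤ s + S.t1) :
    exp r / 2 ≤ exp (v t) := by
  have h1 := h.v_ge hst
  have h2 : S.c * (t - s) ≤ S.M * S.t1 :=
    mul_le_mul S.cM (by linarith) (by linarith) S.M_pos.le
  rw [S.t1_M] at h2
  have h3 : r + -(1/2) ≤ v t := by linarith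
  have h4 := exp_le_exp.2 h3
  rw [exp_add] at h4
  have := exp_neg_half_ge
  nlinarith [exp_pos r]

lemma u_le_fast (h : S.Sol u v) (hu : u s = r) (hv : v s = r) (hB : S.Big r) {t : ℝ} (hst : s ≤ t)
    (ht : t ≤ s + S.t1) : u t ≤ r - S.κ * exp r * (t - s) := by
  have := cmp_le (C := -(S.κ * exp r)) hst (fun x _ => (h x).1) (by
    intro x hx
    have h1 := y_ge h hv hx.1.le (hx.2.le.trans ht)
    have h2 : S.k * (exp r / 2) ≤ S.b x * exp (v x) :=
      mul_le_mul (S.kb x) h1 (by positivity) (S.b_pos x).le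
    have h3 := hB.2.1
    have h4 := mul_lt_mul_of_pos_right h3 S.κ_pos
    rw [S.Cc_κ] at h4
    have := S.aM
    have h5 : S.κ = S.k / 4 := rfl
    rw [h5] at h4 ⊢
    linarith)
  linarith

lemma v_le_fast (h : S.Sol u v) (hu : u s = r) (hv : v s = r) (hB : S.Big r) {t : ℝ} (hst : s ≤ t)
    (ht : t ≤ s + S.t1) : v t ≤ r + S.Cc := by
  have hκ := S.κ_pos
  have hd : ∀ x, HasDerivAt (fun x => -(S.Cc * exp (-(S.κ * exp r * (x - s)))))
      (S.M * (exp r * exp (-(S.κ * exp r * (x - s))))) x := by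
    intro x
    have h1 : HasDerivAt (fun x => -(S.κ * exp r * (x - s))) (-(S.κ * exp r)) x :=
      HasDerivAt.congr_deriv (((hasDerivAt_id x).sub_const s).const_mul (S.κ * exp r)).neg
        (by ring)
    refine HasDerivAt.congr_deriv ((h1.exp.const_mul S.Cc).neg) ?_
    rw [← S.Cc_κ]; ring
  have := cmp hst (fun x _ => (h x).2) (fun x _ => hd x) (by
    intro x hx
    have h1 := u_le_fast h hu hv hB hx.1.le (hx.2.le.trans ht)
    have h2 := exp_le_exp.2 h1
    rw [sub_eq_add_neg, exp_add] at h2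
    have h3 := mul_le_mul (S.dM x) h2 (exp_pos _).le S.M_pos.le
    linarith [S.c_pos])
  simp only [sub_self, mul_zero, neg_zero, exp_zero] at this
  have h4 : 0 < S.Cc * exp (-(S.κ * exp r * (t - s))) := mul_pos S.Cc_pos (exp_pos _)
  linarith

lemma G_neg_fast (h : S.Sol u v) (hu : u s = r) (hv : v s = r) (hB : S.Big r) {t : ℝ} (hst : s < t)
    (ht : t ≤ s + S.t1) : u t < v t := by
  have h1 := u_le_fast h hu hv hB hst.le ht
  have h2 := h.v_ge hst.le
  have h4 := mul_lt_mul_of_pos_right hB.2.1 S.κ_pos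
  rw [S.Cc_κ] at h4
  have h5 := S.cM
  nlinarith

/-- slow part: `v` decreases -/
lemma v_le_slow (h : S.Sol u v) (hu : u s = r) (hv : v s = r) (hB : S.Big r)
    (hG : ∀ t ∈ Icc (s + S.t1) τ, u t ≤ v t) {t : ℝ} (ht : t ∈ Icc (s + S.t1) τ) :
    v t ≤ r + S.Cc - S.k / 4 * (t - s - S.t1) := by
  have hk := S.hk
  have ht1 := S.t1_pos
  have hw := S.w_pos
  refine image_le_of_deriv_right_lt_deriv_boundary (a := s + S.t1) (b := τ)
    (f := v) (f' := fun x => -S.c + S.d x * exp (u x))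
    (B := fun x => r + S.Cc - S.k / 4 * (x - s - S.t1)) (B' := fun _ => -(S.k / 4))
    h.cv.continuousOn (fun x _ => (h x).2.hasDerivWithinAt) ?_ ?_ ?_ ht
  · have := v_le_fast h hu hv hB (t := s + S.t1) (by linarith) le_rfl
    simpa using this
  · intro x
    have := ((((hasDerivAt_id x).sub_const s).sub_const S.t1).const_mul (S.k / 4)).const_sub
      (r + S.Cc)
    simpa using this
  · intro x hx hxv
    have hE := exp_pos r
    have key : u x ≤ -S.U0 := by
      rcases le_total (S.M * (x - s - S.t1)) (S.κ * exp r * S.t1 / 4) with hc | hc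
      · have h1 := u_le_fast h hu hv hB (t := s + S.t1) (by linarith) le_rfl
        have h2 := h.u_le hx.1
        have h3 : S.a * (x - (s + S.t1)) ≤ S.M * (x - (s + S.t1)) :=
          mul_le_mul_of_nonneg_right S.aM (by linarith [hx.1])
        have h4 := mul_le_mul_of_nonneg_right S.w_le hE.le
        have h5 := hB.2.2
        have h6 := S.Cc_pos
        nlinarith
      · have h1 := hG x (Ico_subset_Icc_self hx)
        have h5 := hB.2.2
        have h3 : 4 * (S.w * exp r) ≤ S.k / 4 * (x - s - S.t1) := by
          have h4 := S.w_eq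
          have h6 := mul_le_mul_of_nonneg_left hc hk.le
          have h7 : S.k * (S.κ * exp r * S.t1 / 4) = (S.w * (64 * S.M)) * exp r / 4 := by
            rw [h4]; ring
          rw [h7] at h6
          have hM := S.M_pos
          by_contra hcon
          push Not at hcon
          have := mul_lt_mul_of_pos_left hcon hM
          nlinarith
        have : 0 < S.w * exp r := by positivity
        linarith
    have h1 := mul_le_mul (S.dM x) (exp_le_exp.2 key) (exp_pos _).le S.M_pos.le
    rw [S.exp_U0] at h1
    have := S.kc
    change -S.c + S.d x * exp (u x) < _
    linarith

lemma u_le_slow (h : S.Sol u v) (hu : u s = r) (hv : v s = r) (hB : S.Big r)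
    (hG : ∀ t ∈ Icc (s + S.t1) τ, u t ≤ v t) {t : ℝ} (ht : t ∈ Icc (s + S.t1) τ) :
    u t ≤ -(S.w * exp r) - S.k / 8 * (t - s - S.t1) := by
  have hk := S.hk
  have hk1 := S.hk1
  have hM := S.hM
  have ht1 := S.t1_pos
  have hw := S.w_pos
  have hE := exp_pos r
  have hU := S.U0_nonneg
  have hC := S.Cc_pos
  have h5 := hB.2.2
  rcases le_total (S.M * (t - s - S.t1)) (S.κ * exp r * S.t1 / 4) with hc | hc
  · have h1 := u_le_fast h hu hv hB (t := s + S.t1) (by linarith) le_rfl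
    have h2 := h.u_le ht.1
    have h3 : S.a * (t - (s + S.t1)) ≤ S.M * (t - (s + S.t1)) :=
      mul_le_mul_of_nonneg_right S.aM (by linarith [ht.1])
    have h4 := mul_le_mul_of_nonneg_right S.w_le hE.le
    have h6 : S.k / 8 * (t - s - S.t1) ≤ S.M * (t - s - S.t1) / 8 := by
      have := mul_le_mul_of_nonneg_right (hk1.trans hM) (show 0 ≤ t - s - S.t1 by linarith [ht.1])
      linarith
    nlinarith
  · have h1 := hG t ht
    have h0 := v_le_slow h hu hv hB hG ht
    have h3 : 2 * (S.w * exp r) ≤ S.k / 8 * (t - s - S.t1) := by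
      have h4 := S.w_eq
      have h6 := mul_le_mul_of_nonneg_left hc hk.le
      have h7 : S.k * (S.κ * exp r * S.t1 / 4) = (S.w * (64 * S.M)) * exp r / 4 := by
        rw [h4]; ring
      rw [h7] at h6
      by_contra hcon
      push Not at hcon
      have := mul_lt_mul_of_pos_left hcon S.M_pos
      nlinarith
    linarith

lemma v_le_all (h : S.Sol u v) (hu : u s = r) (hv : v s = r) (hB : S.Big r)
    (hG : ∀ t ∈ Icc (s + S.t1) τ, u t ≤ v t) {t : ℝ} (ht : t ∈ Icc s τ) :
    v t ≤ r + S.Cc := by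
  rcases le_total t (s + S.t1) with h1 | h1
  · exact v_le_fast h hu hv hB ht.1 h1
  · have := v_le_slow h hu hv hB hG ⟨h1, ht.2⟩
    have h2 : 0 ≤ S.k / 4 * (t - s - S.t1) :=
      mul_nonneg (by linarith [S.hk]) (by linarith)
    linarith

lemma down_exists (h : S.Sol u v) (hu : u s = r) (hv : v s = r) (hB : S.Big r) :
    ∃ τ, s + S.t1 < τ ∧ u τ = v τ ∧ ∀ t, s < t → t < τ → u t < v t := by
  have hk := S.hk
  have ht1 := S.t1_pos
  have h0 : u (s + S.t1) - v (s + S.t1) < 0 := by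
    linarith [G_neg_fast h hu hv hB (t := s + S.t1) (by linarith) le_rfl]
  have hcont : Continuous fun t => u t - v t := h.cu.sub h.cv
  have hex : ∃ β, s + S.t1 ≤ β ∧ 0 ≤ u β - v β := by
    by_contra hcon
    push Not at hcon
    set θ := (r + S.Cc + S.U0) * 4 / S.k with hθ
    have hθ0 : 0 ≤ θ := by
      have := hB.1; have := S.Cc_pos; have := S.U0_nonneg
      positivity
    set p := s + S.t1 + θ with hp
    have hd : ∀ x, p ≤ x → S.k ≤ (S.a - S.b x * exp (v x)) - (-S.c + S.d x * exp (u x)) := by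
      intro x hx
      have hx1 : s + S.t1 ≤ x := by linarith
      have h1 := v_le_slow h hu hv hB (τ := x) (fun t ht => by linarith [hcon t ht.1])
        ⟨hx1, le_rfl⟩
      have h2 : S.k / 4 * θ = r + S.Cc + S.U0 := by rw [hθ]; field_simp
      have h3 : S.k / 4 * θ ≤ S.k / 4 * (x - s - S.t1) :=
        mul_le_mul_of_nonneg_left (by linarith) (by linarith)
      have h4 : v x ≤ -S.U0 := by linarith
      have h5 : u x ≤ -S.U0 := by linarith [hcon x hx1]
      have h6 := mul_le_mul (S.bM x) (exp_le_exp.2 h4) (exp_pos _).le S.M_pos.le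
      have h7 := mul_le_mul (S.dM x) (exp_le_exp.2 h5) (exp_pos _).le S.M_pos.le
      rw [S.exp_U0] at h6 h7
      linarith [S.ka, S.kc]
    set q := p + (v p - u p) / S.k with hq
    have hp1 := hcon p (by linarith)
    have hpq : p ≤ q := by
      have : 0 ≤ (v p - u p) / S.k := div_nonneg (by linarith) hk.le
      linarith
    have := cmp_ge (C := S.k) hpq (fun x _ => (h x).1.sub (h x).2) (fun x hx => hd x hx.1.le)
    have h2 : S.k * (q - p) = v p - u p := by rw [hq]; field_simp; ring
    have h3 := hcon q (by linarith)
    simp only [Pi.sub_apply] at this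
    linarith
  obtain ⟨β, hβ, hβ2⟩ := hex
  obtain ⟨τ, h1, -, h3, h4⟩ := first_zero hβ hcont.continuousOn h0 hβ2
  refine ⟨τ, h1, by linarith, ?_⟩
  intro t hst htτ
  rcases le_total t (s + S.t1) with h5 | h5
  · exact G_neg_fast h hu hv hB hst h5
  · linarith [h4 t h5 htτ]

end Sys
end VS

namespace VS
open Real Set Filter Topology MeasureTheory

lemma per_unif {f : ℝ → ℝ} {T : ℝ} (hT : 0 < T) (hf : Continuous f) (hp : ∀ t, f (t + T) = f t)
    {ε : ℝ} (hε : 0 < ε) : ∃ η > 0, ∀ s t, |t - s| ≤ η → |f t - f s| ≤ ε := by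
  have hu := isCompact_Icc.uniformContinuousOn_of_continuous
    (hf.continuousOn (s := Icc (-1) (T + 1)))
  rw [Metric.uniformContinuousOn_iff_le] at hu
  obtain ⟨η, hη, H⟩ := hu ε hε
  refine ⟨min η 1, by positivity, ?_⟩
  intro s t hst
  have hp' : Function.Periodic f T := hp
  set n := ⌊s / T⌋ with hn
  have h1 : (n : ℝ) * T ≤ s := by
    have := Int.floor_le (s / T)
    rwa [le_div_iff₀ hT] at this
  have h2 : s < (n : ℝ) * T + T := by
    have := Int.lt_floor_add_one (s / T)
    rw [div_lt_iff₀ hT] at this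
    linarith
  have e1 := hp'.sub_zsmul_eq n (x := s)
  have e2 := hp'.sub_zsmul_eq n (x := t)
  rw [zsmul_eq_mul] at e1 e2
  rw [← e1, ← e2]
  have hst1 := hst.trans (min_le_left _ _)
  have hst2 := hst.trans (min_le_right _ _)
  rw [abs_le] at hst2
  have := H (t - n * T) ⟨by linarith, by linarith⟩ (s - n * T) ⟨by linarith, by linarith⟩
    (by rw [Real.dist_eq, sub_sub_sub_cancel_right]; exact hst1)
  rwa [Real.dist_eq] at this

lemma exp_hasDeriv (A l p x : ℝ) (hl : 0 < l) :
    HasDerivAt (fun x => -(A / l * exp (-(l * (x - p))))) (A * exp (-(l * (x - p)))) x := by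
  have h1 : HasDerivAt (fun x => -(l * (x - p))) (-l) x :=
    HasDerivAt.congr_deriv (((hasDerivAt_id x).sub_const p).const_mul l).neg (by ring)
  refine HasDerivAt.congr_deriv ((h1.exp.const_mul (A / l)).neg) ?_
  field_simp

lemma exp_cmp_le {f f' : ℝ → ℝ} {p q A l : ℝ} (hpq : p ≤ q) (hA : 0 ≤ A) (hl : 0 < l)
    (hf : ∀ x ∈ Icc p q, HasDerivAt f (f' x) x)
    (h : ∀ x ∈ Ioo p q, f' x ≤ A * exp (-(l * (x - p)))) : f q - f p ≤ A / l := by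
  have := cmp hpq hf (fun x _ => exp_hasDeriv A l p x hl) h
  simp only [sub_self, mul_zero, neg_zero, exp_zero] at this
  have : 0 ≤ A / l * exp (-(l * (q - p))) := by positivity
  linarith

lemma exp_cmp_ge {f f' : ℝ → ℝ} {p q A l : ℝ} (hpq : p ≤ q) (hA : 0 ≤ A) (hl : 0 < l)
    (hf : ∀ x ∈ Icc p q, HasDerivAt f (f' x) x)
    (h : ∀ x ∈ Ioo p q, -(A * exp (-(l * (x - p)))) ≤ f' x) : -(A / l) ≤ f q - f p := by
  have := exp_cmp_le hpq hA hl (fun x hx => (hf x hx).neg) (fun x hx => by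
    have := h x hx; linarith)
  simp only [Pi.neg_apply] at this
  linarith

lemma poly_exp {p q l ζ : ℝ} (hp : 0 ≤ p) (hq : 0 ≤ q) (hl : 0 < l) (hζ : 0 ≤ ζ) :
    (p + q * ζ) * exp (-(l * ζ)) ≤ (p + 2 * q / l) * exp (-(l / 2 * ζ)) := by
  have h1 : exp (-(l * ζ)) = exp (-(l / 2 * ζ)) * exp (-(l / 2 * ζ)) := by
    rw [← exp_add]; ring_nf
  rw [h1, ← mul_assoc]
  apply mul_le_mul_of_nonneg_right _ (exp_pos _).le
  have h2 := add_one_le_exp (l / 2 * ζ)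
  have h3 : exp (l / 2 * ζ) * exp (-(l / 2 * ζ)) = 1 := by rw [← exp_add]; simp
  have h4 : 0 ≤ l / 2 * ζ := by positivity
  have h5 : p + q * ζ ≤ (p + 2 * q / l) * exp (l / 2 * ζ) := by
    have e1 : p * 1 ≤ p * exp (l / 2 * ζ) := mul_le_mul_of_nonneg_left (by linarith) hp
    have e2 : 2 * q / l * (l / 2 * ζ) ≤ 2 * q / l * exp (l / 2 * ζ) :=
      mul_le_mul_of_nonneg_left (by linarith) (by positivity)
    have e3 : 2 * q / l * (l / 2 * ζ) = q * ζ := by field_simp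
    linarith
  have h6 := mul_le_mul_of_nonneg_right h5 (exp_pos (-(l / 2 * ζ))).le
  rwa [mul_assoc, h3, mul_one] at h6

namespace Sys
variable (S : Sys)
noncomputable def C0 : ℝ := 1 + 6 * S.Cc
noncomputable def C3 : ℝ := 2 * S.M * exp S.Cc * S.C0
noncomputable def C6 : ℝ := 1 + S.C0 + 2 * S.C3 / S.κ
noncomputable def κ0 : ℝ := exp (-S.Cc) / 2

lemma C0_pos : 0 < S.C0 := by have := S.Cc_pos; unfold C0; positivity
lemma C3_pos : 0 < S.C3 := by have := S.C0_pos; have := S.M_pos; unfold C3; positivity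
lemma C6_pos : 0 < S.C6 := by
  have := S.C0_pos; have := S.C3_pos; have := S.κ_pos; unfold C6; positivity
lemma κ0_pos : 0 < S.κ0 := by unfold κ0; positivity
lemma κ0_le : S.κ0 ≤ 1 := by
  have : exp (-S.Cc) ≤ 1 := exp_le_one_iff.2 (by linarith [S.Cc_pos])
  unfold κ0; linarith

structure HC (u v β δ U V : ℝ → ℝ) (s τ r ε : ℝ) : Prop where
  sol : S.Sol u v
  hu : u s = r
  hv : v s = r
  big : S.Big r
  le : s + S.t1 ≤ τ
  hG : ∀ t ∈ Icc (s + S.t1) τ, u t ≤ v t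
  lin : Lin β δ U V s τ
  U1 : U s = 1
  V1 : V s = 1
  ε0 : 0 ≤ ε
  ε1 : ε ≤ 1 / 2
  hβ : ∀ t ∈ Icc s τ, |β t - S.b t * exp (v t)| ≤ ε * (S.b t * exp (v t))
  hδ : ∀ t ∈ Icc s τ, |δ t - S.d t * exp (u t)| ≤ ε * (S.d t * exp (u t))

variable {S} {u v β δ U V : ℝ → ℝ} {s τ r ε q : ℝ}

namespace HC
variable (H : S.HC u v β δ U V s τ r ε)
include H

lemma β_lo {t : ℝ} (ht : t ∈ Icc s τ) : S.k / 2 * exp (v t) ≤ β t := by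
  have h := (abs_le.1 (H.hβ t ht)).1
  have h1 := mul_le_mul_of_nonneg_right (S.kb t) (exp_pos (v t)).le
  have h2 := mul_le_mul_of_nonneg_right H.ε1 (mul_pos (S.b_pos t) (exp_pos (v t))).le
  linarith

lemma β_pos {t : ℝ} (ht : t ∈ Icc s τ) : 0 < β t := by
  have := H.β_lo ht
  have := mul_pos (half_pos S.hk) (exp_pos (v t))
  linarith

lemma δ_pos {t : ℝ} (ht : t ∈ Icc s τ) : 0 < δ t := by
  have h := (abs_le.1 (H.hδ t ht)).1
  have h1 := mul_pos (S.d_pos t) (exp_pos (u t))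
  have h2 := mul_le_mul_of_nonneg_right H.ε1 h1.le
  linarith

lemma δ_le {t : ℝ} (ht : t ∈ Icc s τ) : δ t ≤ 2 * S.M * exp (u t) := by
  have h := (abs_le.1 (H.hδ t ht)).2
  have h1 := mul_pos (S.d_pos t) (exp_pos (u t))
  have h2 := mul_le_mul_of_nonneg_right H.ε1 h1.le
  have h3 := mul_le_mul_of_nonneg_right (S.dM t) (exp_pos (u t)).le
  linarith

lemma y_le {t : ℝ} (ht : t ∈ Icc s τ) : exp (v t) ≤ exp S.Cc * exp r := by
  rw [← exp_add]
  apply exp_le_exp.2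
  linarith [v_le_all H.sol H.hu H.hv H.big H.hG ht]

lemma β_le {t : ℝ} (ht : t ∈ Icc s τ) : β t ≤ 2 * S.M * (exp S.Cc * exp r) := by
  have h := (abs_le.1 (H.hβ t ht)).2
  have h1 := mul_pos (S.b_pos t) (exp_pos (v t))
  have h2 := mul_le_mul_of_nonneg_right H.ε1 h1.le
  have h3 := mul_le_mul (S.bM t) (H.y_le ht) (exp_pos (v t)).le S.M_pos.le
  linarith

lemma x_fast {t : ℝ} (h1 : s ≤ t) (h2 : t ≤ s + S.t1) :
    exp (u t) ≤ exp r * exp (-(S.κ * exp r * (t - s))) := by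
  rw [← exp_add]
  apply exp_le_exp.2
  linarith [u_le_fast H.sol H.hu H.hv H.big h1 h2]

lemma x_slow {t : ℝ} (h1 : s + S.t1 ≤ t) (h2 : t ≤ τ) :
    exp (u t) ≤ exp (-(S.w * exp r)) * exp (-(S.k / 8 * (t - (s + S.t1)))) := by
  rw [← exp_add]
  apply exp_le_exp.2
  linarith [u_le_slow H.sol H.hu H.hv H.big H.hG ⟨h1, h2⟩]

section
variable (hq : q ∈ Icc s τ) (hV : ∀ t ∈ Icc s q, 0 ≤ V t)
include hq hV

lemma U_anti {p t : ℝ} (hp : s ≤ p) (hpt : p ≤ t) (ht : t ≤ q) : U t ≤ U p := by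
  have := cmp_le (C := 0) hpt
    (fun x hx => (H.lin x ⟨by linarith [hx.1], by linarith [hx.2, hq.2]⟩).1)
    (fun x hx => by
      have h1 := H.β_pos (t := x) ⟨by linarith [hx.1], by linarith [hx.2, hq.2]⟩
      have h2 := hV x ⟨by linarith [hx.1], by linarith [hx.2, hq.2]⟩
      have := mul_nonneg h1.le h2
      linarith)
  linarith

lemma U_le {t : ℝ} (ht : t ∈ Icc s q) : U t ≤ 1 := by
  have := H.U_anti hq hV le_rfl ht.1 ht.2
  rwa [H.U1] at this

lemma V'_le {t : ℝ} (ht : t ∈ Icc s q) : δ t * U t ≤ 2 * S.M * exp (u t) := by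
  have h1 := H.U_le hq hV ht
  have ht' : t ∈ Icc s τ := ⟨ht.1, ht.2.trans hq.2⟩
  have h2 := H.δ_pos ht'
  have h3 := H.δ_le ht'
  nlinarith

lemma V_fast {t : ℝ} (ht : t ∈ Icc s q) (ht1 : t ≤ s + S.t1) : V t ≤ 1 + 2 * S.Cc := by
  have hM := S.M_pos
  have hκ := S.κ_pos
  have := exp_cmp_le (A := 2 * S.M * exp r) (l := S.κ * exp r) ht.1 (by positivity) (by positivity)
    (fun x hx => (H.lin x ⟨hx.1, hx.2.trans (ht.2.trans hq.2)⟩).2) (fun x hx => by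
      have h1 := H.V'_le hq hV ⟨hx.1.le, hx.2.le.trans ht.2⟩
      have h2 := H.x_fast hx.1.le (hx.2.le.trans ht1)
      have h3 := mul_le_mul_of_nonneg_left h2 (show 0 ≤ 2 * S.M by positivity)
      linarith)
  have h2 : 2 * S.M * exp r / (S.κ * exp r) = 2 * S.Cc := by
    rw [← S.Cc_κ]; field_simp
  rw [h2, H.V1] at this
  linarith

lemma V_le {t : ℝ} (ht : t ∈ Icc s q) : V t ≤ S.C0 := by
  have hM := S.M_pos
  have hk := S.hk
  have hC := S.Cc_pos
  have ht1 := S.t1_pos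
  rcases le_total t (s + S.t1) with h1 | h1
  · have := H.V_fast hq hV ht h1
    unfold C0; linarith
  · have h0 := H.V_fast hq hV (t := s + S.t1) ⟨by linarith, h1.trans ht.2⟩ le_rfl
    have := exp_cmp_le (A := 2 * S.M) (l := S.k / 8) h1 (by positivity) (by positivity)
      (fun x hx => (H.lin x ⟨by linarith [hx.1], hx.2.trans (ht.2.trans hq.2)⟩).2) (fun x hx => by
        have h1 := H.V'_le hq hV ⟨by linarith [hx.1], hx.2.le.trans ht.2⟩
        have h2 := H.x_slow hx.1.le (hx.2.le.trans (ht.2.trans hq.2))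
        have h4 : exp (-(S.w * exp r)) ≤ 1 := by
          have := mul_pos S.w_pos (exp_pos r)
          exact exp_le_one_iff.2 (by linarith)
        have h5 : exp (u x) ≤ exp (-(S.k / 8 * (x - (s + S.t1)))) := by
          refine h2.trans ?_
          have := exp_pos (-(S.k / 8 * (x - (s + S.t1))))
          nlinarith
        have h3 := mul_le_mul_of_nonneg_left h5 (show 0 ≤ 2 * S.M by positivity)
        linarith)
    have h2 : 2 * S.M / (S.k / 8) = 4 * S.Cc := by
      unfold Cc; field_simp; ring
    rw [h2] at this
    unfold C0; linarith

lemma U_ge {t : ℝ} (ht : t ∈ Icc s q) : 1 - S.C3 * (exp r * (t - s)) ≤ U t := by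
  have := cmp_ge (C := -(S.C3 * exp r)) ht.1
    (fun x hx => (H.lin x ⟨hx.1, hx.2.trans (ht.2.trans hq.2)⟩).1) (fun x hx => by
      have hx' : x ∈ Icc s q := ⟨hx.1.le, hx.2.le.trans ht.2⟩
      have h1 := H.β_le (t := x) ⟨hx'.1, hx'.2.trans hq.2⟩
      have h2 := H.V_le hq hV hx'
      have h3 := mul_le_mul h1 h2 (hV x hx') (by have := S.M_pos; positivity)
      have h4 : 2 * S.M * (exp S.Cc * exp r) * S.C0 = S.C3 * exp r := by unfold C3; ring
      linarith)
  rw [H.U1] at this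
  linarith

lemma U_abs {t : ℝ} (ht : t ∈ Icc s q) : |U t| ≤ 1 + S.C3 * (exp r * (t - s)) := by
  have h1 := H.U_ge hq hV ht
  have h2 := H.U_le hq hV ht
  have h3 : 0 ≤ S.C3 * (exp r * (t - s)) :=
    mul_nonneg S.C3_pos.le (mul_nonneg (exp_pos r).le (by linarith [ht.1]))
  rw [abs_le]; constructor <;> linarith

/-- `x (|U| + V)` is small. -/
lemma xUV {t : ℝ} (ht : t ∈ Icc s q) (ht1 : t ≤ s + S.t1) :
    exp (u t) * (|U t| + V t) ≤ S.C6 * exp r * exp (-(S.κ * exp r / 2 * (t - s))) := by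
  have h1 := H.U_abs hq hV ht
  have h2 := H.V_le hq hV ht
  have h3 := H.x_fast ht.1 ht1
  have hC0 := S.C0_pos
  have hC3 := S.C3_pos
  have hζ : 0 ≤ exp r * (t - s) := mul_nonneg (exp_pos r).le (by linarith [ht.1])
  have h4 := poly_exp (p := 1 + S.C0) (q := S.C3) (l := S.κ) (ζ := exp r * (t - s))
    (by positivity) hC3.le S.κ_pos hζ
  have h5 : exp (u t) * (|U t| + V t) ≤ (exp r * exp (-(S.κ * exp r * (t - s)))) *
      (1 + S.C0 + S.C3 * (exp r * (t - s))) :=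
    mul_le_mul h3 (by linarith) (add_nonneg (abs_nonneg _) (hV t ht)) (by positivity)
  have h6 := mul_le_mul_of_nonneg_left h4 (exp_pos r).le
  have e1 : -(S.κ * exp r * (t - s)) = -(S.κ * (exp r * (t - s))) := by ring
  have e2 : -(S.κ * exp r / 2 * (t - s)) = -(S.κ / 2 * (exp r * (t - s))) := by ring
  rw [e1] at h5
  rw [e2]
  calc _ ≤ _ := h5
    _ = exp r * ((1 + S.C0 + S.C3 * (exp r * (t - s))) * exp (-(S.κ * (exp r * (t - s))))) := by
      ring
    _ ≤ _ := h6
    _ = _ := by unfold C6; ring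

end
end HC
end Sys
end VS

namespace VS
open Real Set Filter Topology MeasureTheory

lemma energy_alg {x y U V p q e1 e2 ε : ℝ} (hx : 0 < x) (hy : 0 < y) (hV : 0 ≤ V)
    (hε : 0 ≤ ε) (hε1 : ε ≤ 1 / 2)
    (hp : |p - 1| ≤ ε) (hq : |q - 1| ≤ ε) (h1 : |e1| ≤ ε) (h2 : |e2| ≤ ε) :
    -(4 * ε * (x * (|U| + V)) * y) ≤
      x * y * (U * (-p + q * (1 + e2)) + V * (q - p * (1 + e1))) := by
  have hq' : |q| ≤ 2 := by
    rw [abs_le] at hq ⊢; constructor <;> linarith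
  have hp' : |p| ≤ 2 := by
    rw [abs_le] at hp ⊢; constructor <;> linarith
  have a1 : |-p + q * (1 + e2)| ≤ 4 * ε := by
    have e : -p + q * (1 + e2) = (q - 1) + -(p - 1) + q * e2 := by ring
    rw [e]
    have t1 := abs_add_le ((q - 1) + -(p - 1)) (q * e2)
    have t2 := abs_add_le (q - 1) (-(p - 1))
    rw [abs_neg] at t2
    rw [abs_mul] at t1
    have t3 := mul_le_mul hq' h2 (abs_nonneg _) (by norm_num)
    linarith
  have a2 : |q - p * (1 + e1)| ≤ 4 * ε := by
    have e : q - p * (1 + e1) = (q - 1) + -(p - 1) + -(p * e1) := by ring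
    rw [e]
    have t1 := abs_add_le ((q - 1) + -(p - 1)) (-(p * e1))
    have t2 := abs_add_le (q - 1) (-(p - 1))
    rw [abs_neg] at t2
    rw [abs_neg, abs_mul] at t1
    have t3 := mul_le_mul hp' h1 (abs_nonneg _) (by norm_num)
    linarith
  have b1 : -(4 * ε * |U|) ≤ U * (-p + q * (1 + e2)) := by
    have := neg_abs_le (U * (-p + q * (1 + e2)))
    rw [abs_mul] at this
    have := mul_le_mul_of_nonneg_left a1 (abs_nonneg U)
    linarith
  have b2 : -(4 * ε * V) ≤ V * (q - p * (1 + e1)) := by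
    have := mul_le_mul_of_nonneg_left (abs_le.1 a2).1 hV
    linarith
  have b3 := mul_le_mul_of_nonneg_left (add_le_add b1 b2) (mul_pos hx hy).le
  linarith

namespace Sys
variable (S : Sys)
noncomputable def C8 : ℝ := S.M / S.k * (S.C6 + S.C0 * exp S.Cc)
lemma C8_pos : 0 < S.C8 := by
  have := S.M_pos; have := S.hk; have := S.C6_pos; have := S.C0_pos
  unfold C8; positivity

variable {S} {u v β δ U V : ℝ → ℝ} {s τ r ε q : ℝ}

namespace HC
variable (H : S.HC u v β δ U V s τ r ε)
include H
variable (hq : q ∈ Icc s τ) (hV : ∀ t ∈ Icc s q, 0 ≤ V t)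
include hq hV

lemma E_ge {t : ℝ} (ht : t ∈ Icc s q) (ht1 : t ≤ s + S.t1)
    (hb : ∀ x ∈ Icc s t, |S.b x - S.b s| ≤ ε * S.b s)
    (hd : ∀ x ∈ Icc s t, |S.d x - S.d s| ≤ ε * S.d s) :
    exp r / S.b s + exp r / S.d s - 8 * ε * exp S.Cc * S.C6 * exp r / S.κ
      - S.C8 * exp r * (t - s) ≤
    exp (u t) * U t / S.b s + exp (v t) * V t / S.d s := by
  have hM := S.M_pos
  have hk := S.hk
  have hκ := S.κ_pos
  have hC6 := S.C6_pos
  have hε := H.ε0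
  have b0 := S.b_pos s
  have d0 := S.d_pos s
  set E' : ℝ → ℝ := fun x => ((exp (u x) * (S.a - S.b x * exp (v x))) * U x
      + exp (u x) * (-(β x * V x))) / S.b s + ((exp (v x) * (-S.c + S.d x * exp (u x))) * V x
      + exp (v x) * (δ x * U x)) / S.d s + S.C8 * exp r with hE'
  have hder : ∀ x ∈ Icc s t, HasDerivAt
      (fun x => exp (u x) * U x / S.b s + exp (v x) * V x / S.d s + S.C8 * exp r * x)
      (E' x) x := by
    intro x hx
    have hl := H.lin x ⟨hx.1, hx.2.trans (ht.2.trans hq.2)⟩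
    have h1 := ((H.sol x).1.exp.mul hl.1).div_const (S.b s)
    have h2 := ((H.sol x).2.exp.mul hl.2).div_const (S.d s)
    have h3 := (hasDerivAt_id x).const_mul (S.C8 * exp r)
    refine HasDerivAt.congr_deriv ((h1.add h2).add h3) ?_
    simp only [hE', mul_one]
  have key := exp_cmp_ge (A := 4 * ε * exp S.Cc * S.C6 * exp r * exp r) (l := S.κ * exp r / 2)
    ht.1 (by positivity) (by positivity) hder (by
    intro x hx
    have hx' : x ∈ Icc s q := ⟨hx.1.le, hx.2.le.trans ht.2⟩
    have hxτ : x ∈ Icc s τ := ⟨hx'.1, hx'.2.trans hq.2⟩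
    have hxt : x ∈ Icc s t := Ioo_subset_Icc_self hx
    have hVx := hV x hx'
    have hbx := S.b_pos x
    have hdx := S.d_pos x
    have hX := exp_pos (u x)
    have hY := exp_pos (v x)
    have hby := mul_pos hbx hY
    have hdx2 := mul_pos hdx hX
    set p := S.b x / S.b s with hp
    set q' := S.d x / S.d s with hq'
    set e1 := (β x - S.b x * exp (v x)) / (S.b x * exp (v x)) with he1
    set e2 := (δ x - S.d x * exp (u x)) / (S.d x * exp (u x)) with he2
    have hp1 : |p - 1| ≤ ε := by
      rw [hp, div_sub_one b0.ne', abs_div, abs_of_pos b0, div_le_iff₀ b0]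
      exact hb x hxt
    have hq1 : |q' - 1| ≤ ε := by
      rw [hq', div_sub_one d0.ne', abs_div, abs_of_pos d0, div_le_iff₀ d0]
      exact hd x hxt
    have he1' : |e1| ≤ ε := by
      rw [he1, abs_div, abs_of_pos hby, div_le_iff₀ hby]
      exact H.hβ x hxτ
    have he2' : |e2| ≤ ε := by
      rw [he2, abs_div, abs_of_pos hdx2, div_le_iff₀ hdx2]
      exact H.hδ x hxτ
    have hβ : β x = S.b x * exp (v x) * (1 + e1) := by rw [he1]; field_simp; ring
    have hδ : δ x = S.d x * exp (u x) * (1 + e2) := by rw [he2]; field_simp; ring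
    have alg := energy_alg (U := U x) hX hY hVx H.ε0 H.ε1 hp1 hq1 he1' he2'
    have hEq : E' x = S.a * (exp (u x) * U x) / S.b s - S.c * (exp (v x) * V x) / S.d s
        + S.C8 * exp r
        + exp (u x) * exp (v x) * (U x * (-p + q' * (1 + e2)) + V x * (q' - p * (1 + e1))) := by
      simp only [hE']
      rw [hβ, hδ, hp, hq']
      field_simp
      ring
    rw [hEq]
    have hxuv := H.xUV hq hV hx' (hx.2.le.trans ht1)
    have hy := H.y_le hxτ
    have t1 : 4 * ε * (exp (u x) * (|U x| + V x)) * exp (v x) ≤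
        4 * ε * (S.C6 * exp r * exp (-(S.κ * exp r / 2 * (x - s)))) * (exp S.Cc * exp r) := by
      apply mul_le_mul (mul_le_mul_of_nonneg_left hxuv (by positivity)) hy hY.le (by positivity)
    have hexp1 : exp (-(S.κ * exp r / 2 * (x - s))) ≤ 1 := by
      apply exp_le_one_iff.2
      have : 0 ≤ S.κ * exp r / 2 * (x - s) := mul_nonneg (by positivity) (by linarith [hx.1])
      linarith
    have t2 : -(S.M / S.k * (S.C6 * exp r)) ≤ S.a * (exp (u x) * U x) / S.b s := by
      have g1 : exp (u x) * |U x| ≤ S.C6 * exp r := by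
        have : exp (u x) * |U x| ≤ exp (u x) * (|U x| + V x) :=
          mul_le_mul_of_nonneg_left (by linarith) hX.le
        have g2 := mul_le_mul_of_nonneg_left hexp1 (show 0 ≤ S.C6 * exp r by positivity)
        linarith
      have g3 : S.a / S.b s ≤ S.M / S.k := div_le_div₀ hM.le S.aM hk (S.kb s)
      have g4 : 0 ≤ S.a / S.b s := div_nonneg S.a_pos.le b0.le
      have g5 := mul_le_mul g3 g1 (by positivity) (by positivity)
      have g6 : -(exp (u x) * |U x|) ≤ exp (u x) * U x := by
        have := mul_le_mul_of_nonneg_left (neg_abs_le (U x)) hX.le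
        linarith
      have g7 := mul_le_mul_of_nonneg_left g6 g4
      have g8 : S.a * (exp (u x) * U x) / S.b s = S.a / S.b s * (exp (u x) * U x) := by ring
      rw [g8]; linarith
    have t3 : S.c * (exp (v x) * V x) / S.d s ≤ S.M / S.k * (exp S.Cc * exp r * S.C0) := by
      have g3 : S.c / S.d s ≤ S.M / S.k := div_le_div₀ hM.le S.cM hk (S.kd s)
      have g1 := mul_le_mul hy (H.V_le hq hV hx') hVx (by positivity)
      have g5 := mul_le_mul g3 g1 (by positivity) (by positivity)
      have g8 : S.c * (exp (v x) * V x) / S.d s = S.c / S.d s * (exp (v x) * V x) := by ring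
      rw [g8]; linarith
    have t4 : S.C8 * exp r = S.M / S.k * (S.C6 * exp r) + S.M / S.k * (exp S.Cc * exp r * S.C0) := by
      unfold C8; ring
    linarith)
  simp only [H.hu, H.hv, H.U1, H.V1, mul_one] at key
  have e : 4 * ε * exp S.Cc * S.C6 * exp r * exp r / (S.κ * exp r / 2) =
      8 * ε * exp S.Cc * S.C6 * exp r / S.κ := by
    field_simp; ring
  rw [e] at key
  linarith

lemma V_window {t K : ℝ} (ht : t ∈ Icc s q) (ht1 : t ≤ s + S.t1)
    (hb : ∀ x ∈ Icc s t, |S.b x - S.b s| ≤ ε * S.b s)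
    (hd : ∀ x ∈ Icc s t, |S.d x - S.d s| ≤ ε * S.d s)
    (hεs : ε * (16 * S.M * exp S.Cc * S.C6) ≤ S.κ)
    (htK : exp r * (t - s) ≤ K) (hK : S.C8 * K * (2 * S.M) ≤ exp r) :
    S.κ0 ≤ V t := by
  have hM := S.M_pos
  have hκ := S.κ_pos
  have hR := exp_pos r
  rcases le_or_gt 0 (U t) with hU | hU
  · have := cmp_ge (C := 0) ht.1
      (fun x hx => (H.lin x ⟨hx.1, hx.2.trans (ht.2.trans hq.2)⟩).2) (fun x hx => by
        have h1 := H.U_anti hq hV hx.1.le hx.2.le ht.2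
        have h2 := H.δ_pos (t := x) ⟨hx.1.le, hx.2.le.trans (ht.2.trans hq.2)⟩
        exact mul_nonneg h2.le (hU.trans h1))
    rw [H.V1] at this
    linarith [S.κ0_le]
  · have hE := H.E_ge hq hV ht ht1 hb hd
    have b0 := S.b_pos s
    have d0 := S.d_pos s
    have h1 : exp (u t) * U t / S.b s ≤ 0 := by
      apply div_nonpos_of_nonpos_of_nonneg _ b0.le
      exact mul_nonpos_of_nonneg_of_nonpos (exp_pos _).le hU.le
    have h2 : 8 * ε * exp S.Cc * S.C6 * exp r / S.κ ≤ exp r / (2 * S.M) := by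
      rw [div_le_div_iff₀ hκ (by positivity)]
      have := mul_le_mul_of_nonneg_right hεs hR.le
      linarith
    have h3 : S.C8 * exp r * (t - s) ≤ exp r / (2 * S.M) := by
      rw [le_div_iff₀ (by positivity)]
      have := mul_le_mul_of_nonneg_left htK S.C8_pos.le
      have := mul_le_mul_of_nonneg_right this (show 0 ≤ 2 * S.M by positivity)
      linarith
    have h4 : exp r / S.M ≤ exp r / S.b s := div_le_div_of_nonneg_left hR.le b0 (S.bM s)
    have h5 : exp r / S.M = exp r / (2 * S.M) + exp r / (2 * S.M) := by field_simp; ring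
    have h6 : exp r / S.d s ≤ exp (v t) * V t / S.d s := by linarith
    rw [div_le_div_iff_of_pos_right d0] at h6
    have h7 := H.y_le (t := t) ⟨ht.1, ht.2.trans hq.2⟩
    have h8 := mul_le_mul_of_nonneg_right h7 (hV t ht)
    have h9 : exp r * 1 ≤ exp r * (exp S.Cc * V t) := by linarith
    have h10 := le_of_mul_le_mul_left h9 hR
    have h11 : exp (-S.Cc) * exp S.Cc = 1 := by rw [← exp_add]; simp
    have h12 := mul_le_mul_of_nonneg_left h10 (exp_pos (-S.Cc)).le
    rw [← mul_assoc, h11] at h12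
    have := exp_pos (-S.Cc)
    unfold κ0
    linarith

lemma V_post1 {p : ℝ} (hp : s ≤ p) (hpq : p ≤ q) (hq1 : q ≤ s + S.t1) :
    V p - 4 * S.Cc * S.C6 * exp (-(S.κ / 2 * (exp r * (p - s)))) ≤ V q := by
  have hM := S.M_pos
  have hκ := S.κ_pos
  have hC6 := S.C6_pos
  have := exp_cmp_ge (A := 2 * S.M * (S.C6 * exp r * exp (-(S.κ / 2 * (exp r * (p - s))))))
    (l := S.κ * exp r / 2) hpq (by positivity) (by positivity)
    (fun x hx => (H.lin x ⟨hp.trans hx.1, hx.2.trans hq.2⟩).2) (fun x hx => by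
      have hx' : x ∈ Icc s q := ⟨hp.trans hx.1.le, hx.2.le⟩
      have hxτ : x ∈ Icc s τ := ⟨hx'.1, hx'.2.trans hq.2⟩
      have h1 := H.xUV hq hV hx' (hx.2.le.trans hq1)
      have h2 : -(2 * S.M * (exp (u x) * (|U x| + V x))) ≤ δ x * U x := by
        have g1 := mul_le_mul_of_nonneg_left (neg_abs_le (U x)) (H.δ_pos hxτ).le
        have g2 := mul_le_mul_of_nonneg_right (H.δ_le hxτ) (abs_nonneg (U x))
        have g3 : 0 ≤ 2 * S.M * (exp (u x) * V x) :=
          mul_nonneg (by positivity) (mul_nonneg (exp_pos _).le (hV x hx'))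
        linarith
      have h3 := mul_le_mul_of_nonneg_left h1 (show 0 ≤ 2 * S.M by positivity)
      have h4 : exp (-(S.κ * exp r / 2 * (x - s))) = exp (-(S.κ / 2 * (exp r * (p - s)))) *
          exp (-(S.κ * exp r / 2 * (x - p))) := by
        rw [← exp_add]; congr 1; ring
      rw [h4] at h3
      linarith)
  have e : 2 * S.M * (S.C6 * exp r * exp (-(S.κ / 2 * (exp r * (p - s))))) / (S.κ * exp r / 2) =
      4 * S.Cc * S.C6 * exp (-(S.κ / 2 * (exp r * (p - s)))) := by
    rw [← S.Cc_κ]; field_simp; ring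
  rw [e] at this
  linarith

lemma V_post2 (hq1 : s + S.t1 ≤ q) :
    V (s + S.t1) - 32 * S.M / S.k * ((1 + (S.C3 * S.t1 + 16 * S.C3 / S.k) * exp r)
      * exp (-(S.w * exp r))) ≤ V q := by
  have hM := S.M_pos
  have hk := S.hk
  have ht1 := S.t1_pos
  have hC3 := S.C3_pos
  set A := 2 * S.M * ((1 + (S.C3 * S.t1 + 16 * S.C3 / S.k) * exp r) * exp (-(S.w * exp r))) with hA
  have hA0 : 0 ≤ A := by positivity
  have := exp_cmp_ge (A := A)
    (l := S.k / 8 / 2) hq1 hA0 (by positivity)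
    (fun x hx => (H.lin x ⟨by linarith [hx.1], hx.2.trans hq.2⟩).2) (fun x hx => by
      have hx' : x ∈ Icc s q := ⟨by linarith [hx.1], hx.2.le⟩
      have hxτ : x ∈ Icc s τ := ⟨hx'.1, hx'.2.trans hq.2⟩
      have h1 := H.U_abs hq hV hx'
      have h2 := H.x_slow hx.1.le hxτ.2
      set θ := x - (s + S.t1) with hθ
      have hθ0 : 0 ≤ θ := by linarith [hx.1]
      have h3 := poly_exp (p := 1 + S.C3 * exp r * S.t1) (q := S.C3 * exp r) (l := S.k / 8)
        (ζ := θ) (by positivity) (by positivity) (by positivity) hθ0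
      have g1 := mul_le_mul_of_nonneg_left (neg_abs_le (U x)) (H.δ_pos hxτ).le
      have g2 := mul_le_mul_of_nonneg_right (H.δ_le hxτ) (abs_nonneg (U x))
      have g3 : exp (u x) * |U x| ≤ exp (-(S.w * exp r)) * exp (-(S.k / 8 * θ)) *
          (1 + S.C3 * exp r * S.t1 + S.C3 * exp r * θ) := by
        apply mul_le_mul h2 _ (abs_nonneg _) (by positivity)
        refine h1.trans (le_of_eq ?_)
        rw [hθ]; ring
      have g4 := mul_le_mul_of_nonneg_left h3 (exp_pos (-(S.w * exp r))).le
      have g5 : 2 * S.M * (exp (u x) * |U x|) ≤ A * exp (-(S.k / 8 / 2 * θ)) := by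
        have : exp (u x) * |U x| ≤ exp (-(S.w * exp r)) *
          ((1 + S.C3 * exp r * S.t1 + 2 * (S.C3 * exp r) / (S.k / 8)) * exp (-(S.k / 8 / 2 * θ))) := by
          linarith
        have := mul_le_mul_of_nonneg_left this (show 0 ≤ 2 * S.M by positivity)
        refine this.trans (le_of_eq ?_)
        rw [hA]; field_simp; ring
      linarith)
  have e : A / (S.k / 8 / 2) = 32 * S.M / S.k * ((1 + (S.C3 * S.t1 + 16 * S.C3 / S.k) * exp r)
      * exp (-(S.w * exp r))) := by
    rw [hA]; field_simp; ring
  rw [e] at this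
  linarith

end HC

/-- The half-turn lemma for perturbations of the linearised system. -/
theorem half (S : Sys) : ∃ ε, 0 < ε ∧ ε ≤ 1 / 2 ∧ ∀ᶠ r in atTop, ∀ u v β δ U V s τ,
    S.HC u v β δ U V s τ r ε → U τ ≤ -1 ∧ 0 < V τ ∧ V τ ≤ -U τ / 2 := by
  have hM := S.M_pos
  have hk := S.hk
  have hκ := S.κ_pos
  have hC6 := S.C6_pos
  have hC0 := S.C0_pos
  have hC3 := S.C3_pos
  have hC8 := S.C8_pos
  have hCc := S.Cc_pos
  have hκ0 := S.κ0_pos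
  have ht1 := S.t1_pos
  have hw := S.w_pos
  set ε := S.κ / (16 * S.M * exp S.Cc * S.C6) with hε
  have hε0 : 0 < ε := by positivity
  have hεs : ε * (16 * S.M * exp S.Cc * S.C6) ≤ S.κ := by rw [hε]; apply le_of_eq; field_simp
  -- choice of K
  obtain ⟨K, hK0, hK⟩ : ∃ K, 0 < K ∧ 4 * S.Cc * S.C6 * exp (-(S.κ / 2 * K)) ≤ S.κ0 / 4 := by
    have h1 : Tendsto (fun K : ℝ => S.κ / 2 * K) atTop atTop :=
      tendsto_id.const_mul_atTop (by positivity)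
    have h2 := (tendsto_exp_neg_atTop_nhds_zero.comp h1).const_mul (4 * S.Cc * S.C6)
    rw [mul_zero] at h2
    have h3 := h2.eventually (eventually_le_nhds (show 0 < S.κ0 / 4 by positivity))
    obtain ⟨K, h4, h5⟩ := (h3.and (eventually_gt_atTop 0)).exists
    exact ⟨K, h5, h4⟩
  obtain ⟨η1, hη1, Hb⟩ := per_unif S.hT S.bc S.bp (ε := ε * S.k) (by positivity)
  obtain ⟨η2, hη2, Hd⟩ := per_unif S.hT S.dc S.dp (ε := ε * S.k) (by positivity)
  have hbig : ∀ L : ℝ, ∀ᶠ r : ℝ in atTop, L ≤ exp r := fun L =>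
    tendsto_exp_atTop.eventually_ge_atTop L
  have hsmall : ∀ᶠ r : ℝ in atTop, 32 * S.M / S.k *
      ((1 + (S.C3 * S.t1 + 16 * S.C3 / S.k) * exp r) * exp (-(S.w * exp r))) ≤ S.κ0 / 4 := by
    set q := S.C3 * S.t1 + 16 * S.C3 / S.k with hq
    have hq0 : 0 ≤ q := by positivity
    have h1 : Tendsto (fun r : ℝ => S.w / 2 * exp r) atTop atTop :=
      tendsto_exp_atTop.const_mul_atTop (by positivity)
    have h2 := (tendsto_exp_neg_atTop_nhds_zero.comp h1).const_mul
      (32 * S.M / S.k * (1 + 2 * q / S.w))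
    rw [mul_zero] at h2
    have h3 := h2.eventually (eventually_le_nhds (show 0 < S.κ0 / 4 by positivity))
    filter_upwards [h3] with r hr
    refine le_trans ?_ hr
    have := poly_exp (p := 1) (q := q) (l := S.w) (ζ := exp r) zero_le_one hq0 hw (exp_pos r).le
    have := mul_le_mul_of_nonneg_left this (show 0 ≤ 32 * S.M / S.k by positivity)
    simp only [Function.comp_apply]
    linarith
  have hεh : ε ≤ 1 / 2 := by
    have h1 : (1:ℝ) ≤ exp S.Cc := one_le_exp (by positivity)
    have h2 : (1:ℝ) ≤ S.C6 := by
      have : 0 ≤ 2 * S.C3 / S.κ := by positivity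
      unfold C6
      linarith
    have h3 : S.κ ≤ 1 / 4 := by have := S.hk1; unfold κ; linarith
    have h4 : 1 * 1 * 1 ≤ S.M * exp S.Cc * S.C6 := by
      have := S.hM
      gcongr
    nlinarith
  refine ⟨ε, hε0, hεh, ?_⟩
  filter_upwards [hbig (K / S.t1), hbig (K / η1), hbig (K / η2), hbig (S.C8 * K * (2 * S.M)),
    hbig ((2 + 2 * S.C0) * 8 / (S.k * S.κ0 * S.t1)), hsmall] with r r1 r2 r3 r4 r5 r6
  rw [div_le_iff₀ (by positivity)] at r1 r2 r3 r5
  intro u v β δ U V s τ H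
  have hR := exp_pos r
  set p := s + K / exp r with hp
  have hps : s ≤ p := by have : 0 < K / exp r := by positivity
                         linarith
  have hpt : p ≤ s + S.t1 := by
    have : K / exp r ≤ S.t1 := by rw [div_le_iff₀ hR]; linarith
    linarith
  have hpη1 : K / exp r ≤ η1 := by rw [div_le_iff₀ hR]; linarith
  have hpη2 : K / exp r ≤ η2 := by rw [div_le_iff₀ hR]; linarith
  have hpζ : exp r * (p - s) = K := by rw [hp]; field_simp; ring
  have hbp : ∀ x ∈ Icc s p, |S.b x - S.b s| ≤ ε * S.b s := by
    intro x hx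
    refine (Hb s x ?_).trans (mul_le_mul_of_nonneg_left (S.kb s) hε0.le)
    rw [abs_of_nonneg (by linarith [hx.1])]; linarith [hx.2]
  have hdp : ∀ x ∈ Icc s p, |S.d x - S.d s| ≤ ε * S.d s := by
    intro x hx
    refine (Hd s x ?_).trans (mul_le_mul_of_nonneg_left (S.kd s) hε0.le)
    rw [abs_of_nonneg (by linarith [hx.1])]; linarith [hx.2]
  have low : ∀ q ∈ Icc s τ, (∀ t ∈ Icc s q, 0 ≤ V t) → S.κ0 / 2 ≤ V q := by
    intro q hq hV
    have win : ∀ t ∈ Icc s q, t ≤ p → S.κ0 ≤ V t := by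
      intro t ht htp
      refine H.V_window hq hV (K := K) ht (htp.trans hpt)
        (fun x hx => hbp x ⟨hx.1, hx.2.trans htp⟩) (fun x hx => hdp x ⟨hx.1, hx.2.trans htp⟩)
        hεs ?_ r4
      rw [← hpζ]
      exact mul_le_mul_of_nonneg_left (by linarith) hR.le
    have st2 : ∀ q' ∈ Icc s q, q' ≤ s + S.t1 → S.κ0 * (3 / 4) ≤ V q' := by
      intro q' hq' hq1
      have hV' : ∀ t ∈ Icc s q', 0 ≤ V t := fun t ht => hV t ⟨ht.1, ht.2.trans hq'.2⟩
      rcases le_total q' p with h1 | h1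
      · have := win q' hq' h1; linarith
      · have h2 := H.V_post1 ⟨hq'.1, hq'.2.trans hq.2⟩ hV' hps h1 hq1
        rw [hpζ] at h2
        have h3 := win p ⟨hps, h1.trans hq'.2⟩ le_rfl
        linarith
    rcases le_total q (s + S.t1) with h1 | h1
    · have := st2 q ⟨hq.1, le_rfl⟩ h1; linarith
    · have h2 := H.V_post2 hq hV h1
      have h3 := st2 (s + S.t1) ⟨by linarith, h1⟩ le_rfl
      linarith
  have hsτ : s ≤ τ := by have := H.le; linarith
  have hVpos : ∀ t ∈ Icc s τ, 0 ≤ V t := by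
    by_contra hcon
    push Not at hcon
    obtain ⟨t, ht, hneg⟩ := hcon
    obtain ⟨z, z1, z2, z3, z4⟩ := first_zero (f := fun x => -V x) ht.1
      (fun x hx => ((H.lin x ⟨hx.1, hx.2.trans ht.2⟩).2.continuousAt.neg).continuousWithinAt)
      (by simp [H.V1]) (by linarith)
    have := low z ⟨z1.le, z2.trans ht.2⟩ (fun x hx => by
      rcases hx.2.lt_or_eq with h | h
      · have := z4 x hx.1 h
        linarith
      · rw [h]; linarith)
    linarith
  have hlow : ∀ t ∈ Icc s τ, S.κ0 / 2 ≤ V t := fun t ht =>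
    low t ht (fun x hx => hVpos x ⟨hx.1, hx.2.trans ht.2⟩)
  have hττ : τ ∈ Icc s τ := ⟨hsτ, le_rfl⟩
  have hVτ := hlow τ hττ
  have hVτ2 := H.V_le hττ hVpos hττ
  have hUt := cmp_le (C := -(S.k / 2 * (exp r / 2) * (S.κ0 / 2))) (show s ≤ s + S.t1 by linarith)
    (fun x hx => (H.lin x ⟨hx.1, hx.2.trans H.le⟩).1) (fun x hx => by
      have hx' : x ∈ Icc s τ := ⟨hx.1.le, hx.2.le.trans H.le⟩
      have h1 := H.β_lo hx'
      have h2 := y_ge H.sol H.hv hx.1.le hx.2.le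
      have h3 : S.k / 2 * (exp r / 2) ≤ β x :=
        (mul_le_mul_of_nonneg_left h2 (by positivity)).trans h1
      have h4 := mul_le_mul h3 (hlow x hx') (by positivity) (H.β_pos hx').le
      linarith)
  have hU2 := H.U_anti hττ hVpos (show s ≤ s + S.t1 by linarith) H.le le_rfl
  rw [H.U1] at hUt
  have hU3 : U τ ≤ -1 - 2 * S.C0 := by
    have : S.k / 2 * (exp r / 2) * (S.κ0 / 2) * (s + S.t1 - s) * 8
      = exp r * (S.k * S.κ0 * S.t1) := by ring
    linarith
  refine ⟨by linarith, by linarith, by linarith⟩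

end Sys
end VS

namespace VS
open Real Set Filter Topology MeasureTheory
namespace Sys
variable {S : Sys} {u v : ℝ → ℝ}

/-- while the predator is below `-U0` the prey grows -/
lemma up_u {τ t : ℝ} (h : S.Sol u v) (ht : τ ≤ t) (hv : ∀ x ∈ Icc τ t, v x ≤ -S.U0) :
    u τ + S.k / 2 * (t - τ) ≤ u t := by
  have := cmp_ge (C := S.k / 2) ht (fun x _ => (h x).1) (fun x hx => by
    have h1 := hv x ⟨hx.1.le, hx.2.le⟩
    have h2 : S.b x * exp (v x) ≤ S.M * exp (-S.U0) :=
      mul_le_mul (S.bM x) (exp_le_exp.2 h1) (exp_pos _).le S.M_pos.le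
    rw [S.exp_U0] at h2
    linarith [S.ka])
  linarith

lemma up_t3 {τ ρ : ℝ} (h : S.Sol u v) (hu : u τ = -ρ) (hv : v τ = -ρ) (hρ : S.U0 < ρ) :
    ∃ t3, τ < t3 ∧ v t3 = -S.U0 ∧ ∀ t, τ ≤ t → t < t3 → v t < -S.U0 := by
  have hM := S.M_pos
  have hk := S.hk
  have hU := S.U0_nonneg
  set T1 := 2 / S.k * (ρ + S.U0) with hT1
  have hT1p : 0 < T1 := by have : 0 < ρ + S.U0 := by linarith
                           positivity
  have ex : ∃ t, τ ≤ t ∧ -S.U0 ≤ v t := by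
    by_contra hcon
    push Not at hcon
    have hu1 : ∀ t, τ + T1 ≤ t → S.U0 ≤ u t := by
      intro t ht
      have h1 := up_u (t := t) h (by linarith) (fun x hx => (hcon x hx.1).le)
      have h2 : S.k / 2 * T1 ≤ S.k / 2 * (t - τ) :=
        mul_le_mul_of_nonneg_left (by linarith) (by linarith)
      have h3 : S.k / 2 * T1 = ρ + S.U0 := by rw [hT1]; field_simp
      linarith
    have hv1 := h.v_ge (show τ ≤ τ + T1 by linarith)
    set T2 := (ρ + S.c * T1) / S.M with hT2
    have hc := S.c_pos
    have hT2p : 0 ≤ T2 := by have : 0 < ρ := by linarith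
                             positivity
    have h4 := cmp_ge (C := S.M) (show τ + T1 ≤ τ + T1 + T2 by linarith) (fun x _ => (h x).2)
      (fun x hx => by
        have e1 : exp S.U0 ≤ exp (u x) := exp_le_exp.2 (hu1 x hx.1.le)
        have e2 : exp S.U0 = 2 * S.M / S.k := by rw [U0, exp_log (by positivity)]
        have e3 : S.k * exp S.U0 ≤ S.d x * exp (u x) :=
          mul_le_mul (S.kd x) e1 (exp_pos _).le (S.d_pos x).le
        rw [e2] at e3
        have e4 : S.k * (2 * S.M / S.k) = 2 * S.M := by field_simp
        linarith [S.cM])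
    have h5 : S.M * T2 = ρ + S.c * T1 := by rw [hT2]; field_simp
    have h6 := hcon (τ + T1 + T2) (by linarith)
    have h7 : S.M * (τ + T1 + T2 - (τ + T1)) = S.M * T2 := by ring
    have h8 : S.c * (τ + T1 - τ) = S.c * T1 := by ring
    rw [h7] at h4
    rw [h8] at hv1
    linarith
  obtain ⟨t, ht, hvt⟩ := ex
  obtain ⟨z, z1, z2, z3, z4⟩ := first_zero (f := fun x => v x + S.U0) ht
    (h.cv.add continuous_const).continuousOn (by linarith) (by linarith)
  exact ⟨z, z1, by linarith, fun x hx hx' => by have := z4 x hx hx'; linarith⟩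

lemma up_G {τ t t3 ρ : ℝ} (h : S.Sol u v) (hu : u τ = -ρ) (hv : v τ = -ρ)
    (hv3 : ∀ x ∈ Icc τ t3, v x ≤ -S.U0) (h1 : τ < t) (h2 : t ≤ t3) : v t < u t := by
  have hk := S.hk
  rcases lt_or_ge (-S.U0) (u t) with h3 | h3
  · exact (hv3 t ⟨h1.le, h2⟩).trans_lt h3
  · have h4 := cmp_ge (f := fun x => u x - v x) (C := S.k) h1.le
      (fun x _ => (h x).1.sub (h x).2) (fun x hx => by
        have a1 := up_u (t := t) (τ := x) h hx.2.le (fun y hy => hv3 y ⟨hx.1.le.trans hy.1, hy.2.trans h2⟩)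
        have a2 : 0 ≤ S.k / 2 * (t - x) := mul_nonneg (by linarith) (by linarith [hx.2])
        have a3 : S.b x * exp (v x) ≤ S.M * exp (-S.U0) :=
          mul_le_mul (S.bM x) (exp_le_exp.2 (hv3 x ⟨hx.1.le, hx.2.le.trans h2⟩)) (exp_pos _).le S.M_pos.le
        have a4 : S.d x * exp (u x) ≤ S.M * exp (-S.U0) :=
          mul_le_mul (S.dM x) (exp_le_exp.2 (by linarith)) (exp_pos _).le S.M_pos.le
        rw [S.exp_U0] at a3 a4
        linarith [S.ka, S.kc])
    have h5 : 0 < S.k * (t - τ) := mul_pos hk (by linarith)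
    linarith

/-- The lower half-turn. -/
theorem up_exists (S : Sys) (Q : ℝ) : ∃ ρ0, ∀ u v τ ρ, S.Sol u v → u τ = -ρ → v τ = -ρ → ρ0 ≤ ρ →
    ∃ s', τ < s' ∧ u s' = v s' ∧ (∀ t, τ < t → t < s' → v t < u t) ∧ Q ≤ u s' := by
  have hM := S.M_pos
  have hk := S.hk
  have hU := S.U0_nonneg
  set l := 2 * S.M / S.k with hl
  have hl0 : 0 < l := by positivity
  set Y0 := l + 1 + (2 * S.M + 1) / S.k + exp Q with hY0
  have hY0p : 0 < Y0 := by have := exp_pos Q; positivity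
  have hY1 : l < Y0 := by
    have : 0 < (2 * S.M + 1) / S.k := by positivity
    have := exp_pos Q; linarith
  have hY2 : 2 * S.M + 1 ≤ S.k * Y0 := by
    have e : S.k * Y0 = S.k * (l + 1 + exp Q) + (2 * S.M + 1) := by rw [hY0]; field_simp; ring
    have : 0 < S.k * (l + 1 + exp Q) := by have := exp_pos Q; positivity
    linarith
  have hY3 : exp Q ≤ Y0 := by
    have : 0 < (2 * S.M + 1) / S.k := by positivity
    linarith
  refine ⟨S.U0 + 1 + l * ((1 + l) * Y0), ?_⟩
  intro u v τ ρ h hu hv hρ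
  have hq : 0 < l * ((1 + l) * Y0) := by positivity
  obtain ⟨t3, a1, a2, a3⟩ := up_t3 h hu hv (by linarith)
  have a3' : ∀ x ∈ Icc τ t3, v x ≤ -S.U0 := fun x hx => by
    rcases hx.2.lt_or_eq with e | e
    · exact (a3 x hx.1 e).le
    · rw [e, a2]
  have hX : (1 + l) * Y0 ≤ exp (u t3) := by
    have h1 := cmp (f := v) (g := fun x => l * exp (u x)) a1.le (fun x _ => (h x).2)
      (fun x _ => ((h x).1.exp).const_mul l) (fun x hx => by
        have b1 := a3' x ⟨hx.1.le, hx.2.le⟩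
        have b2 : S.b x * exp (v x) ≤ S.M * exp (-S.U0) :=
          mul_le_mul (S.bM x) (exp_le_exp.2 b1) (exp_pos _).le S.M_pos.le
        rw [S.exp_U0] at b2
        have b3 : S.d x * exp (u x) ≤ S.M * exp (u x) :=
          mul_le_mul_of_nonneg_right (S.dM x) (exp_pos _).le
        have b4 : l * exp (u x) * (S.k / 2) ≤ l * exp (u x) * (S.a - S.b x * exp (v x)) :=
          mul_le_mul_of_nonneg_left (by linarith [S.ka]) (by positivity)
        have b5 : l * exp (u x) * (S.k / 2) = S.M * exp (u x) := by rw [hl]; field_simp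
        have := S.c_pos
        linarith)
    have h2 : 0 < l * exp (u τ) := by positivity
    have h3 : l * ((1 + l) * Y0) ≤ l * exp (u t3) := by linarith
    exact le_of_mul_le_mul_left h3 hl0
  -- persistence of large prey
  have mono : ∀ t, t3 ≤ t → (∀ x ∈ Icc t3 t, v x ≤ u x) → (∀ x ∈ Ioo t3 t, l ≤ exp (u x)) →
      Y0 ≤ exp (u t) := by
    intro t ht hg hL
    have h1 := cmp_ge (f := fun x => exp (u x) + l * exp (v x)) (C := 0) ht
      (fun x _ => ((h x).1.exp).add (((h x).2.exp).const_mul l)) (fun x hx => by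
        have c1 := hL x hx
        have c2 := exp_pos (u x)
        have c3 := exp_pos (v x)
        have hlk : l * S.k = 2 * S.M := by rw [hl]; field_simp
        have c4 : 2 * S.M ≤ l * S.d x := by rw [← hlk]; exact mul_le_mul_of_nonneg_left (S.kd x) hl0.le
        have c5 : S.M ≤ l * S.d x - S.b x := by linarith [S.bM x]
        have c6 : S.M * l ≤ exp (u x) * (l * S.d x - S.b x) := by
          rw [mul_comm]; exact mul_le_mul c1 c5 hM.le c2.le
        have c7 : l * S.c ≤ S.M * l := by rw [mul_comm]; exact mul_le_mul_of_nonneg_right S.cM hl0.le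
        have c8 : 0 ≤ exp (v x) * (exp (u x) * (l * S.d x - S.b x) - l * S.c) :=
          mul_nonneg c3.le (by linarith)
        have c9 : 0 ≤ exp (u x) * S.a := mul_nonneg c2.le S.a_pos.le
        nlinarith)
    have h2 : exp (v t) ≤ exp (u t) := exp_le_exp.2 (hg t ⟨ht, le_rfl⟩)
    have h3 : 0 < l * exp (v t3) := by positivity
    have h4 : l * exp (v t) ≤ l * exp (u t) := mul_le_mul_of_nonneg_left h2 hl0.le
    have h5 : (1 + l) * Y0 ≤ (1 + l) * exp (u t) := by linarith
    exact le_of_mul_le_mul_left h5 (by linarith)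
  have big : ∀ t, t3 ≤ t → (∀ x ∈ Icc t3 t, v x ≤ u x) → Y0 ≤ exp (u t) := by
    intro t ht hg
    apply mono t ht hg
    by_contra hcon
    push Not at hcon
    obtain ⟨y, hy, hyl⟩ := hcon
    obtain ⟨z, z1, z2, z3, z4⟩ := first_zero (f := fun x => l - exp (u x)) hy.1.le
      (continuous_const.sub (continuous_exp.comp h.cu)).continuousOn (by nlinarith) (by linarith)
    have := mono z z1.le (fun x hx => hg x ⟨hx.1, by linarith [hx.2, hy.2]⟩) (fun x hx => by
      have := z4 x hx.1.le hx.2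
      linarith)
    linarith
  have G3 : v t3 < u t3 := up_G h hu hv a3' a1 le_rfl
  have ex : ∃ t, t3 ≤ t ∧ u t ≤ v t := by
    by_contra hcon
    push Not at hcon
    have h1 := cmp_le (f := fun x => u x - v x) (C := -1)
      (show t3 ≤ t3 + (u t3 - v t3) by linarith) (fun x _ => (h x).1.sub (h x).2) (fun x hx => by
        have b1 := big x hx.1.le (fun y hy => (hcon y hy.1).le)
        have b2 : S.k * Y0 ≤ S.d x * exp (u x) := mul_le_mul (S.kd x) b1 hY0p.le (S.d_pos x).le
        have b3 : 0 < S.b x * exp (v x) := mul_pos (S.b_pos x) (exp_pos _)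
        linarith [S.aM, S.cM])
    have := hcon (t3 + (u t3 - v t3)) (by linarith)
    linarith
  obtain ⟨t, ht, htu⟩ := ex
  obtain ⟨z, z1, z2, z3, z4⟩ := first_zero (f := fun x => v x - u x) ht
    (h.cv.sub h.cu).continuousOn (by linarith) (by linarith)
  refine ⟨z, a1.trans z1, by linarith, ?_, ?_⟩
  · intro x hx1 hx2
    rcases le_total x t3 with e | e
    · exact up_G h hu hv a3' hx1 e
    · have := z4 x e hx2
      linarith
  · have := big z z1.le (fun x hx => by
      rcases hx.2.lt_or_eq with e | e
      · have := z4 x hx.1 e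
        linarith
      · rw [e]; linarith)
    exact exp_le_exp.1 (hY3.trans this)

end Sys
end VS

namespace VS
open Real Set Filter Topology MeasureTheory

/-- One full turn of an orbit starting at `(r,r)` at time `s`. -/
structure Sys.Ret (S : Sys) (R1 : ℝ) (u v : ℝ → ℝ) (s τ s' r : ℝ) : Prop where
  sol : S.Sol u v
  hu : u s = r
  hv : v s = r
  big : S.Big r
  lt1 : s + S.t1 < τ
  hτ : u τ = v τ
  neg : ∀ t, s < t → t < τ → u t < v t
  bot : u τ ≤ -(S.w * exp r)
  lt2 : τ < s'
  eq : u s' = v s'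
  pos : ∀ t, τ < t → t < s' → v t < u t
  top : R1 ≤ u s'

namespace Sys

theorem ret_exists (S : Sys) (R1 : ℝ) : ∀ᶠ r in atTop, ∀ u v s, S.Sol u v → u s = r → v s = r →
    ∃ τ s', S.Ret R1 u v s τ s' r := by
  obtain ⟨ρ0, H⟩ := S.up_exists R1
  have h1 : Tendsto (fun r : ℝ => S.w * exp r) atTop atTop :=
    tendsto_exp_atTop.const_mul_atTop S.w_pos
  filter_upwards [S.big_ev, h1.eventually_ge_atTop ρ0] with r hB hr u v s h hu hv
  obtain ⟨τ, a1, a2, a3⟩ := down_exists h hu hv hB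
  have ht1 := S.t1_pos
  have hb : u τ ≤ -(S.w * exp r) := by
    have := u_le_slow h hu hv hB (τ := τ) (fun t ht => by
      rcases ht.2.lt_or_eq with e | e
      · exact (a3 t (by linarith [ht.1]) e).le
      · rw [e, a2]) (t := τ) ⟨a1.le, le_rfl⟩
    have h2 : 0 ≤ S.k / 8 * (τ - s - S.t1) := mul_nonneg (by linarith [S.hk]) (by linarith)
    linarith
  obtain ⟨s', b1, b2, b3, b4⟩ := H u v τ (-u τ) h (by ring) (by rw [a2]; ring) (by linarith)
  exact ⟨τ, s', h, hu, hv, hB, a1, a2, a3, hb, b1, b2, b3, b4⟩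

namespace Ret
variable {S : Sys} {R1 : ℝ} {u v : ℝ → ℝ} {s τ s' r : ℝ}

lemma lt (H : S.Ret R1 u v s τ s' r) : s + S.t1 < s' := by linarith [H.lt1, H.lt2]

lemma time (H : S.Ret R1 u v s τ s' r) (hR : 0 ≤ R1) : S.w * exp r / S.M ≤ s' - s := by
  have h1 := H.sol.u_le H.lt2.le
  have h2 := H.bot
  have h3 := H.top
  have h4 : S.a * (s' - τ) ≤ S.M * (s' - s) :=
    mul_le_mul S.aM (by linarith [H.lt1, S.t1_pos]) (by linarith [H.lt2]) S.M_pos.le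
  rw [div_le_iff₀ S.M_pos]
  linarith

lemma lt3 (H : S.Ret R1 u v s τ s' r) (hB : S.Big (u s')) : τ + S.t1 < s' := by
  by_contra hcon
  push Not at hcon
  have hB' : S.mir.Big (u s') := hB
  have := G_neg_fast (S := S.mir) (s := -s') (r := u s') H.sol.mir (by simp [H.eq]) (by simp) hB'
    (t := -τ) (by linarith [H.lt2]) (by have : S.mir.t1 = S.t1 := rfl
                                        linarith)
  simp only [neg_neg] at this
  linarith [H.hτ]

end Ret

lemma g_cont : Continuous (dslope exp 0) := by
  rw [← continuousOn_univ, continuousOn_dslope univ_mem]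
  exact ⟨continuous_exp.continuousOn, differentiableAt_exp⟩

lemma g_mul (x : ℝ) : dslope exp 0 x * x = exp x - 1 := by
  have := sub_smul_dslope exp 0 x
  simp only [sub_zero, smul_eq_mul, exp_zero] at this
  linarith

lemma g_near {x : ℝ} (hx : |x| ≤ 1) : |dslope exp 0 x - 1| ≤ |x| := by
  rcases eq_or_ne x 0 with rfl | h0
  · simp
  · have h1 := abs_exp_sub_one_sub_id_le hx
    rw [← g_mul x] at h1
    have h2 : |dslope exp 0 x * x - x| = |dslope exp 0 x - 1| * |x| := by
      rw [← abs_mul]; congr 1; ring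
    rw [h2, ← sq_abs, sq] at h1
    exact le_of_mul_le_mul_right h1 (abs_pos.2 h0)

/-- The difference of two solutions satisfies a linear system. -/
lemma diff_lin {S : Sys} {u v u2 v2 : ℝ → ℝ} (h : S.Sol u v) (h2 : S.Sol u2 v2) (s t : ℝ) :
    Lin (fun t => S.b t * exp (v t) * dslope exp 0 (v2 t - v t))
      (fun t => S.d t * exp (u t) * dslope exp 0 (u2 t - u t))
      (fun t => u2 t - u t) (fun t => v2 t - v t) s t := by
  intro x _
  constructor
  · refine HasDerivAt.congr_deriv ((h2 x).1.sub (h x).1) ?_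
    have e := g_mul (v2 x - v x)
    have e2 : exp (v2 x) = exp (v x) * exp (v2 x - v x) := by rw [← exp_add]; ring_nf
    rw [mul_assoc, e, e2]; ring
  · refine HasDerivAt.congr_deriv ((h2 x).2.sub (h x).2) ?_
    have e := g_mul (u2 x - u x)
    have e2 : exp (u2 x) = exp (u x) * exp (u2 x - u x) := by rw [← exp_add]; ring_nf
    rw [mul_assoc, e, e2]; ring

theorem twist (S : Sys) : ∃ ε1, 0 < ε1 ∧ ∃ R1, ∀ u v s τ s' r, R1 ≤ r → S.Ret R1 u v s τ s' r →
    ∀ u2 v2 r2, S.Sol u2 v2 → u2 s = r2 → v2 s = r2 →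
    (∀ t ∈ Icc s s', |u2 t - u t| ≤ ε1 ∧ |v2 t - v t| ≤ ε1) →
    3 / 4 * (r2 - r) ^ 2 ≤ (r2 - r) * (u2 s' - v2 s') := by
  obtain ⟨εa, ha0, ha1, ha⟩ := S.half
  obtain ⟨εb, hb0, hb1, hb⟩ := S.mir.half
  obtain ⟨R1, hR⟩ := eventually_atTop.1 (ha.and (hb.and S.big_ev))
  refine ⟨min (min εa εb) 1, by positivity, R1, ?_⟩
  intro u v s τ s' r hr H u2 v2 r2 h2 hu2 hv2 hclose
  rcases eq_or_ne r2 r with rfl | hne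
  · simp
  have hD : r2 - r ≠ 0 := sub_ne_zero.2 hne
  have hsτ : s ≤ τ := by linarith [H.lt1, S.t1_pos]
  have hτs : τ ≤ s' := H.lt2.le
  set β := fun t => S.b t * exp (v t) * dslope exp 0 (v2 t - v t) with hβ
  set δ := fun t => S.d t * exp (u t) * dslope exp 0 (u2 t - u t) with hδ
  have cβ : Continuous β := (S.bc.mul (continuous_exp.comp H.sol.cv)).mul
    (g_cont.comp (h2.cv.sub H.sol.cv))
  have cδ : Continuous δ := (S.dc.mul (continuous_exp.comp H.sol.cu)).mul
    (g_cont.comp (h2.cu.sub H.sol.cu))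
  have hβ1 : ∀ t ∈ Icc s s', |β t - S.b t * exp (v t)| ≤ min εa εb * (S.b t * exp (v t)) := by
    intro t ht
    have h3 := (hclose t ht).2
    have h4 := g_near (h3.trans (min_le_right _ _))
    have h5 : β t - S.b t * exp (v t) =
      (S.b t * exp (v t)) * (dslope exp 0 (v2 t - v t) - 1) := by rw [hβ]; ring
    have h6 : 0 < S.b t * exp (v t) := mul_pos (S.b_pos t) (exp_pos _)
    rw [h5, abs_mul, abs_of_pos h6, mul_comm]
    exact mul_le_mul_of_nonneg_right (h4.trans (h3.trans (min_le_left _ _))) h6.le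
  have hδ1 : ∀ t ∈ Icc s s', |δ t - S.d t * exp (u t)| ≤ min εa εb * (S.d t * exp (u t)) := by
    intro t ht
    have h3 := (hclose t ht).1
    have h4 := g_near (h3.trans (min_le_right _ _))
    have h5 : δ t - S.d t * exp (u t) =
      (S.d t * exp (u t)) * (dslope exp 0 (u2 t - u t) - 1) := by rw [hδ]; ring
    have h6 : 0 < S.d t * exp (u t) := mul_pos (S.d_pos t) (exp_pos _)
    rw [h5, abs_mul, abs_of_pos h6, mul_comm]
    exact mul_le_mul_of_nonneg_right (h4.trans (h3.trans (min_le_left _ _))) h6.le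
  have hl : Lin β δ (fun t => (u2 t - u t) / (r2 - r)) (fun t => (v2 t - v t) / (r2 - r)) s s' := by
    intro x hx
    have h3 := diff_lin H.sol h2 s s' x hx
    constructor
    · exact (h3.1.div_const (r2 - r)).congr_deriv (by ring)
    · exact (h3.2.div_const (r2 - r)).congr_deriv (by ring)
  have bpos : ∀ t, 0 < S.b t * exp (v t) := fun t => mul_pos (S.b_pos t) (exp_pos _)
  have dpos : ∀ t, 0 < S.d t * exp (u t) := fun t => mul_pos (S.d_pos t) (exp_pos _)
  obtain ⟨f1, f2, f3⟩ := (hR r hr).1 u v β δ _ _ s τ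
    { sol := H.sol, hu := H.hu, hv := H.hv, big := H.big, le := H.lt1.le
      hG := fun t ht => by
        rcases ht.2.lt_or_eq with e | e
        · exact (H.neg t (by linarith [ht.1, S.t1_pos]) e).le
        · rw [e, H.hτ]
      lin := fun x hx => hl x ⟨hx.1, hx.2.trans hτs⟩
      U1 := by simp only [hu2, H.hu]; exact div_self hD
      V1 := by simp only [hv2, H.hv]; exact div_self hD
      ε0 := ha0.le, ε1 := ha1
      hβ := fun t ht => (hβ1 t ⟨ht.1, ht.2.trans hτs⟩).trans
        (mul_le_mul_of_nonneg_right (min_le_left _ _) (bpos t).le)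
      hδ := fun t ht => (hδ1 t ⟨ht.1, ht.2.trans hτs⟩).trans
        (mul_le_mul_of_nonneg_right (min_le_left _ _) (dpos t).le) }
  obtain ⟨P, Q, hPQ, hP, hQ⟩ := lin_exists (fun x => δ (-x)) (fun x => β (-x))
    (cδ.comp continuous_neg) (cβ.comp continuous_neg) (-s') (-τ) 1 1 (by linarith)
  have hBt : S.Big (u s') := (hR _ H.top).2.2
  have l3 := H.lt3 hBt
  obtain ⟨k1, k2, k3⟩ := (hR _ H.top).2.1 (fun t => v (-t)) (fun t => u (-t)) (fun x => δ (-x))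
    (fun x => β (-x)) P Q (-s') (-τ)
    { sol := H.sol.mir, hu := by simp [H.eq], hv := by simp, big := hBt
      le := by
        have : S.mir.t1 = S.t1 := rfl
        linarith
      hG := fun t ht => by
        have e0 : S.mir.t1 = S.t1 := rfl
        have e1 := ht.1
        rw [e0] at e1
        have := S.t1_pos
        rcases ht.2.lt_or_eq with e | e
        · exact (H.pos (-t) (by linarith) (by linarith)).le
        · simp only [e, neg_neg]; exact H.hτ.ge
      lin := hPQ, U1 := hP, V1 := hQ, ε0 := hb0.le, ε1 := hb1
      hβ := fun t ht => (hδ1 (-t) ⟨by linarith [ht.2], by linarith [ht.1]⟩).trans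
        (mul_le_mul_of_nonneg_right (min_le_right _ _) (dpos (-t)).le)
      hδ := fun t ht => (hβ1 (-t) ⟨by linarith [ht.2], by linarith [ht.1]⟩).trans
        (mul_le_mul_of_nonneg_right (min_le_right _ _) (bpos (-t)).le) }
  have hm := hPQ.mir
  simp only [neg_neg] at hm
  have hw := hm.wedge (fun x hx => hl x ⟨hsτ.trans hx.1, hx.2⟩) hτs
  simp only [hP, hQ] at hw
  set p := (u2 τ - u τ) / (r2 - r)
  set q := (v2 τ - v τ) / (r2 - r)
  have e1 : 3 / 4 ≤ (u2 s' - u s') / (r2 - r) * 1 - (v2 s' - v s') / (r2 - r) * 1 := by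
    rw [hw]
    have g1 : 1 ≤ (-p) * (-P (-τ)) := by nlinarith
    have g2 : q * Q (-τ) ≤ (-p / 2) * (-P (-τ) / 2) :=
      mul_le_mul f3 k3 k2.le (by linarith)
    nlinarith
  have e2 : (u2 s' - u s') / (r2 - r) * 1 - (v2 s' - v s') / (r2 - r) * 1
      = (u2 s' - v2 s') / (r2 - r) := by rw [H.eq]; ring
  rw [e2] at e1
  have e3 : (r2 - r) * (u2 s' - v2 s') = (u2 s' - v2 s') / (r2 - r) * (r2 - r) ^ 2 := by
    field_simp
  rw [e3]
  exact mul_le_mul_of_nonneg_right e1 (sq_nonneg _)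

end Sys
end VS

namespace VS
open Real Set Filter Topology MeasureTheory

namespace Sys
variable {S : Sys}

/-- The orbit from `(r,r)` at time `s` makes one full turn in time `ℓ`. -/
def RetL (S : Sys) (R1 s r ℓ : ℝ) : Prop :=
  ∃ τ, S.Ret R1 (S.uu s r) (S.vv s r) s τ (s + ℓ) r

lemma Ret.zero {R1 : ℝ} {u v : ℝ → ℝ} {s τ s' r t : ℝ} (H : S.Ret R1 u v s τ s' r)
    (h1 : s < t) (h2 : t < s') (h3 : u t = v t) : u t < 0 := by
  rcases lt_trichotomy t τ with h | h | h
  · exact absurd h3 (H.neg t h1 h).ne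
  · rw [h]
    have := H.bot
    have := mul_pos S.w_pos (exp_pos r)
    linarith
  · exact absurd h3 (H.pos t h h2).ne'

lemma RetL.unique {R1 s r ℓ ℓ' : ℝ} (hR : 0 < R1) (h : S.RetL R1 s r ℓ) (h' : S.RetL R1 s r ℓ') :
    ℓ = ℓ' := by
  have key : ∀ ℓ ℓ', S.RetL R1 s r ℓ → S.RetL R1 s r ℓ' → ¬ ℓ < ℓ' := by
    rintro ℓ ℓ' ⟨τ, H⟩ ⟨τ', H'⟩ hlt
    have := H'.zero (t := s + ℓ) (by linarith [H.lt, S.t1_pos]) (by linarith) H.eq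
    linarith [H.top]
  exact le_antisymm (not_lt.1 (key _ _ h' h)) (not_lt.1 (key _ _ h h'))

lemma flow_per' (s r t : ℝ) : S.uu (s + S.T) r t = S.uu s r (t - S.T) ∧
    S.vv (s + S.T) r t = S.vv s r (t - S.T) := by
  have := S.flow_per s r (t - S.T)
  simpa using this

lemma RetL.shift {R1 s r ℓ : ℝ} (h : S.RetL R1 s r ℓ) : S.RetL R1 (s + S.T) r ℓ := by
  obtain ⟨τ, H⟩ := h
  have eu : ∀ t, S.uu (s + S.T) r t = S.uu s r (t - S.T) := fun t => (S.flow_per' s r t).1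
  have ev : ∀ t, S.vv (s + S.T) r t = S.vv s r (t - S.T) := fun t => (S.flow_per' s r t).2
  have e : s + S.T + ℓ - S.T = s + ℓ := by ring
  refine ⟨τ + S.T, S.sol _ _, by simp, by simp, H.big, by linarith [H.lt1], ?_, ?_, ?_,
    by linarith [H.lt2], ?_, ?_, ?_⟩
  · rw [eu, ev, add_sub_cancel_right]; exact H.hτ
  · intro t h1 h2
    rw [eu, ev]; exact H.neg _ (by linarith) (by linarith)
  · rw [eu, add_sub_cancel_right]; exact H.bot
  · rw [eu, ev, e]; exact H.eq
  · intro t h1 h2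
    rw [eu, ev]; exact H.pos _ (by linarith) (by linarith)
  · rw [eu, e]; exact H.top

lemma flow_close (S : Sys) (s0 r0 ℓ e : ℝ) (he : 0 < e) : ∃ δ, 0 < δ ∧ ∀ s r, |s - s0| < δ →
    |r - r0| < δ → ∀ t, |t - s0| ≤ ℓ →
    |S.uu s r t - S.uu s0 r0 t| < e ∧ |S.vv s r t - S.vv s0 r0 t| < e := by
  obtain ⟨C, hC, H⟩ := S.flow_lip (|r0| + 1) |ℓ| (by positivity) (abs_nonneg _)
  refine ⟨min 1 (e / (2 * C)), by positivity, ?_⟩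
  intro s r hs hr t ht
  have h1 : |s - s0| ≤ 1 := hs.le.trans (min_le_left _ _)
  have h2 : |r| ≤ |r0| + 1 := by
    have := abs_sub_abs_le_abs_sub r r0
    have := hr.le.trans (min_le_left _ _)
    linarith
  obtain ⟨a1, a2, -, -⟩ := H s0 s r0 r (by linarith) h2 h1 t (ht.trans (le_abs_self _))
  have h3 : C * (|s - s0| + |r - r0|) < e := by
    have b1 := hs.trans_le (min_le_right _ _)
    have b2 := hr.trans_le (min_le_right _ _)
    have b3 : C * (|s - s0| + |r - r0|) < C * (e / (2 * C) + e / (2 * C)) :=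
      mul_lt_mul_of_pos_left (by linarith) (by linarith)
    have b4 : C * (e / (2 * C) + e / (2 * C)) = e := by field_simp; ring
    linarith
  exact ⟨a1.trans_lt h3, a2.trans_lt h3⟩

/-- Near the end of a turn all close-by solutions cross the diagonal downwards. -/
lemma Ret.near {R1 : ℝ} {u v : ℝ → ℝ} {s τ s' r : ℝ} (H : S.Ret R1 u v s τ s' r)
    (hR : 2 * S.M < S.k * exp (R1 - 2)) : ∃ η, 0 < η ∧ ∀ u2 v2, S.Sol u2 v2 → ∀ t t', s' - η ≤ t →
    t < t' → t' ≤ s' + η → (∀ x ∈ Icc t t', |u2 x - u x| ≤ 1) → u2 t' - v2 t' < u2 t - v2 t := by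
  obtain ⟨η, hη, h1⟩ := Metric.continuousAt_iff.1 (H.sol.cu.continuousAt (x := s')) 1 one_pos
  refine ⟨η / 2, by positivity, ?_⟩
  intro u2 v2 h2 t t' ht htt ht' hc
  have := cmp_le (f := fun x => u2 x - v2 x) (C := 2 * S.M - S.k * exp (R1 - 2)) htt.le
    (fun x _ => (h2 x).1.sub (h2 x).2) (fun x hx => by
      have h3 : dist x s' < η := by
        rw [Real.dist_eq, abs_lt]; constructor <;> linarith [hx.1, hx.2]
      have h4 := h1 h3
      rw [Real.dist_eq, abs_lt] at h4
      have h5 := abs_le.1 (hc x ⟨hx.1.le, hx.2.le⟩)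
      have h6 : S.k * exp (R1 - 2) ≤ S.d x * exp (u2 x) :=
        mul_le_mul (S.kd x) (exp_le_exp.2 (by linarith [H.top, h4.1, h5.1])) (exp_pos _).le (S.d_pos x).le
      have h7 : 0 < S.b x * exp (v2 x) := mul_pos (S.b_pos x) (exp_pos _)
      linarith [S.aM, S.cM])
  have h8 : (2 * S.M - S.k * exp (R1 - 2)) * (t' - t) < 0 :=
    mul_neg_of_neg_of_pos (by linarith) (by linarith)
  linarith

lemma RetL.cont {R1 s0 r0 ℓ0 : ℝ} (h : S.RetL R1 s0 r0 ℓ0) (hR0 : 0 < R1)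
    (hR : 2 * S.M < S.k * exp (R1 - 2)) (η : ℝ) (hη : 0 < η) :
    ∃ δ, 0 < δ ∧ ∀ s r ℓ, |s - s0| < δ → |r - r0| < δ → S.RetL R1 s r ℓ → |ℓ - ℓ0| < η := by
  obtain ⟨τ, H⟩ := h
  have ht1 := S.t1_pos
  obtain ⟨η1, hη1, hnear⟩ := H.near hR
  set e := min η1 (η / 2) / 2 with he
  have he0 : 0 < e := by positivity
  have he1 : e < η1 := by
    have := min_le_left η1 (η / 2); linarith
  have he2 : e < η / 2 := by
    have := min_le_right η1 (η / 2); linarith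
  set u := S.uu s0 r0
  set v := S.vv s0 r0
  have g1 : u (s0 + ℓ0 + e) - v (s0 + ℓ0 + e) < 0 := by
    have := hnear u v H.sol (s0 + ℓ0) (s0 + ℓ0 + e) (by linarith) (by linarith) (by linarith)
      (fun x _ => by simp)
    linarith [H.eq]
  set tm := (τ + (s0 + ℓ0)) / 2 with htm
  have tm1 : τ < tm := by linarith [H.lt2]
  have tm2 : tm < s0 + ℓ0 := by linarith [H.lt2]
  have g2 := H.pos tm tm1 tm2
  -- compactness
  obtain ⟨μ, hμ, hcomp⟩ : ∃ μ, 0 < μ ∧ ∀ t ∈ Icc (s0 + S.t1 / 2) (s0 + ℓ0 - e),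
      μ ≤ max |u t - v t| (-u t) := by
    rcases (Icc (s0 + S.t1 / 2) (s0 + ℓ0 - e)).eq_empty_or_nonempty with hE | hE
    · exact ⟨1, one_pos, fun t ht => by rw [hE] at ht; exact absurd ht (notMem_empty t)⟩
    · obtain ⟨t, ht, hmin⟩ := isCompact_Icc.exists_isMinOn hE
        (f := fun t => max |u t - v t| (-u t))
        (((H.sol.cu.sub H.sol.cv).abs.max H.sol.cu.neg).continuousOn)
      refine ⟨max |u t - v t| (-u t), ?_, fun x hx => hmin hx⟩
      by_cases hz : u t = v t
      · have := H.zero (by linarith [ht.1]) (by linarith [ht.2]) hz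
        exact lt_max_of_lt_right (by linarith)
      · exact lt_max_of_lt_left (abs_pos.2 (sub_ne_zero.2 hz))
  set E := min (min (-(u (s0 + ℓ0 + e) - v (s0 + ℓ0 + e))) (u tm - v tm)) μ / 4 with hE
  have hE0 : 0 < E := by
    have : 0 < min (min (-(u (s0 + ℓ0 + e) - v (s0 + ℓ0 + e))) (u tm - v tm)) μ :=
      lt_min (lt_min (by linarith) (by linarith)) hμ
    positivity
  have hE1 : 4 * E ≤ -(u (s0 + ℓ0 + e) - v (s0 + ℓ0 + e)) := by
    rw [hE]; linarith [(min_le_left (min (-(u (s0 + ℓ0 + e) - v (s0 + ℓ0 + e))) (u tm - v tm)) μ).trans (min_le_left _ _)]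
  have hE2 : 4 * E ≤ u tm - v tm := by
    rw [hE]; linarith [(min_le_left (min (-(u (s0 + ℓ0 + e) - v (s0 + ℓ0 + e))) (u tm - v tm)) μ).trans (min_le_right _ _)]
  have hE3 : 4 * E ≤ μ := by
    rw [hE]; linarith [min_le_right (min (-(u (s0 + ℓ0 + e) - v (s0 + ℓ0 + e))) (u tm - v tm)) μ]
  obtain ⟨δ, hδ, hcl⟩ := S.flow_close s0 r0 (ℓ0 + e) E hE0
  refine ⟨min δ (min (S.t1 / 2) (η / 2)), by positivity, ?_⟩
  rintro s r ℓ hs hr ⟨τ2, H2⟩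
  have hs1 := abs_lt.1 (hs.trans_le ((min_le_right _ _).trans (min_le_left _ _)))
  have hs2 := abs_lt.1 (hs.trans_le ((min_le_right _ _).trans (min_le_right _ _)))
  have hcl' := hcl s r (hs.trans_le (min_le_left _ _)) (hr.trans_le (min_le_left _ _))
  have hl0 := H.lt
  have up : s + ℓ ≤ s0 + ℓ0 + e := by
    by_contra hcon
    push Not at hcon
    have c1 := hcl' tm (by rw [abs_le]; constructor <;> linarith [H.lt1])
    have c2 := hcl' (s0 + ℓ0 + e) (by rw [abs_le]; constructor <;> linarith)
    rw [abs_lt, abs_lt] at c1 c2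
    have d1 : S.vv s r tm < S.uu s r tm := by linarith [c1.1.1, c1.2.2]
    have d2 : S.uu s r (s0 + ℓ0 + e) < S.vv s r (s0 + ℓ0 + e) := by linarith [c2.1.2, c2.2.1]
    have d3 : τ2 < tm := by
      by_contra hc
      rcases (not_lt.1 hc).lt_or_eq with e1 | e1
      · have := H2.neg tm (by linarith [H.lt1, hs1.2]) e1
        linarith
      · rw [e1, H2.hτ] at d1
        exact lt_irrefl _ d1
    have := H2.pos (s0 + ℓ0 + e) (by linarith) hcon
    linarith
  have lo : s0 + ℓ0 - e ≤ s + ℓ := by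
    by_contra hcon
    push Not at hcon
    have hl2 := H2.lt
    have c1 := hcl' (s + ℓ) (by rw [abs_le]; constructor <;> linarith [hs1.1])
    have c2 := hcomp (s + ℓ) ⟨by linarith [hs1.1], hcon.le⟩
    rw [abs_lt, abs_lt] at c1
    have d1 := H2.eq
    have d2 := H2.top
    have : max |u (s + ℓ) - v (s + ℓ)| (-u (s + ℓ)) < μ := by
      apply max_lt
      · rw [abs_lt]; constructor <;> linarith [c1.1.1, c1.1.2, c1.2.1, c1.2.2]
      · linarith [c1.1.1, c1.1.2]
    linarith
  rw [abs_lt]; constructor <;> linarith [hs2.1, hs2.2]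

end Sys
end VS

namespace VS
open Real Set Filter Topology MeasureTheory

namespace Sys
variable {S : Sys}

/-- Admissible thresholds. -/
structure Par (S : Sys) (ε1 R1 R0 : ℝ) : Prop where
  e0 : 0 < ε1
  R1pos : 0 < R1
  hR : 2 * S.M < S.k * exp (R1 - 2)
  R10 : R1 ≤ R0
  tw : ∀ u v s τ s' r, R1 ≤ r → S.Ret R1 u v s τ s' r →
    ∀ u2 v2 r2, S.Sol u2 v2 → u2 s = r2 → v2 s = r2 →
    (∀ t ∈ Icc s s', |u2 t - u t| ≤ ε1 ∧ |v2 t - v t| ≤ ε1) →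
    3 / 4 * (r2 - r) ^ 2 ≤ (r2 - r) * (u2 s' - v2 s')
  ex : ∀ s r, R0 ≤ r → ∃ ℓ, S.RetL R1 s r ℓ

lemma par_exists (S : Sys) : ∃ ε1 R1 R0, S.Par ε1 R1 R0 := by
  obtain ⟨ε1, he, R, hR⟩ := S.twist
  have h1 : Tendsto (fun r : ℝ => S.k * exp (r - 2)) atTop atTop :=
    (tendsto_exp_atTop.comp (tendsto_atTop_add_const_right _ (-2) tendsto_id)).const_mul_atTop S.hk
  obtain ⟨R1, a1, a2, a3⟩ := ((h1.eventually_gt_atTop (2 * S.M)).and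
    ((eventually_gt_atTop 0).and (eventually_ge_atTop R))).exists
  obtain ⟨R0, hR0⟩ := eventually_atTop.1 ((S.ret_exists R1).and (eventually_ge_atTop R1))
  refine ⟨ε1, R1, R0, he, a2, a1, (hR0 R0 le_rfl).2, ?_, ?_⟩
  · intro u v s τ s' r hr H
    exact hR u v s τ s' r (a3.trans hr) { H with top := a3.trans H.top }
  · intro s r hr
    obtain ⟨τ, s', H⟩ := (hR0 r hr).1 (S.uu s r) (S.vv s r) s (S.sol s r) (by simp) (by simp)
    exact ⟨s' - s, τ, by simpa using H⟩

section
variable {ε1 R1 R0 : ℝ}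

lemma RetL.mono_loc (hp : S.Par ε1 R1 R0) {s r0 ℓ0 : ℝ} (hr0 : R1 ≤ r0) (h : S.RetL R1 s r0 ℓ0) :
    ∃ δ, 0 < δ ∧ ∀ r ℓ, |r - r0| < δ → S.RetL R1 s r ℓ →
      (r0 < r → ℓ0 < ℓ) ∧ (r < r0 → ℓ < ℓ0) := by
  have hc := h
  obtain ⟨τ, H⟩ := h
  obtain ⟨η, hη, hnear⟩ := H.near hp.hR
  obtain ⟨δ1, hδ1, h1⟩ := hc.cont hp.R1pos hp.hR η hη
  obtain ⟨δ2, hδ2, h2⟩ := S.flow_close s r0 (ℓ0 + η) (min ε1 1) (lt_min hp.e0 one_pos)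
  have hl0 := H.lt
  have ht1 := S.t1_pos
  refine ⟨min δ1 δ2, by positivity, ?_⟩
  intro r ℓ hr hL
  have c1 := abs_lt.1 (h1 s r ℓ (by simpa using hδ1) (hr.trans_le (min_le_left _ _)) hL)
  have c2 := h2 s r (by simpa using hδ2) (hr.trans_le (min_le_right _ _))
  obtain ⟨τ2, H2⟩ := hL
  have tw := hp.tw _ _ _ _ _ _ hr0 H _ _ r (S.sol s r) (by simp) (by simp) (fun t ht => by
    have := c2 t (by rw [abs_le]; constructor <;> linarith [ht.1, ht.2])
    exact ⟨this.1.le.trans (min_le_left _ _), this.2.le.trans (min_le_left _ _)⟩)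
  have hdec : ∀ t t', s + ℓ0 - η ≤ t → s ≤ t → t < t' → t' ≤ s + ℓ0 + η →
      S.uu s r t' - S.vv s r t' < S.uu s r t - S.vv s r t := fun t t' b0 b1 b2 b3 =>
    hnear _ _ (S.sol s r) t t' b0 b2 b3 (fun x hx =>
      ((c2 x (by rw [abs_le]; constructor <;> linarith [hx.1, hx.2])).1.le).trans (min_le_right _ _))
  have hl2 := H2.lt
  have heq := H2.eq
  constructor
  · intro hlt
    have g : 0 < S.uu s r (s + ℓ0) - S.vv s r (s + ℓ0) := by
      by_contra hcon
      have : 0 < (r - r0) ^ 2 := by have : 0 < r - r0 := by linarith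
                                    positivity
      have := mul_nonpos_of_nonneg_of_nonpos (show 0 ≤ r - r0 by linarith) (not_lt.1 hcon)
      linarith
    by_contra hcon
    rcases (not_lt.1 hcon).lt_or_eq with e | e
    · have := hdec (s + ℓ) (s + ℓ0) (by linarith [c1.1]) (by linarith) (by linarith) (by linarith)
      linarith
    · rw [e] at heq
      linarith
  · intro hlt
    have g : S.uu s r (s + ℓ0) - S.vv s r (s + ℓ0) < 0 := by
      by_contra hcon
      have : 0 < (r - r0) ^ 2 := sq_pos_of_neg (by linarith)
      have := mul_nonpos_of_nonpos_of_nonneg (show r - r0 ≤ 0 by linarith) (not_lt.1 hcon)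
      linarith
    by_contra hcon
    rcases (not_lt.1 hcon).lt_or_eq with e | e
    · have := hdec (s + ℓ0) (s + ℓ) (by linarith) (by linarith) (by linarith) (by linarith [c1.2])
      linarith
    · rw [e] at g
      linarith

lemma strictMono_of_loc {f : ℝ → ℝ} {R0 : ℝ} (hc : ContinuousOn f (Ici R0))
    (h : ∀ r0, R0 ≤ r0 → ∃ δ, 0 < δ ∧ ∀ r, R0 ≤ r → |r - r0| < δ → r0 < r → f r0 < f r) :
    StrictMonoOn f (Ici R0) := by
  intro r1 h1 r2 h2 hlt
  have h1 : R0 ≤ r1 := h1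
  by_contra hcon
  have nomax : ∀ ξ ∈ Ico r1 r2, ¬ IsMaxOn f (Icc r1 r2) ξ := by
    intro ξ hξ hmax
    obtain ⟨δ, hδ, hh⟩ := h ξ (h1.trans hξ.1)
    set x := min (ξ + δ / 2) r2
    have x1 : ξ < x := lt_min (by linarith) hξ.2
    have x2 : x ≤ ξ + δ / 2 := min_le_left _ _
    have x3 : x ≤ r2 := min_le_right _ _
    have := hh x (by linarith [hξ.1]) (by rw [abs_lt]; constructor <;> linarith) x1
    have := hmax (show x ∈ Icc r1 r2 from ⟨by linarith [hξ.1], x3⟩)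
    simp only [mem_ofPred_eq] at this
    linarith
  obtain ⟨ξ, hξ, hmax⟩ := isCompact_Icc.exists_isMaxOn (nonempty_Icc.2 hlt.le)
    (hc.mono (fun x hx => h1.trans hx.1))
  rcases hξ.2.lt_or_eq with e | e
  · exact nomax ξ ⟨hξ.1, e⟩ hmax
  · refine nomax r1 ⟨le_rfl, hlt⟩ (fun x hx => ?_)
    have := hmax hx
    simp only [mem_ofPred_eq] at this ⊢
    rw [e] at this
    linarith [not_lt.1 hcon]

/-- The return-time function and its basic properties. -/
lemma L_exists (hp : S.Par ε1 R1 R0) : ∃ L : ℝ → ℝ → ℝ, (∀ s r, R0 ≤ r → S.RetL R1 s r (L s r)) ∧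
    (∀ s r, R0 ≤ r → L (s + S.T) r = L s r) ∧
    (∀ s, StrictMonoOn (L s) (Ici R0)) ∧ (∀ s, ContinuousOn (L s) (Ici R0)) ∧
    (∀ r, R0 ≤ r → Continuous fun s => L s r) ∧
    (∀ s ℓ, ∃ r, R0 ≤ r ∧ ℓ ≤ L s r) := by
  choose! L hL using fun s => hp.ex s
  have hcont : ∀ s, ContinuousOn (L s) (Ici R0) := by
    intro s r0 hr0
    rw [ContinuousWithinAt, Metric.tendsto_nhdsWithin_nhds]
    intro η hη
    obtain ⟨δ, hδ, h⟩ := (hL s r0 hr0).cont hp.R1pos hp.hR η hη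
    exact ⟨δ, hδ, fun {r} hr hd => h s r _ (by simpa using hδ) hd (hL s r hr)⟩
  refine ⟨L, hL, ?_, ?_, hcont, ?_, ?_⟩
  · intro s r hr
    exact (hL (s + S.T) r hr).unique hp.R1pos (hL s r hr).shift
  · intro s
    refine strictMono_of_loc (hcont s) (fun r0 hr0 => ?_)
    obtain ⟨δ, hδ, h⟩ := (hL s r0 hr0).mono_loc hp (hp.R10.trans hr0)
    exact ⟨δ, hδ, fun r hr hd => (h r _ hd (hL s r hr)).1⟩
  · intro r hr
    rw [Metric.continuous_iff]
    intro s η hη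
    obtain ⟨δ, hδ, h⟩ := (hL s r hr).cont hp.R1pos hp.hR η hη
    exact ⟨δ, hδ, fun s' hd => h s' r _ hd (by simpa using hδ) (hL s' r hr)⟩
  · intro s ℓ
    have h1 : Tendsto (fun r : ℝ => S.w / S.M * exp r) atTop atTop :=
      tendsto_exp_atTop.const_mul_atTop (div_pos S.w_pos S.M_pos)
    obtain ⟨r, a1, a2⟩ := ((h1.eventually_ge_atTop ℓ).and (eventually_ge_atTop R0)).exists
    obtain ⟨τ, H⟩ := hL s r a2
    have := H.time hp.R1pos.le
    refine ⟨r, a2, ?_⟩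
    have e : S.w * exp r / S.M = S.w / S.M * exp r := by ring
    linarith

lemma per_bdd {T : ℝ} (hT : 0 < T) {f : ℝ → ℝ} (hf : Continuous f) (hp : ∀ t, f (t + T) = f t) :
    ∃ B, ∀ t, f t ≤ B := by
  obtain ⟨B, hB⟩ := isCompact_Icc.exists_bound_of_continuousOn (s := Icc 0 T) hf.continuousOn
  refine ⟨B, fun t => ?_⟩
  obtain ⟨y, hy, e⟩ := Function.Periodic.exists_mem_Ico₀ (f := f) (c := T) hp hT t
  rw [e]
  exact (le_abs_self _).trans (hB y ⟨hy.1, hy.2.le⟩)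

/-- The section of initial points that return after time `m T`. -/
lemma r_exists (hp : S.Par ε1 R1 R0) : ∃ (m0 : ℕ) (ρ : ℕ → ℝ → ℝ), 1 ≤ m0 ∧
    (∀ m, m0 ≤ m → (∀ s, R0 ≤ ρ m s) ∧ (∀ s, S.RetL R1 s (ρ m s) (m * S.T)) ∧
      (∀ s, ρ m (s + S.T) = ρ m s) ∧ Continuous (ρ m)) ∧
    (∀ Q, ∀ᶠ m in atTop, ∀ s, Q ≤ ρ m s) := by
  obtain ⟨L, h1, h2, h3, h4, h5, h6⟩ := L_exists hp
  have hT := S.hT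
  have bd : ∀ Q, R0 ≤ Q → ∃ B, ∀ s, L s Q ≤ B := fun Q hQ =>
    per_bdd hT (h5 Q hQ) (fun s => h2 s Q hQ)
  have hm : ∀ B : ℝ, ∃ m0 : ℕ, ∀ m : ℕ, m0 ≤ m → B < m * S.T := by
    intro B
    have : Tendsto (fun m : ℕ => (m : ℝ) * S.T) atTop atTop :=
      tendsto_natCast_atTop_atTop.atTop_mul_const hT
    exact eventually_atTop.1 (this.eventually_gt_atTop B)
  obtain ⟨B0, hB0⟩ := bd R0 le_rfl
  obtain ⟨m0, hm0⟩ := hm B0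
  have ex : ∀ m : ℕ, ∀ s, ∃ r, max m0 1 ≤ m → R0 ≤ r ∧ L s r = m * S.T := by
    intro m s
    by_cases hmm : max m0 1 ≤ m
    · obtain ⟨r, a1, a2⟩ := h6 s (m * S.T)
      have := intermediate_value_Icc a1 ((h4 s).mono (fun x hx => hx.1))
      obtain ⟨x, hx, e⟩ := this ⟨(hB0 s).trans (hm0 m ((le_max_left _ _).trans hmm)).le, a2⟩
      exact ⟨x, fun _ => ⟨hx.1, e⟩⟩
    · exact ⟨0, fun h => absurd h hmm⟩
  choose ρ hρ using ex
  refine ⟨max m0 1, ρ, le_max_right _ _, ?_, ?_⟩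
  · intro m hmm
    have q0 : ∀ s, R0 ≤ ρ m s := fun s => (hρ m s hmm).1
    have qL : ∀ s, L s (ρ m s) = m * S.T := fun s => (hρ m s hmm).2
    refine ⟨q0, fun s => ?_, fun s => ?_, ?_⟩
    · rw [← qL s]; exact h1 s _ (q0 s)
    · apply (h3 s).injOn (q0 _) (q0 _)
      rw [qL s, ← h2 s _ (q0 _), qL]
    · rw [Metric.continuous_iff]
      intro s0 η hη
      have up : ∀ᶠ s in 𝓝 s0, ρ m s < ρ m s0 + η := by
        have e1 : m * S.T < L s0 (ρ m s0 + η) := by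
          rw [← qL s0]
          exact h3 s0 (q0 s0) (show R0 ≤ _ by linarith [q0 s0]) (by linarith)
        have hR : R0 ≤ ρ m s0 + η := by linarith [q0 s0]
        filter_upwards [(h5 _ hR).continuousAt.eventually (lt_mem_nhds e1)] with s hs
        rw [← qL s] at hs
        exact ((h3 s).lt_iff_lt (q0 s) hR).1 hs
      have lo : ∀ᶠ s in 𝓝 s0, ρ m s0 - η < ρ m s := by
        rcases lt_or_ge (ρ m s0 - η) R0 with hc | hR
        · exact Eventually.of_forall (fun s => hc.trans_le (q0 s))
        · have e1 : L s0 (ρ m s0 - η) < m * S.T := by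
            rw [← qL s0]
            exact h3 s0 hR (q0 s0) (by linarith)
          filter_upwards [(h5 _ hR).continuousAt.eventually (gt_mem_nhds e1)] with s hs
          rw [← qL s] at hs
          exact ((h3 s).lt_iff_lt hR (q0 s)).1 hs
      obtain ⟨δ, hδ, hh⟩ := Metric.eventually_nhds_iff.1 (up.and lo)
      refine ⟨δ, hδ, fun s hs => ?_⟩
      have := hh hs
      rw [Real.dist_eq, abs_lt]; constructor <;> linarith [this.1, this.2]
  · intro Q
    obtain ⟨B, hB⟩ := bd (max Q R0) (le_max_right _ _)
    obtain ⟨m1, hm1⟩ := hm B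
    filter_upwards [eventually_ge_atTop (max m1 (max m0 1))] with m hmm s
    obtain ⟨a1, a2⟩ := hρ m s ((le_max_right _ _).trans hmm)
    have := hm1 m ((le_max_left _ _).trans hmm)
    have h7 : L s (max Q R0) < L s (ρ m s) := by rw [a2]; exact (hB s).trans_lt this
    exact (le_max_left _ _).trans (((h3 s).lt_iff_lt (mem_Ici.2 (le_max_right Q R0)) a1).1 h7).le

end
end Sys
end VS

namespace VS
open Real Set Filter Topology MeasureTheory

lemma deriv_lip {f : ℝ → ℝ} {f' x : ℝ} (h : HasDerivAt f f' x) :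
    ∃ C, 0 ≤ C ∧ ∀ᶠ y in 𝓝 x, |f y - f x| ≤ C * |y - x| := by
  obtain ⟨C, hC, h1⟩ := h.isBigO_sub.exists_nonneg
  exact ⟨C, hC, h1.bound⟩

lemma deriv_of_quad {f g : ℝ → ℝ} {g' x C : ℝ} (hg : HasDerivAt g g' x)
    (h : ∀ᶠ y in 𝓝 x, |(f y - g y) - (f x - g x)| ≤ C * |y - x| ^ 2) : HasDerivAt f g' x := by
  have h1 : (fun y => (f y - g y) - (f x - g x)) =O[𝓝 x] fun y => ‖y - x‖ ^ 2 := by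
    apply Asymptotics.IsBigO.of_bound C
    filter_upwards [h] with y hy
    simpa using hy
  have h2 := (h1.hasFDerivAt (by norm_num)).hasDerivAt
  have h3 := (hg.add h2).add_const (f x - g x)
  have h4 : (fun y => f y) = fun y => g y + (f y - g y - (f x - g x)) + (f x - g x) := by
    funext y; ring
  have h5 : HasDerivAt (fun y => f y) g' x := by
    rw [h4]
    exact h3.congr_deriv (by simp)
  exact h5

namespace Sys
variable {S : Sys} {ε1 R1 R0 ℓ : ℝ} {r : ℝ → ℝ}

/-- A continuous periodic section of points with return time exactly `ℓ`. -/
structure Sec (S : Sys) (ε1 R1 R0 ℓ : ℝ) (r : ℝ → ℝ) : Prop where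
  par : S.Par ε1 R1 R0
  ge : ∀ s, R0 ≤ r s
  ret : ∀ s, S.RetL R1 s (r s) ℓ
  per : ∀ s, r (s + S.T) = r s
  cont : Continuous r

lemma Sec.pos (h : S.Sec ε1 R1 R0 ℓ r) : 0 < ℓ := by
  obtain ⟨τ, H⟩ := h.ret 0
  linarith [H.lt, S.t1_pos]

lemma Sec.lip (h : S.Sec ε1 R1 R0 ℓ r) (s : ℝ) :
    ∃ C, 0 ≤ C ∧ ∀ᶠ y in 𝓝 s, |r y - r s| ≤ C * |y - s| := by
  have hℓ := h.pos
  obtain ⟨δ, hδ, hcl⟩ := S.flow_close s (r s) (ℓ + 1) (ε1 / 2) (by linarith [h.par.e0])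
  obtain ⟨C1, hC1, hfl⟩ := S.flow_lip |r s| (ℓ + 1) (abs_nonneg _) (by linarith)
  have hd := (((S.sol s (r s)) (s + ℓ)).1.comp_add_const s ℓ).sub
    (((S.sol s (r s)) (s + ℓ)).2.comp_add_const s ℓ)
  obtain ⟨C2, hC2, hG⟩ := deriv_lip hd
  refine ⟨4 / 3 * (2 * C1 + C2), by positivity, ?_⟩
  have e1 : ∀ᶠ y in 𝓝 s, |y - s| < min δ 1 := Metric.ball_mem_nhds s (by positivity)
  have e2 : ∀ᶠ y in 𝓝 s, |r y - r s| < δ :=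
    h.cont.continuousAt.eventually (Metric.ball_mem_nhds (r s) hδ)
  filter_upwards [e1, e2, hG] with y h1 h2 h3
  have h1a := h1.trans_le (min_le_left _ _)
  have h1b := h1.trans_le (min_le_right _ _)
  have h1c := abs_lt.1 h1b
  obtain ⟨τ, H⟩ := h.ret y
  have tw := h.par.tw _ _ _ _ _ _ (h.par.R10.trans (h.ge y)) H _ _ (r s) (S.sol y (r s)) (by simp)
    (by simp) (fun t ht => by
      have ht' : |t - s| ≤ ℓ + 1 := by
        rw [abs_le]; constructor <;> linarith [ht.1, ht.2, h1c.1, h1c.2]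
      have a1 := hcl y (r y) h1a h2 t ht'
      have a2 := hcl y (r s) h1a (by simpa using hδ) t ht'
      rw [abs_lt, abs_lt] at a1 a2
      constructor <;> rw [abs_le] <;> constructor <;> linarith [a1.1.1, a1.1.2, a1.2.1, a1.2.2, a2.1.1, a2.1.2, a2.2.1, a2.2.2])
  have b1 := hfl s y (r s) (r s) le_rfl le_rfl h1b.le (y + ℓ) (by
    rw [abs_le]; constructor <;> linarith [h1c.1, h1c.2])
  simp only [sub_self, abs_zero, add_zero] at b1
  obtain ⟨b2, b3, -, -⟩ := b1
  obtain ⟨τ', H'⟩ := h.ret s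
  have heq := H'.eq
  have h3' : |S.uu s (r s) (y + ℓ) - S.vv s (r s) (y + ℓ)| ≤ C2 * |y - s| := by
    have : (S.uu s (r s) (y + ℓ) - S.vv s (r s) (y + ℓ)) - (S.uu s (r s) (s + ℓ) - S.vv s (r s) (s + ℓ))
      = S.uu s (r s) (y + ℓ) - S.vv s (r s) (y + ℓ) := by rw [heq]; ring
    rw [← this]; exact h3
  set g := S.uu y (r s) (y + ℓ) - S.vv y (r s) (y + ℓ) with hg
  have c1 : |g| ≤ (2 * C1 + C2) * |y - s| := by
    rw [abs_le] at b2 b3 h3' ⊢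
    constructor <;> nlinarith [b2.1, b2.2, b3.1, b3.2, h3'.1, h3'.2]
  have c2 : 3 / 4 * |r y - r s| ≤ |g| := by
    rcases eq_or_ne (r y) (r s) with e | e
    · rw [e]; simp
    · have d1 : 0 < |r y - r s| := abs_pos.2 (sub_ne_zero.2 e)
      have d2 : (r s - r y) * g ≤ |r y - r s| * |g| := by
        rw [abs_sub_comm, ← abs_mul]; exact le_abs_self _
      have d3 : (r s - r y) ^ 2 = |r y - r s| * |r y - r s| := by
        rw [abs_sub_comm, ← sq, sq_abs]
      rw [d3] at tw
      have d4 : |r y - r s| * (3 / 4 * |r y - r s|) ≤ |r y - r s| * |g| := by linarith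
      exact le_of_mul_le_mul_left d4 d1
  linarith

/-- Lipschitz dependence of the orbits along the section. -/
lemma Sec.orbit (h : S.Sec ε1 R1 R0 ℓ r) (s : ℝ) :
    ∃ C, 1 ≤ C ∧ ∀ᶠ y in 𝓝 s, |r y - r s| ≤ C * |y - s| ∧ ∀ t, |t - s| ≤ ℓ + 1 →
      |S.uu y (r y) t - S.uu s (r s) t| ≤ C * |y - s| ∧
      |S.vv y (r y) t - S.vv s (r s) t| ≤ C * |y - s| ∧
      |S.uu s (r s) t| ≤ C ∧ |S.vv s (r s) t| ≤ C := by
  have hℓ := h.pos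
  obtain ⟨C0, hC0, hr⟩ := h.lip s
  obtain ⟨C1, hC1, hfl⟩ := S.flow_lip (|r s| + 1) (ℓ + 1) (by positivity) (by linarith)
  refine ⟨C1 * (1 + C0) + C0, by nlinarith, ?_⟩
  have e1 : ∀ᶠ y in 𝓝 s, |y - s| < 1 := Metric.ball_mem_nhds s (by positivity)
  have e2 : ∀ᶠ y in 𝓝 s, |r y - r s| < 1 :=
    h.cont.continuousAt.eventually (Metric.ball_mem_nhds (r s) one_pos)
  filter_upwards [e1, e2, hr] with y h1 h2 h3
  have h4 := abs_nonneg (y - s)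
  refine ⟨by nlinarith [mul_nonneg (show 0 ≤ C1 * (1 + C0) by positivity) h4], fun t ht => ?_⟩
  have h5 : |r y| ≤ |r s| + 1 := by
    have := abs_sub_abs_le_abs_sub (r y) (r s)
    linarith
  obtain ⟨a1, a2, -, -⟩ := hfl s y (r s) (r y) (by linarith) h5 h1.le t ht
  obtain ⟨-, -, a3, a4⟩ := hfl s s (r s) (r s) (by linarith) (by linarith) (by simp) t ht
  have h6 : C1 * (|y - s| + |r y - r s|) ≤ (C1 * (1 + C0) + C0) * |y - s| := by
    have : C1 * |r y - r s| ≤ C1 * (C0 * |y - s|) := mul_le_mul_of_nonneg_left h3 (by linarith)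
    have := mul_nonneg hC0 h4
    nlinarith
  have h7 : C1 ≤ C1 * (1 + C0) + C0 := by nlinarith
  exact ⟨a1.trans h6, a2.trans h6, a3.trans h7, a4.trans h7⟩

end Sys
end VS

namespace VS
open Real Set Filter Topology MeasureTheory

lemma rem1 {x : ℝ} (hx : |x| ≤ 1) : |exp x * (x - 1) + 1| ≤ 3 * x ^ 2 := by
  have h1 := abs_exp_sub_one_sub_id_le hx
  have h2 : exp x * (x - 1) + 1 = (exp x - 1 - x) * (x - 1) + x ^ 2 := by ring
  have h3 : |x - 1| ≤ 2 := by
    rw [abs_le] at hx ⊢; constructor <;> linarith [hx.1, hx.2]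
  rw [h2]
  refine (abs_add_le _ _).trans ?_
  rw [abs_mul, abs_of_nonneg (sq_nonneg x)]
  have := mul_le_mul h1 h3 (abs_nonneg _) (sq_nonneg x)
  linarith

namespace Sys
variable {S : Sys} {ε1 R1 R0 ℓ : ℝ} {r : ℝ → ℝ}

/-- the Lagrangian along a pair of functions -/
noncomputable def lag (S : Sys) (u v : ℝ → ℝ) (t : ℝ) : ℝ :=
  S.d t * exp (u t) * (u t - 1) - S.b t * exp (v t) + S.a * v t

lemma lag_cont {u v : ℝ → ℝ} (h : S.Sol u v) : Continuous (S.lag u v) := by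
  have := S.dc; have := S.bc; have := h.cu; have := h.cv
  unfold lag
  fun_prop

lemma lag_diff {u v u2 v2 : ℝ → ℝ} {t C H : ℝ} (hu : |u t| ≤ C) (hv : |v t| ≤ C)
    (hU : |u2 t - u t| ≤ H) (hV : |v2 t - v t| ≤ H) (hH : H ≤ 1) :
    |S.lag u2 v2 t - S.lag u v t - ((S.a - S.b t * exp (v t)) * (v2 t - v t) +
      u t * ((-S.c + S.d t * exp (u2 t)) - (-S.c + S.d t * exp (u t))))| ≤
      4 * S.M * exp C * H ^ 2 := by
  have h0 : 0 ≤ H := (abs_nonneg _).trans hU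
  have h1 := rem1 (hU.trans hH)
  have h2 := abs_exp_sub_one_sub_id_le (hV.trans hH)
  have e1 : exp (u2 t) = exp (u t) * exp (u2 t - u t) := by rw [← exp_add]; ring_nf
  have e2 : exp (v2 t) = exp (v t) * exp (v2 t - v t) := by rw [← exp_add]; ring_nf
  have q1 : (u2 t - u t) ^ 2 ≤ H ^ 2 := by rw [← sq_abs]; gcongr
  have q2 : (v2 t - v t) ^ 2 ≤ H ^ 2 := by rw [← sq_abs]; gcongr
  have h3 : S.lag u2 v2 t - S.lag u v t - ((S.a - S.b t * exp (v t)) * (v2 t - v t) +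
      u t * ((-S.c + S.d t * exp (u2 t)) - (-S.c + S.d t * exp (u t)))) =
      S.d t * exp (u t) * (exp (u2 t - u t) * (u2 t - u t - 1) + 1) -
      S.b t * exp (v t) * (exp (v2 t - v t) - 1 - (v2 t - v t)) := by
    unfold lag
    rw [e1, e2]; ring
  rw [h3]
  have a1 : S.d t * exp (u t) ≤ S.M * exp C :=
    mul_le_mul (S.dM t) (exp_le_exp.2 ((le_abs_self _).trans hu)) (exp_pos _).le S.M_pos.le
  have a2 : S.b t * exp (v t) ≤ S.M * exp C :=
    mul_le_mul (S.bM t) (exp_le_exp.2 ((le_abs_self _).trans hv)) (exp_pos _).le S.M_pos.le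
  have p1 : 0 < S.d t * exp (u t) := mul_pos (S.d_pos t) (exp_pos _)
  have p2 : 0 < S.b t * exp (v t) := mul_pos (S.b_pos t) (exp_pos _)
  have p3 : 0 < S.M * exp C := mul_pos S.M_pos (exp_pos _)
  refine (abs_sub _ _).trans ?_
  rw [abs_mul (S.d t * exp (u t)), abs_mul (S.b t * exp (v t)), abs_of_pos p1, abs_of_pos p2]
  have b1 := mul_le_mul a1 (h1.trans (mul_le_mul_of_nonneg_left q1 (by norm_num))) (abs_nonneg _) p3.le
  have b2 := mul_le_mul a2 (h2.trans q2) (abs_nonneg _) p3.le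
  linarith

/-- the reduced action -/
noncomputable def Act (S : Sys) (ℓ : ℝ) (r : ℝ → ℝ) (s : ℝ) : ℝ :=
  (∫ t in s..(s + ℓ), S.lag (S.uu s (r s)) (S.vv s (r s)) t) -
    ((S.uu s (r s) (s + ℓ)) ^ 2 - (r s) ^ 2) / 2

lemma Act_per (hper : ∀ s, r (s + S.T) = r s) (s : ℝ) : S.Act ℓ r (s + S.T) = S.Act ℓ r s := by
  unfold Act
  have e : s + S.T + ℓ = s + ℓ + S.T := by ring
  rw [hper, e, ← intervalIntegral.integral_comp_add_right]
  have e2 := S.flow_per s (r s)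
  rw [(e2 _).1]
  congr 1
  apply intervalIntegral.integral_congr
  intro t _
  simp only [lag]
  rw [(e2 t).1, (e2 t).2, S.dp, S.bp]

noncomputable def Ham (S : Sys) (s ρ : ℝ) : ℝ := (S.b s + S.d s) * exp ρ - (S.a + S.c) * ρ

set_option maxHeartbeats 2000000 in
theorem Sec.act_deriv (h : S.Sec ε1 R1 R0 ℓ r) (hb : ∀ t, S.b (t + ℓ) = S.b t)
    (hd : ∀ t, S.d (t + ℓ) = S.d t) (s : ℝ) :
    HasDerivAt (S.Act ℓ r) (S.Ham s (r s) - S.Ham s (S.uu s (r s) (s + ℓ))) s := by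
  have hℓ := h.pos
  obtain ⟨C, hC, horb⟩ := h.orbit s
  set u := S.uu s (r s) with hu
  set v := S.vv s (r s) with hv
  have hsol : S.Sol u v := S.sol _ _
  have us : u s = r s := by simp [hu]
  have vs : v s = r s := by simp [hv]
  set r' := u (s + ℓ) with hr'
  have vr' : v (s + ℓ) = r' := by
    obtain ⟨τ, H⟩ := h.ret s
    exact H.eq.symm
  have hlc := lag_cont hsol
  have hJ : ∀ t, HasDerivAt (fun t => ∫ x in s..t, S.lag u v x) (S.lag u v t) t := fun t =>
    (hlc.integral_hasStrictDerivAt s t).hasDerivAt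
  set J := fun t => ∫ x in s..t, S.lag u v x with hJd
  set Ψ := fun σ => J (σ + ℓ) - J σ - r' * v (σ + ℓ) + r s * v σ with hΨ
  have hΨd : HasDerivAt Ψ (S.Ham s (r s) - S.Ham s r') s := by
    have h1 := ((((hJ (s + ℓ)).comp_add_const s ℓ).sub (hJ s)).sub
      (((hsol (s + ℓ)).2.comp_add_const s ℓ).const_mul r')).add ((hsol s).2.const_mul (r s))
    refine HasDerivAt.congr_deriv h1 ?_
    unfold lag Ham
    rw [vr', us, vs, hb, hd, ← hr']
    ring
  obtain ⟨C2, hC2, hd2⟩ := deriv_lip (((hsol (s + ℓ)).1.comp_add_const s ℓ))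
  obtain ⟨C3, hC3, hd3⟩ := deriv_lip (hsol s).1
  refine deriv_of_quad (C := 4 * S.M * exp C * C ^ 2 * ℓ + C2 * C + C3 * C + (C + C2) ^ 2 + C ^ 2) hΨd ?_
  have e1 : ∀ᶠ y in 𝓝 s, |y - s| < 1 / C := Metric.ball_mem_nhds s (by positivity)
  filter_upwards [e1, horb, hd2, hd3] with y h1 h2 h3 h4
  obtain ⟨h2r, h2⟩ := h2
  set k := |y - s| with hk
  have hk0 : 0 ≤ k := abs_nonneg _
  have hCk : C * k ≤ 1 := by
    rw [lt_div_iff₀ (by linarith)] at h1; linarith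
  have hk1 : k ≤ 1 := by nlinarith
  have hys := abs_le.1 hk1
  set u2 := S.uu y (r y) with hu2
  set v2 := S.vv y (r y) with hv2
  have hsol2 : S.Sol u2 v2 := S.sol _ _
  have us2 : u2 y = r y := by simp [hu2]
  have vs2 : v2 y = r y := by simp [hv2]
  set r2' := u2 (y + ℓ) with hr2'
  have vr2' : v2 (y + ℓ) = r2' := by
    obtain ⟨τ, H⟩ := h.ret y
    exact H.eq.symm
  have hlc2 := lag_cont hsol2
  have hJ2 : ∀ t, HasDerivAt (fun t => ∫ x in s..t, S.lag u2 v2 x) (S.lag u2 v2 t) t := fun t =>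
    (hlc2.integral_hasStrictDerivAt s t).hasDerivAt
  set J2 := fun t => ∫ x in s..t, S.lag u2 v2 x with hJ2d
  have hF : ∀ x ∈ Icc y (y + ℓ), HasDerivAt (fun t => J2 t - J t - u t * (v2 t - v t))
      (S.lag u2 v2 x - S.lag u v x - ((S.a - S.b x * exp (v x)) * (v2 x - v x) +
      u x * ((-S.c + S.d x * exp (u2 x)) - (-S.c + S.d x * exp (u x))))) x := fun x _ =>
    ((hJ2 x).sub (hJ x)).sub ((hsol x).1.mul ((hsol2 x).2.sub (hsol x).2))
  have hyl : y ≤ y + ℓ := by linarith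
  have hbd : ∀ x ∈ Ioo y (y + ℓ), |S.lag u2 v2 x - S.lag u v x -
      ((S.a - S.b x * exp (v x)) * (v2 x - v x) +
      u x * ((-S.c + S.d x * exp (u2 x)) - (-S.c + S.d x * exp (u x))))| ≤
      4 * S.M * exp C * (C * k) ^ 2 := by
    intro x hx
    obtain ⟨g1, g2, g3, g4⟩ := h2 x (by rw [abs_le]; constructor <;> linarith [hx.1, hx.2, hys.1, hys.2])
    exact lag_diff g3 g4 g1 g2 hCk
  have f1 := cmp_le hyl hF (fun x hx => (abs_le.1 (hbd x hx)).2)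
  have f2 := cmp_ge hyl hF (fun x hx => (abs_le.1 (hbd x hx)).1)
  have eA : S.Act ℓ r y = J2 (y + ℓ) - J2 y - (r2' ^ 2 - (r y) ^ 2) / 2 := by
    unfold Act
    rw [hJ2d]
    simp only
    rw [intervalIntegral.integral_interval_sub_left (hlc2.intervalIntegrable _ _)
      (hlc2.intervalIntegrable _ _)]
  have eB : S.Act ℓ r s - Ψ s = (r' ^ 2 - (r s) ^ 2) / 2 := by
    rw [hΨ]
    simp only
    rw [vr', vs]
    have : J s = 0 := by simp [hJd]
    rw [this]
    unfold Act
    rw [← hu, ← hv, ← hr', hJd]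
    simp only
    ring
  obtain ⟨-, g2, -, -⟩ := h2 y (by rw [abs_le]; constructor <;> linarith [hys.1, hys.2])
  obtain ⟨g1', g2', -, -⟩ := h2 (y + ℓ) (by rw [abs_le]; constructor <;> linarith [hys.1, hys.2])
  rw [eB, eA, hΨ]
  simp only
  simp only [vr2', vs2] at f1 f2 g2 g2'
  set fd := (J2 (y + ℓ) - J (y + ℓ) - u (y + ℓ) * (r2' - v (y + ℓ))) - (J2 y - J y - u y * (r y - v y))
    with hfd
  have eq : J2 (y + ℓ) - J2 y - (r2' ^ 2 - r y ^ 2) / 2 - (J (y + ℓ) - J y - r' * v (y + ℓ) + r s * v y) -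
      (r' ^ 2 - r s ^ 2) / 2 = fd + (u (y + ℓ) - r') * (r2' - v (y + ℓ)) - (u y - r s) * (r y - v y)
      - (r2' - r') ^ 2 / 2 + (r y - r s) ^ 2 / 2 := by rw [hfd]; ring
  rw [eq]
  rw [us] at h4
  have m1 : |(u (y + ℓ) - r') * (r2' - v (y + ℓ))| ≤ (C2 * k) * (C * k) := by
    rw [abs_mul]; exact mul_le_mul h3 g2' (abs_nonneg _) (by positivity)
  have m2 : |(u y - r s) * (r y - v y)| ≤ (C3 * k) * (C * k) := by
    rw [abs_mul]; exact mul_le_mul h4 g2 (abs_nonneg _) (by positivity)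
  have m3 : (r2' - r') ^ 2 ≤ ((C + C2) * k) ^ 2 := by
    rw [← sq_abs (r2' - r')]
    have : |r2' - r'| ≤ (C + C2) * k := by
      rw [abs_le] at g1' ⊢
      have h3' := abs_le.1 h3
      constructor <;> linarith [g1'.1, g1'.2, h3'.1, h3'.2]
    gcongr
  have m4 : (r y - r s) ^ 2 ≤ (C * k) ^ 2 := by
    rw [← sq_abs (r y - r s)]; gcongr
  have m5 : y + ℓ - y = ℓ := by ring
  rw [m5] at f1 f2
  rw [abs_le] at m1 m2 ⊢
  have n1 := sq_nonneg (r2' - r')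
  have n2 := sq_nonneg (r y - r s)
  obtain ⟨m1a, m1b⟩ := m1
  obtain ⟨m2a, m2b⟩ := m2
  clear_value u v u2 v2 J J2 fd k r' r2'
  constructor <;> linarith

end Sys
end VS

namespace VS
open Real Set Filter Topology MeasureTheory

/-- A differentiable periodic function has two distinct critical points in a period. -/
lemma two_crit {T : ℝ} (hT : 0 < T) {f f' : ℝ → ℝ} (hd : ∀ s, HasDerivAt f (f' s) s)
    (hp : ∀ t, f (t + T) = f t) :
    ∃ s0 s1, s0 ∈ Ico 0 T ∧ s1 ∈ Ico 0 T ∧ s0 ≠ s1 ∧ f' s0 = 0 ∧ f' s1 = 0 := by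
  have hf : Continuous f := continuous_iff_continuousAt.2 fun s => (hd s).continuousAt
  have key : ∀ t, ∃ y ∈ Ico 0 T, f t = f y := fun t =>
    Function.Periodic.exists_mem_Ico₀ (f := f) (c := T) hp hT t
  obtain ⟨p, -, hpm⟩ := isCompact_Icc.exists_isMaxOn (s := Icc 0 T) ⟨0, le_rfl, hT.le⟩
    hf.continuousOn
  obtain ⟨q, -, hqm⟩ := isCompact_Icc.exists_isMinOn (s := Icc 0 T) ⟨0, le_rfl, hT.le⟩
    hf.continuousOn
  obtain ⟨p', hp', ep⟩ := key p
  obtain ⟨q', hq', eq⟩ := key q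
  have mx : ∀ t, f t ≤ f p' := by
    intro t
    obtain ⟨y, hy, e⟩ := key t
    rw [e, ← ep]
    exact hpm ⟨hy.1, hy.2.le⟩
  have mn : ∀ t, f q' ≤ f t := by
    intro t
    obtain ⟨y, hy, e⟩ := key t
    rw [e, ← eq]
    exact hqm ⟨hy.1, hy.2.le⟩
  have cx : ∀ p0, (∀ t, f t ≤ f p0) → f' p0 = 0 := fun p0 h =>
    IsLocalMax.hasDerivAt_eq_zero (Eventually.of_forall h) (hd p0)
  have cn : ∀ p0, (∀ t, f p0 ≤ f t) → f' p0 = 0 := fun p0 h =>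
    IsLocalMin.hasDerivAt_eq_zero (Eventually.of_forall h) (hd p0)
  by_cases hpq : p' = q'
  · have cst : ∀ s t, f s ≤ f t := fun s t => by
      have := mx s; have := mn t; rw [hpq] at *; linarith
    refine ⟨0, T / 2, ⟨le_rfl, hT⟩, ⟨by linarith, by linarith⟩, by linarith [hT] |> fun h : (0:ℝ) < T / 2 => h.ne, ?_, ?_⟩
    · exact cx _ fun t => cst _ _
    · exact cx _ fun t => cst _ _
  · exact ⟨p', q', hp', hq', hpq, cx _ mx, cn _ mn⟩

namespace Sys
variable {S : Sys} {ε1 R1 R0 ℓ : ℝ} {r : ℝ → ℝ}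

lemma Par.ham_inj (h : S.Par ε1 R1 R0) (s : ℝ) {x y : ℝ} (hx : R1 ≤ x) (hy : R1 ≤ y)
    (e : S.Ham s x = S.Ham s y) : x = y := by
  have key : ∀ x y, R1 ≤ x → x < y → S.Ham s x < S.Ham s y := by
    intro x y hx hxy
    have h1 := h.hR
    have h2 : exp (R1 - 2) ≤ exp x := exp_le_exp.2 (by linarith)
    have h3 : exp x * (y - x) ≤ exp y - exp x := by
      have := add_one_le_exp (y - x)
      have e1 : exp y = exp x * exp (y - x) := by rw [← exp_add]; congr 1; ring
      rw [e1]
      nlinarith [exp_pos x]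
    have h4 : S.k ≤ S.b s + S.d s := by linarith [S.kb s, S.d_pos s]
    have h5 : S.k * (exp x * (y - x)) ≤ (S.b s + S.d s) * (exp y - exp x) :=
      mul_le_mul h4 h3 (by have := exp_pos x; have : 0 ≤ y - x := by linarith
                           positivity) (by linarith [S.hk])
    have h6 : S.k * exp (R1 - 2) ≤ S.k * exp x := mul_le_mul_of_nonneg_left h2 S.hk.le
    have h7 : (S.a + S.c) * (y - x) < S.k * exp x * (y - x) := by
      apply mul_lt_mul_of_pos_right _ (by linarith)
      linarith [S.aM, S.cM]
    unfold Ham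
    nlinarith
  rcases lt_trichotomy x y with g | g | g
  · exact absurd e (key _ _ hx g).ne
  · exact g
  · exact absurd e (key _ _ hy g).ne'

lemma Sol.shift_nat {u v : ℝ → ℝ} (h : S.Sol u v) (m : ℕ) :
    S.Sol (fun t => u (t + m * S.T)) (fun t => v (t + m * S.T)) := by
  induction m with
  | zero => simpa using h
  | succ n ih =>
    have := ih.shift
    have e : ∀ t : ℝ, t + S.T + n * S.T = t + ((n + 1 : ℕ) : ℝ) * S.T := by
      intro t; push_cast; ring
    simpa only [e] using this

/-- periodic orbit based at `s` -/
structure Orb (S : Sys) (m : ℕ) (s : ℝ) (u v : ℝ → ℝ) : Prop where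
  sol : S.Sol u v
  pu : ∀ t, u (t + m * S.T) = u t
  pv : ∀ t, v (t + m * S.T) = v t
  eq : u s = v s
  pos : 0 < u s
  iso : ∀ t, s < t → t < s + m * S.T → u t = v t → u t < 0

lemma Orb.grid {m : ℕ} {s t : ℝ} {u v : ℝ → ℝ} (h : S.Orb m s u v) (hm : 1 ≤ m)
    (e : u t = v t) (p : 0 < u t) : ∃ n : ℤ, t = s + n * (m * S.T) := by
  have hm' : (0:ℝ) < m * S.T := mul_pos (by exact_mod_cast hm) S.hT
  have hper : Function.Periodic (fun t => (u t, v t)) (m * S.T) := fun t => by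
    simp [h.pu t, h.pv t]
  refine ⟨⌊(t - s) / (m * S.T)⌋, ?_⟩
  set n := ⌊(t - s) / (m * S.T)⌋ with hn
  have h1 := Int.floor_le ((t - s) / (m * S.T))
  have h2 := Int.lt_floor_add_one ((t - s) / (m * S.T))
  rw [← hn] at h1 h2
  rw [le_div_iff₀ hm'] at h1
  rw [div_lt_iff₀ hm'] at h2
  have h3 := hper.sub_int_mul_eq n (x := t)
  simp only [Prod.mk.injEq] at h3
  by_contra hne
  have h4 : s < t - n * (m * S.T) := by
    rcases lt_or_eq_of_le h1 with g | g
    · linarith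
    · exact absurd (by linarith) hne
  have := h.iso _ h4 (by linarith) (by rw [h3.1, h3.2, e])
  rw [h3.1] at this
  linarith

lemma Sec.orb {m : ℕ} (h : S.Sec ε1 R1 R0 (m * S.T) r) (s : ℝ)
    (e : S.Ham s (r s) - S.Ham s (S.uu s (r s) (s + m * S.T)) = 0) :
    S.Orb m s (S.uu s (r s)) (S.vv s (r s)) := by
  obtain ⟨τ, H⟩ := h.ret s
  have h1 : r s = S.uu s (r s) (s + m * S.T) :=
    h.par.ham_inj s (h.par.R10.trans (h.ge s)) H.top (by linarith)
  have h2 := H.eq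
  have h3 := ((S.sol s (r s)).shift_nat m).unique (S.sol s (r s)) (t₀ := s) (by simp [← h1])
    (by simp [← h2, ← h1])
  refine ⟨S.sol _ _, fun t => (h3 t).1, fun t => (h3 t).2, by simp, ?_, fun t a1 a2 a3 => H.zero a1 a2 a3⟩
  simp only [uu_self]
  linarith [h.ge s, h.par.R10, h.par.R1pos]

theorem main (S : Sys) : ∃ m' : ℕ, 2 ≤ m' ∧ ∃ U V : Fin 2 → ℕ → ℝ → ℝ,
    (∀ i m, m' ≤ m → S.Sol (U i m) (V i m) ∧ (∀ t, U i m (t + m * S.T) = U i m t) ∧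
      (∀ t, V i m (t + m * S.T) = V i m t) ∧
      (∀ j : ℕ, 1 ≤ j → j < m → ¬ (∀ t, U i m (t + j * S.T) = U i m t ∧
        V i m (t + j * S.T) = V i m t))) ∧
    (∀ m, m' ≤ m → ∀ j : ℤ, ¬ (∀ t, U 0 m (t + j * S.T) = U 1 m t ∧
        V 0 m (t + j * S.T) = V 1 m t)) ∧
    (∀ Q, ∀ᶠ m in atTop, ∀ i, (∃ t, Q ≤ U i m t ∧ Q ≤ V i m t) ∧
      (∃ t, U i m t ≤ -Q ∧ V i m t ≤ -Q)) := by
  obtain ⟨ε1, R1, R0, hp⟩ := par_exists S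
  obtain ⟨m0, ρ, hm0, hρ, hinf⟩ := r_exists hp
  have sec : ∀ m, m0 ≤ m → S.Sec ε1 R1 R0 (m * S.T) (ρ m) := fun m hm =>
    ⟨hp, (hρ m hm).1, (hρ m hm).2.1, (hρ m hm).2.2.1, (hρ m hm).2.2.2⟩
  have ex : ∀ m, ∃ s : Fin 2 → ℝ, m0 ≤ m → (∀ i, s i ∈ Ico 0 S.T) ∧ s 0 ≠ s 1 ∧
      ∀ i, S.Orb m (s i) (S.uu (s i) (ρ m (s i))) (S.vv (s i) (ρ m (s i))) := by
    intro m
    by_cases hm : m0 ≤ m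
    · have h := sec m hm
      have pb : ∀ t, S.b (t + m * S.T) = S.b t := fun t =>
        (Function.Periodic.nat_mul (f := S.b) S.bp m) t
      have pd : ∀ t, S.d (t + m * S.T) = S.d t := fun t =>
        (Function.Periodic.nat_mul (f := S.d) S.dp m) t
      obtain ⟨s0, s1, a0, a1, hne, c0, c1⟩ := two_crit S.hT (fun s => h.act_deriv pb pd s)
        (fun s => S.Act_per h.per s)
      refine ⟨![s0, s1], fun _ => ⟨?_, by simpa using hne, ?_⟩⟩
      · intro i; fin_cases i <;> simpa
      · intro i
        fin_cases i
        · exact h.orb s0 c0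
        · exact h.orb s1 c1
    · exact ⟨0, fun h => absurd h hm⟩
  choose σ hσ using ex
  refine ⟨max m0 2, le_max_right _ _, fun i m => S.uu (σ m i) (ρ m (σ m i)),
    fun i m => S.vv (σ m i) (ρ m (σ m i)), ?_, ?_, ?_⟩
  · intro i m hm
    have O := (hσ m (le_trans (le_max_left _ _) hm)).2.2 i
    refine ⟨O.sol, O.pu, O.pv, ?_⟩
    intro j hj hjm hall
    have h1 := hall (σ m i)
    beta_reduce at h1
    have hj' : (0:ℝ) < j := by exact_mod_cast hj
    have hjm' : (j:ℝ) < m := by exact_mod_cast hjm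
    have h2 := O.iso (σ m i + j * S.T) (by have := mul_pos hj' S.hT; linarith)
      (by have := mul_lt_mul_of_pos_right hjm' S.hT; linarith) (by rw [h1.1, h1.2, O.eq])
    rw [h1.1] at h2
    exact absurd O.pos h2.le.not_gt
  · intro m hm j hall
    obtain ⟨hI, hne, hO⟩ := hσ m (le_trans (le_max_left _ _) hm)
    have h1 := hall (σ m 1)
    beta_reduce at h1
    obtain ⟨n, hn⟩ := (hO 0).grid (by omega) (t := σ m 1 + j * S.T)
      (by rw [h1.1, h1.2, (hO 1).eq]) (by rw [h1.1]; exact (hO 1).pos)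
    have h2 : σ m 1 - σ m 0 = ((n * m - j : ℤ) : ℝ) * S.T := by push_cast; linarith
    have i0 := hI 0
    have i1 := hI 1
    have h3 : (n * m - j : ℤ) < 1 := by
      by_contra hc
      have : (1:ℝ) ≤ ((n * m - j : ℤ) : ℝ) := by exact_mod_cast not_lt.1 hc
      nlinarith [i0.1, i1.2, S.hT]
    have h4 : -1 < (n * m - j : ℤ) := by
      by_contra hc
      have : ((n * m - j : ℤ) : ℝ) ≤ -1 := by exact_mod_cast not_lt.1 hc
      nlinarith [i1.1, i0.2, S.hT]
    have h5 : (n * m - j : ℤ) = 0 := by omega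
    rw [h5] at h2
    simp at h2
    exact hne (by linarith)
  · intro Q
    have hw := S.w_pos
    filter_upwards [hinf Q, hinf (Q / S.w), eventually_ge_atTop m0] with m h1 h2 h3 i
    refine ⟨⟨σ m i, by simpa using h1 _, by simpa using h1 _⟩, ?_⟩
    obtain ⟨τ, H⟩ := (hρ m h3).2.1 (σ m i)
    have h4 := h2 (σ m i)
    rw [div_le_iff₀ hw] at h4
    have h5 : S.w * ρ m (σ m i) ≤ S.w * exp (ρ m (σ m i)) :=
      mul_le_mul_of_nonneg_left (by linarith [add_one_le_exp (ρ m (σ m i))]) hw.le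
    have h6 := H.bot
    refine ⟨τ, by linarith, by rw [← H.hτ]; linarith⟩

end Sys
end VS

namespace VS
open Real Set Filter Topology MeasureTheory

lemma prim {T : ℝ} (hT : 0 < T) {f : ℝ → ℝ} (hf : Continuous f) (hp : ∀ t, f (t + T) = f t) :
    ∃ F : ℝ → ℝ, (∀ t, HasDerivAt F (f t - (1 / T) * ∫ t in (0 : ℝ)..T, f t) t) ∧
      ∀ t, F (t + T) = F t := by
  set m := (1 / T) * ∫ t in (0 : ℝ)..T, f t with hm
  have hc : Continuous fun t => f t - m := by fun_prop
  refine ⟨fun t => ∫ s in (0:ℝ)..t, (f s - m), fun t => ?_, fun t => ?_⟩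
  · exact intervalIntegral.integral_hasDerivAt_right (hc.intervalIntegrable _ _)
      (hc.stronglyMeasurableAtFilter _ _) hc.continuousAt
  · have hp' : Function.Periodic (fun t => f t - m) T := fun t => by simp [hp t]
    have h1 := hp'.intervalIntegral_add_eq t 0
    have h2 := intervalIntegral.integral_add_adjacent_intervals (μ := volume)
      (hc.intervalIntegrable 0 t) (hc.intervalIntegrable t (t + T))
    have h3 : ∫ s in (0:ℝ)..(0 + T), (f s - m) = 0 := by
      rw [intervalIntegral.integral_sub (hf.intervalIntegrable _ _) (by simp)]
      simp only [intervalIntegral.integral_const, smul_eq_mul, zero_add, sub_zero]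
      rw [hm]
      field_simp
      ring
    beta_reduce
    rw [← h2, h1, h3, add_zero]

lemma per_pos {T : ℝ} (hT : 0 < T) {f : ℝ → ℝ} (hf : Continuous f) (hp : ∀ t, f (t + T) = f t)
    (hpos : ∀ t ∈ Icc 0 T, 0 < f t) : ∃ k, 0 < k ∧ ∀ t, k ≤ f t := by
  obtain ⟨q, hq, hqm⟩ := isCompact_Icc.exists_isMinOn (s := Icc 0 T) ⟨0, le_rfl, hT.le⟩
    hf.continuousOn
  refine ⟨f q, hpos q hq, fun t => ?_⟩
  obtain ⟨y, hy, e⟩ := Function.Periodic.exists_mem_Ico₀ (f := f) (c := T) hp hT t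
  rw [e]
  exact hqm ⟨hy.1, hy.2.le⟩

lemma tendsto_inf {T : ℝ} (hT : 0 < T) {g : ℕ → ℝ → ℝ} {m' : ℕ} (hm' : 2 ≤ m')
    (h0 : ∀ m, m' ≤ m → ∀ t, 0 < g m t) (hp : ∀ m, m' ≤ m → ∀ t, g m (t + m * T) = g m t)
    (h : ∀ ε, 0 < ε → ∀ᶠ m in atTop, ∃ t, g m t ≤ ε) :
    Tendsto (fun m : ℕ => sInf (g m '' Icc 0 (m * T))) atTop (𝓝 0) := by
  rw [Metric.tendsto_nhds]
  intro ε hε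
  filter_upwards [h (ε / 2) (by linarith), eventually_ge_atTop m'] with m ⟨t, ht⟩ hm
  have hmT : (0:ℝ) < m * T := mul_pos (by exact_mod_cast (by omega : 0 < m)) hT
  obtain ⟨y, hy, e⟩ := Function.Periodic.exists_mem_Ico₀ (f := g m) (c := m * T) (hp m hm) hmT t
  have h1 : sInf (g m '' Icc 0 (m * T)) ≤ g m y :=
    csInf_le ⟨0, by rintro _ ⟨z, -, rfl⟩; exact (h0 m hm z).le⟩ ⟨y, ⟨hy.1, hy.2.le⟩, rfl⟩
  have h2 : 0 ≤ sInf (g m '' Icc 0 (m * T)) :=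
    Real.sInf_nonneg (by rintro _ ⟨z, -, rfl⟩; exact (h0 m hm z).le)
  rw [Real.dist_eq, sub_zero, abs_of_nonneg h2]
  linarith

lemma tendsto_sup {T : ℝ} (hT : 0 < T) {g : ℕ → ℝ → ℝ} {m' : ℕ} (hm' : 2 ≤ m')
    (hc : ∀ m, m' ≤ m → Continuous (g m)) (hp : ∀ m, m' ≤ m → ∀ t, g m (t + m * T) = g m t)
    (h : ∀ Q, ∀ᶠ m in atTop, ∃ t, Q ≤ g m t) :
    Tendsto (fun m : ℕ => sSup (g m '' Icc 0 (m * T))) atTop atTop := by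
  rw [tendsto_atTop]
  intro Q
  filter_upwards [h Q, eventually_ge_atTop m'] with m ⟨t, ht⟩ hm
  have hmT : (0:ℝ) < m * T := mul_pos (by exact_mod_cast (by omega : 0 < m)) hT
  obtain ⟨y, hy, e⟩ := Function.Periodic.exists_mem_Ico₀ (f := g m) (c := m * T) (hp m hm) hmT t
  have h1 : g m y ≤ sSup (g m '' Icc 0 (m * T)) :=
    le_csSup (isCompact_Icc.image (hc m hm)).bddAbove ⟨y, ⟨hy.1, hy.2.le⟩, rfl⟩
  linarith

lemma ev_small {g u : ℕ → ℝ → ℝ} {A : ℝ → ℝ} {B : ℝ} (hB : ∀ t, A t ≤ B)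
    (hg : ∀ m t, g m t = exp (u m t + A t))
    (h : ∀ Q, ∀ᶠ m in atTop, ∃ t, u m t ≤ -Q) :
    ∀ ε, 0 < ε → ∀ᶠ m in atTop, ∃ t, g m t ≤ ε := by
  intro ε hε
  filter_upwards [h (B - log ε)] with m ⟨t, ht⟩
  refine ⟨t, ?_⟩
  rw [hg, ← Real.le_log_iff_exp_le hε]
  linarith [hB t]

lemma ev_large {g u : ℕ → ℝ → ℝ} {A : ℝ → ℝ} {B : ℝ} (hB : ∀ t, -B ≤ A t)
    (hg : ∀ m t, g m t = exp (u m t + A t))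
    (h : ∀ Q, ∀ᶠ m in atTop, ∃ t, Q ≤ u m t) :
    ∀ Q, ∀ᶠ m in atTop, ∃ t, Q ≤ g m t := by
  intro Q
  filter_upwards [h (Q + B)] with m ⟨t, ht⟩
  refine ⟨t, ?_⟩
  rw [hg]
  linarith [hB t, add_one_le_exp (u m t + A t)]

end VS

/-- Under the assumptions of Theorem 1.1 on the `T`-periodic Volterra
system, there is `m* ≥ 2` such that for each `m ≥ m*` there are at least two positive
subharmonic solutions of order `m` (indexed by `i ∈ Fin 2`), not in the same periodicity
class; moreover their minima over a period tend to `0` and their maxima tend to `+∞` as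
`m → ∞`. -/
theorem volterra_subharmonics (T : ℝ) (hT : 0 < T) (a b c d : ℝ → ℝ)
    (hac : Continuous a) (hbc : Continuous b) (hcc : Continuous c) (hdc : Continuous d)
    (hap : ∀ t, a (t + T) = a t) (hbp : ∀ t, b (t + T) = b t)
    (hcp : ∀ t, c (t + T) = c t) (hdp : ∀ t, d (t + T) = d t)
    (hbpos : ∀ t ∈ Set.Icc (0 : ℝ) T, 0 < b t)
    (hdpos : ∀ t ∈ Set.Icc (0 : ℝ) T, 0 < d t)
    (habar : 0 < (1 / T) * ∫ t in (0 : ℝ)..T, a t)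
    (hcbar : 0 < (1 / T) * ∫ t in (0 : ℝ)..T, c t) :
    ∃ m' : ℕ, 2 ≤ m' ∧ ∃ xx yy : Fin 2 → ℕ → ℝ → ℝ,
      (∀ (i : Fin 2) (m : ℕ), m' ≤ m →
        (∀ t, 0 < xx i m t) ∧ (∀ t, 0 < yy i m t) ∧
        (∀ t, xx i m (t + (m : ℝ) * T) = xx i m t) ∧
        (∀ t, yy i m (t + (m : ℝ) * T) = yy i m t) ∧
        (∀ t, HasDerivAt (xx i m) (xx i m t * (a t - b t * yy i m t)) t) ∧
        (∀ t, HasDerivAt (yy i m) (yy i m t * (-(c t) + d t * xx i m t)) t) ∧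
        (∀ j : ℕ, 1 ≤ j → j < m →
          ¬ (∀ t, xx i m (t + (j : ℝ) * T) = xx i m t ∧
              yy i m (t + (j : ℝ) * T) = yy i m t))) ∧
      (∀ m : ℕ, m' ≤ m → ∀ j : ℤ,
        ¬ (∀ t, xx 0 m (t + (j : ℝ) * T) = xx 1 m t ∧
            yy 0 m (t + (j : ℝ) * T) = yy 1 m t)) ∧
      (∀ i : Fin 2,
        Filter.Tendsto (fun m : ℕ => sInf (xx i m '' Set.Icc 0 ((m : ℝ) * T)))
          Filter.atTop (nhds 0) ∧
        Filter.Tendsto (fun m : ℕ => sInf (yy i m '' Set.Icc 0 ((m : ℝ) * T)))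
          Filter.atTop (nhds 0) ∧
        Filter.Tendsto (fun m : ℕ => sSup (xx i m '' Set.Icc 0 ((m : ℝ) * T)))
          Filter.atTop Filter.atTop ∧
        Filter.Tendsto (fun m : ℕ => sSup (yy i m '' Set.Icc 0 ((m : ℝ) * T)))
          Filter.atTop Filter.atTop) := by
  obtain ⟨A, hA, pA⟩ := VS.prim hT hac hap
  obtain ⟨C, hC, pC⟩ := VS.prim hT hcc hcp
  set α := (1 / T) * ∫ t in (0 : ℝ)..T, a t with hα
  set γ := (1 / T) * ∫ t in (0 : ℝ)..T, c t with hγ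
  have cA : Continuous A := continuous_iff_continuousAt.2 fun s => (hA s).continuousAt
  have cC : Continuous C := continuous_iff_continuousAt.2 fun s => (hC s).continuousAt
  have cb : Continuous fun t => b t * Real.exp (-C t) := by fun_prop
  have cd : Continuous fun t => d t * Real.exp (A t) := by fun_prop
  have pb : ∀ t, b (t + T) * Real.exp (-C (t + T)) = b t * Real.exp (-C t) := fun t => by
    rw [hbp, pC]
  have pd : ∀ t, d (t + T) * Real.exp (A (t + T)) = d t * Real.exp (A t) := fun t => by
    rw [hdp, pA]
  obtain ⟨kb, kb0, hkb⟩ := VS.per_pos hT cb pb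
    (fun t ht => mul_pos (hbpos t ht) (Real.exp_pos _))
  obtain ⟨kd, kd0, hkd⟩ := VS.per_pos hT cd pd
    (fun t ht => mul_pos (hdpos t ht) (Real.exp_pos _))
  obtain ⟨Mb, hMb⟩ := VS.Sys.per_bdd hT cb pb
  obtain ⟨Md, hMd⟩ := VS.Sys.per_bdd hT cd pd
  obtain ⟨A1, hA1⟩ := VS.Sys.per_bdd hT cA pA
  obtain ⟨A2, hA2⟩ := VS.Sys.per_bdd hT cA.neg (fun t => by simp [pA t])
  obtain ⟨C1, hC1⟩ := VS.Sys.per_bdd hT cC pC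
  obtain ⟨C2, hC2⟩ := VS.Sys.per_bdd hT cC.neg (fun t => by simp [pC t])
  obtain ⟨k, hk, hk1, hk2, hk3, hk4, hk5⟩ : ∃ k : ℝ, 0 < k ∧ k ≤ 1 ∧ k ≤ α ∧ k ≤ γ ∧ k ≤ kb ∧ k ≤ kd :=
    ⟨min 1 (min α (min γ (min kb kd))), by positivity, by simp, by simp, by simp, by simp, by simp⟩
  obtain ⟨M, hM1, hM2, hM3, hM4, hM5⟩ : ∃ M : ℝ, 1 ≤ M ∧ α ≤ M ∧ γ ≤ M ∧ Mb ≤ M ∧ Md ≤ M :=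
    ⟨max 1 (max α (max γ (max Mb Md))), by simp, by simp, by simp, by simp, by simp⟩
  let S : VS.Sys := { a := α, c := γ, b := fun t => b t * Real.exp (-C t),
                      d := fun t => d t * Real.exp (A t), T := T, k := k, M := M,
                      hT := hT, hk := hk, hk1 := hk1, hM := hM1, ka := hk2, aM := hM2,
                      kc := hk3, cM := hM3, bc := cb, dc := cd, bp := pb, dp := pd,
                      kb := fun t => hk4.trans (hkb t), bM := fun t => (hMb t).trans hM4,
                      kd := fun t => hk5.trans (hkd t), dM := fun t => (hMd t).trans hM5 }
  obtain ⟨m', hm', U, V, h1, h2, h3⟩ := S.main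
  have ST : S.T = T := rfl
  rw [ST] at h1 h2
  have nA : ∀ (n : ℕ) t, A (t + n * T) = A t := fun n t =>
    (Function.Periodic.nat_mul (f := A) pA n) t
  have nC : ∀ (n : ℕ) t, C (t + n * T) = C t := fun n t =>
    (Function.Periodic.nat_mul (f := C) pC n) t
  have zA : ∀ (n : ℤ) t, A (t + n * T) = A t := fun n t =>
    (Function.Periodic.int_mul (f := A) pA n) t
  have zC : ∀ (n : ℤ) t, C (t + n * T) = C t := fun n t =>
    (Function.Periodic.int_mul (f := C) pC n) t
  have px : ∀ i m, m' ≤ m → ∀ t, Real.exp (U i m (t + m * T) + A (t + m * T))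
      = Real.exp (U i m t + A t) := fun i m hm t => by rw [nA, (h1 i m hm).2.1]
  have py : ∀ i m, m' ≤ m → ∀ t, Real.exp (V i m (t + m * T) + -C (t + m * T))
      = Real.exp (V i m t + -C t) := fun i m hm t => by rw [nC, (h1 i m hm).2.2.1]
  refine ⟨m', hm', fun i m t => Real.exp (U i m t + A t), fun i m t => Real.exp (V i m t + -C t),
    ?_, ?_, ?_⟩
  · intro i m hm
    obtain ⟨sol, -, -, np⟩ := h1 i m hm
    refine ⟨fun t => Real.exp_pos _, fun t => Real.exp_pos _, px i m hm, py i m hm, ?_, ?_, ?_⟩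
    · intro t
      have h := (((sol t).1).add (hA t)).exp
      refine HasDerivAt.congr_deriv h ?_
      simp only [Pi.add_apply, S]
      rw [Real.exp_add (V i m t)]
      ring
    · intro t
      have h := (((sol t).2).add (hC t).neg).exp
      refine HasDerivAt.congr_deriv h ?_
      simp only [Pi.add_apply, Pi.neg_apply, S]
      rw [Real.exp_add (U i m t)]
      ring
    · intro j hj hjm hall
      refine np j hj hjm fun t => ?_
      have h := hall t
      simp only [Real.exp_eq_exp, nA, nC, add_left_inj] at h
      exact h
  · intro m hm j hall
    refine h2 m hm j fun t => ?_
    have h := hall t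
    simp only [Real.exp_eq_exp, zA, zC, add_left_inj] at h
    exact h
  · intro i
    have cx : ∀ m, m' ≤ m → Continuous fun t => Real.exp (U i m t + A t) := fun m hm => by
      have := (h1 i m hm).1.cu
      fun_prop
    have cy : ∀ m, m' ≤ m → Continuous fun t => Real.exp (V i m t + -C t) := fun m hm => by
      have := (h1 i m hm).1.cv
      fun_prop
    refine ⟨VS.tendsto_inf hT hm' (fun m _ t => Real.exp_pos _) (px i) ?_,
      VS.tendsto_inf hT hm' (fun m _ t => Real.exp_pos _) (py i) ?_,
      VS.tendsto_sup hT hm' cx (px i) ?_, VS.tendsto_sup hT hm' cy (py i) ?_⟩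
    · exact VS.ev_small (u := U i) hA1 (fun m t => rfl) fun Q =>
        (h3 Q).mono fun m h => (h i).2.imp fun t h => h.1
    · exact VS.ev_small (u := V i) (A := fun t => -C t) hC2 (fun m t => rfl) fun Q =>
        (h3 Q).mono fun m h => (h i).2.imp fun t h => h.2
    · exact VS.ev_large (u := U i) (B := A2) (fun t => neg_le.1 (hA2 t)) (fun m t => rfl) fun Q =>
        (h3 Q).mono fun m h => (h i).1.imp fun t h => h.1
    · exact VS.ev_large (u := V i) (A := fun t => -C t) (B := C1)
        (fun t => by linarith [hC1 t]) (fun m t => rfl) fun Q =>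
        (h3 Q).mono fun m h => (h i).1.imp fun t h => h.2
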